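/- For every ε > 0 there exists a constant C = C(ε) such that for all real X ≥ 2, the sum of h_3(-d)^2 over squarefree integers d with 0 < d < X is at most C · X^{23/18 + ε}. -/

import Mathlib

/-- The imaginary quadratic field `ℚ(√-d)`, realized as the subfield of `ℂ`
generated over `ℚ` by `√d · i`. -/
noncomputable def Kneg (d : ℕ) : IntermediateField ℚ ℂ :=
  IntermediateField.adjoin ℚ {(Real.sqrt d : ℂ) * Complex.I}

/-- `hneg g d` is the `g`-part of the class number of `ℚ(√-d)`: the number of
ideal classes `c` of the ring of integers of `ℚ(√-d)` with `c ^ g = 1`. -/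
noncomputable def hneg (g d : ℕ) : ℕ :=
  Nat.card {c : ClassGroup (NumberField.RingOfIntegers (Kneg d)) // c ^ g = 1}

theorem exists_card_divisors_le_rpow {η : ℝ} (hη : 0 < η) :
    ∃ C : ℝ, 1 ≤ C ∧ ∀ n : ℕ, n ≠ 0 → (n.divisors.card : ℝ) ≤ C * (n : ℝ) ^ η := by
  have hl : 0 < Real.log 2 := Real.log_pos (by norm_num)
  set K : ℝ := 1 + 1 / (η * Real.log 2) with hK
  have hK1 : 1 ≤ K := by rw [hK]; have : 0 < 1 / (η * Real.log 2) := by positivity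
                         linarith
  set B : ℕ := ⌈(2 : ℝ) ^ (1 / η)⌉₊ with hB
  refine ⟨K ^ B, one_le_pow₀ hK1, fun n hn => ?_⟩
  have local_bound : ∀ p ∈ n.primeFactors, ((n.factorization p + 1 : ℕ) : ℝ) ≤
      (if p < B then K else 1) * ((p : ℝ) ^ (n.factorization p)) ^ η := by
    intro p hp
    have hp2 : (2 : ℝ) ≤ p := by exact_mod_cast (Nat.prime_of_mem_primeFactors hp).two_le
    set e := n.factorization p
    have hpow : ((p : ℝ) ^ e) ^ η = ((p : ℝ) ^ η) ^ e := by
      rw [← Real.rpow_natCast, ← Real.rpow_natCast, ← Real.rpow_mul (by linarith),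
        ← Real.rpow_mul (by linarith), mul_comm]
    split_ifs with h
    · have h1 : ((2 : ℝ) ^ e) ^ η ≤ ((p : ℝ) ^ e) ^ η := by gcongr
      have h2 : 1 + e * (η * Real.log 2) ≤ ((2 : ℝ) ^ e) ^ η := by
        have : ((2 : ℝ) ^ e) ^ η = Real.exp (e * (η * Real.log 2)) := by
          rw [← Real.rpow_natCast, ← Real.rpow_mul (by norm_num),
            Real.rpow_def_of_pos (by norm_num)]
          ring_nf
        rw [this]
        linarith [Real.add_one_le_exp (e * (η * Real.log 2))]
      have h3 : ((e + 1 : ℕ) : ℝ) ≤ K * (1 + e * (η * Real.log 2)) := by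
        have : K * (1 + e * (η * Real.log 2)) =
            1 + e + e * (η * Real.log 2) + 1 / (η * Real.log 2) := by
          rw [hK]; field_simp; ring
        rw [this]
        have : 0 ≤ e * (η * Real.log 2) := by positivity
        have : 0 ≤ 1 / (η * Real.log 2) := by positivity
        push_cast; linarith
      calc _ ≤ _ := h3
        _ ≤ _ := by gcongr; exact h2.trans h1
    · rw [one_mul, hpow]
      have h1 : (2 : ℝ) ≤ (p : ℝ) ^ η := by
        have h2 : (2 : ℝ) ^ (1 / η) ≤ p :=
          (Nat.le_ceil _).trans (by exact_mod_cast not_lt.mp h)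
        calc (2 : ℝ) = ((2 : ℝ) ^ (1 / η)) ^ η := by
              rw [← Real.rpow_mul (by norm_num), one_div_mul_cancel hη.ne', Real.rpow_one]
          _ ≤ _ := by gcongr
      have h2 : ((e + 1 : ℕ) : ℝ) ≤ 2 ^ e := by exact_mod_cast Nat.lt_two_pow_self
      exact h2.trans (by gcongr)
  have hprod : (∏ p ∈ n.primeFactors, ((p : ℝ) ^ (n.factorization p)) ^ η) = (n : ℝ) ^ η := by
    rw [Real.finsetProd_rpow _ _ (fun i _ => by positivity)]
    congr 1
    conv_rhs => rw [← Nat.prod_factorization_pow_eq_self hn]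
    rw [Finsupp.prod]; push_cast; rfl
  rw [Nat.card_divisors hn]
  push_cast
  calc (∏ p ∈ n.primeFactors, ((n.factorization p : ℝ) + 1))
      ≤ ∏ p ∈ n.primeFactors, ((if p < B then K else 1) *
          ((p : ℝ) ^ (n.factorization p)) ^ η) := by
        refine Finset.prod_le_prod (fun i _ => by positivity) fun p hp => ?_
        exact_mod_cast local_bound p hp
    _ = (∏ p ∈ n.primeFactors, (if p < B then K else 1)) * (n : ℝ) ^ η := by
        rw [Finset.prod_mul_distrib, hprod]
    _ ≤ _ := by
        gcongr
        rw [← Finset.prod_filter, Finset.prod_const]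
        refine pow_le_pow_right₀ hK1 ?_
        calc _ ≤ (Finset.range B).card := Finset.card_le_card (by
              intro p hp; simp at hp ⊢; exact hp.2)
          _ = B := by simp

/-- The odd primes up to `Z`. -/
def oddPrimesLE (Z : ℕ) : Finset ℕ := (Finset.Icc 3 Z).filter Nat.Prime

theorem mem_oddPrimesLE {Z p : ℕ} : p ∈ oddPrimesLE Z ↔ 3 ≤ p ∧ p ≤ Z ∧ p.Prime := by
  simp [oddPrimesLE, and_assoc]

theorem exists_rpow_le_card_oddPrimesLE {η : ℝ} (hη : 0 < η) :
    ∃ C : ℝ, 1 ≤ C ∧ ∀ Z : ℕ, 3 ≤ Z → (Z : ℝ) ≤ C * (Z : ℝ) ^ η * (oddPrimesLE Z).card := by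
  refine ⟨max 1 (20 / η), le_max_left _ _, fun Z hZ => ?_⟩
  have hZ3 : (3 : ℝ) ≤ Z := by exact_mod_cast hZ
  have hpi : Nat.primeCounting Z ≤ (oddPrimesLE Z).card + 1 := by
    rw [Nat.primeCounting, Nat.primeCounting', Nat.count_eq_card_filter_range]
    calc _ ≤ (insert 2 (oddPrimesLE Z)).card := Finset.card_le_card (by
          intro p hp
          simp only [Finset.mem_filter, Finset.mem_range, Finset.mem_insert,
            mem_oddPrimesLE] at hp ⊢
          have := hp.2.two_le
          by_cases h : p = 2
          · exact Or.inl h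
          · exact Or.inr ⟨by omega, by omega, hp.2⟩)
      _ ≤ _ := Finset.card_insert_le _ _
  have h1 : 1 ≤ (oddPrimesLE Z).card := Finset.card_pos.mpr
    ⟨3, mem_oddPrimesLE.mpr ⟨le_rfl, hZ, Nat.prime_three⟩⟩
  have hpi2 : (Nat.primeCounting Z : ℝ) ≤ 2 * (oddPrimesLE Z).card := by
    have : Nat.primeCounting Z ≤ 2 * (oddPrimesLE Z).card := by omega
    exact_mod_cast this
  have hge := Chebyshev.pi_ge Z
  have hlogpos : 0 < Real.log Z := Real.log_pos (by linarith)
  rw [div_le_iff₀ hlogpos] at hge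
  have hlog2 := Real.log_two_gt_d9
  have hlog4 : Real.log (Z + 1) ≤ (Z + 1) / 4 + 2 * Real.log 2 - 1 := by
    have h := Real.log_le_sub_one_of_pos (show (0 : ℝ) < (Z + 1) / 4 by positivity)
    rw [Real.log_div (by positivity) (by norm_num)] at h
    have : Real.log 4 = 2 * Real.log 2 := by
      rw [show (4 : ℝ) = 2 ^ 2 by norm_num, Real.log_pow]; norm_num
    linarith
  have hlow : (Z : ℝ) / 10 ≤ Z * Real.log 2 - Real.log (Z + 1) := by
    have := Real.log_two_lt_d9
    nlinarith
  have hlogle : Real.log Z ≤ (Z : ℝ) ^ η / η := Real.log_le_rpow_div (by positivity) hη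
  have : (Z : ℝ) ≤ 20 * (oddPrimesLE Z).card * ((Z : ℝ) ^ η / η) := by
    have h2 : (Nat.primeCounting Z : ℝ) * Real.log Z ≤
        2 * (oddPrimesLE Z).card * ((Z : ℝ) ^ η / η) := by gcongr
    linarith
  calc (Z : ℝ) ≤ _ := this
    _ = 20 / η * (Z : ℝ) ^ η * (oddPrimesLE Z).card := by ring
    _ ≤ _ := by gcongr; exact le_max_right _ _

theorem card_units_sq_eq_one_two_pow_le (a : ℕ) (ha : 0 < a) :
    Nat.card {x : (ZMod (2 ^ a))ˣ // x ^ 2 = 1} ≤ 4 := by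
  classical
  let T : Finset (ZMod (2 ^ a)) :=
    {1, -1, 1 + ((2 ^ (a - 1) : ℤ) : ZMod (2 ^ a)), -1 + ((2 ^ (a - 1) : ℤ) : ZMod (2 ^ a))}
  have key : ∀ x : (ZMod (2 ^ a))ˣ, x ^ 2 = 1 → (x : ZMod (2 ^ a)) ∈ T := by
    intro x hx
    obtain ⟨v, hv⟩ := ZMod.intCast_surjective (x : ZMod (2 ^ a))
    have hx' : (x : ZMod (2 ^ a)) ^ 2 = 1 := by
      rw [← Units.val_pow_eq_pow_val, hx, Units.val_one]
    rw [← hv] at hx'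
    have hzero : ((v ^ 2 - 1 : ℤ) : ZMod (2 ^ a)) = 0 := by push_cast; rw [hx']; ring
    rw [ZMod.intCast_zmod_eq_zero_iff_dvd] at hzero
    push_cast at hzero
    have htop : ((2 ^ a : ℤ) : ZMod (2 ^ a)) = 0 := by
      rw [ZMod.intCast_zmod_eq_zero_iff_dvd]; push_cast; exact dvd_rfl
    have hodd : Odd v := by
      have h2 : (2 : ℤ) ∣ v ^ 2 - 1 := (dvd_pow_self 2 ha.ne').trans hzero
      by_contra h
      rw [Int.not_odd_iff_even] at h
      obtain ⟨w, rfl⟩ := h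
      have : (2 : ℤ) ∣ 1 := by
        have h3 : (2 : ℤ) ∣ (w + w) ^ 2 := ⟨2 * w ^ 2, by ring⟩
        simpa using dvd_sub h3 h2
      norm_num at this
    obtain ⟨y, rfl⟩ := hodd
    rw [← hv]
    simp only [T, Finset.mem_insert, Finset.mem_singleton]
    rcases Nat.lt_or_ge a 2 with h2 | h2
    · have : a = 1 := by omega
      subst this
      left
      have : ((2 * y : ℤ) : ZMod (2 ^ 1)) = 0 := by
        rw [ZMod.intCast_zmod_eq_zero_iff_dvd]; exact ⟨y, by norm_num⟩
      rw [Int.cast_add, this]; simp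
    · obtain ⟨n, rfl⟩ := Nat.exists_eq_add_of_le' h2
      have h4 : (2 : ℤ) ^ n ∣ y * (y + 1) := by
        have : (4 : ℤ) * 2 ^ n ∣ 4 * (y * (y + 1)) := by
          convert hzero using 1
          · ring
          · ring
        exact (mul_dvd_mul_iff_left (by norm_num)).mp this
      have hcop : IsCoprime y (y + 1) := ⟨-1, 1, by ring⟩
      have hsub : n + 2 - 1 = n + 1 := by omega
      rw [hsub]
      have cases : (2 : ℤ) ^ n ∣ y ∨ (2 : ℤ) ^ n ∣ y + 1 := by
        by_cases h : (2 : ℤ) ∣ y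
        · left
          have : ¬ (2 : ℤ) ∣ y + 1 := by omega
          exact Prime.pow_dvd_of_dvd_mul_right Int.prime_two n this h4
        · right
          exact Prime.pow_dvd_of_dvd_mul_left Int.prime_two n h h4
      rcases cases with ⟨z, rfl⟩ | ⟨z, hz⟩
      · rcases Int.even_or_odd' z with ⟨w, rfl | rfl⟩
        · left
          have : (2 * (2 ^ n * (2 * w)) + 1 : ℤ) = 2 ^ (n + 2) * w + 1 := by ring
          rw [this, Int.cast_add, Int.cast_mul, htop]; simp
        · right; right; left
          have : (2 * (2 ^ n * (2 * w + 1)) + 1 : ℤ) = 2 ^ (n + 2) * w + (1 + 2 ^ (n + 1)) := by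
            ring
          rw [this, Int.cast_add, Int.cast_mul, htop]; simp
      · have hy : y = 2 ^ n * z - 1 := by linarith
        subst hy
        rcases Int.even_or_odd' z with ⟨w, rfl | rfl⟩
        · right; left
          have : (2 * (2 ^ n * (2 * w) - 1) + 1 : ℤ) = 2 ^ (n + 2) * w + -1 := by ring
          rw [this, Int.cast_add, Int.cast_mul, htop]; simp
        · right; right; right
          have : (2 * (2 ^ n * (2 * w + 1) - 1) + 1 : ℤ) =
            2 ^ (n + 2) * w + (-1 + 2 ^ (n + 1)) := by ring
          rw [this, Int.cast_add, Int.cast_mul, htop]; simp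
  let f : {x : (ZMod (2 ^ a))ˣ // x ^ 2 = 1} → T := fun x => ⟨x.1, key x.1 x.2⟩
  have hf : Function.Injective f := by
    intro x y h
    have : (x.1 : ZMod (2 ^ a)) = y.1 := congrArg Subtype.val h
    exact Subtype.ext (Units.ext this)
  calc _ ≤ Nat.card T := Nat.card_le_card_of_injective f hf
    _ = T.card := by simp
    _ ≤ 4 := Finset.card_le_four

theorem card_units_pow_eq_one_le {k : ℕ} (hk : k = 2 ∨ k = 3) (m : ℕ) (hm : m ≠ 0) :
    Nat.card {x : (ZMod m)ˣ // x ^ k = 1} ≤ m.divisors.card ^ 2 := by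
  classical
  induction m using Nat.recOnPosPrimePosCoprime with
  | zero => exact absurd rfl hm
  | one =>
    have : Subsingleton (ZMod 1)ˣ := inferInstance
    have : Subsingleton {x : (ZMod 1)ˣ // x ^ k = 1} := inferInstance
    simpa using (Finite.card_le_one_iff_subsingleton).mpr this
  | prime_pow p n hp hn =>
    have hdiv : (p ^ n).divisors.card = n + 1 := by rw [Nat.divisors_prime_pow hp]; simp
    have h4 : 4 ≤ (p ^ n).divisors.card ^ 2 := by rw [hdiv]; nlinarith
    refine le_trans ?_ h4
    have : NeZero (p ^ n) := ⟨hm⟩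
    by_cases hp2 : p = 2
    · subst hp2
      rcases hk with rfl | rfl
      · exact card_units_sq_eq_one_two_pow_le n hn
      · have : Subsingleton {x : (ZMod (2 ^ n))ˣ // x ^ 3 = 1} := by
          have aux : ∀ x : (ZMod (2 ^ n))ˣ, x ^ 3 = 1 → x = 1 := by
            intro x hx
            have h1 : orderOf x ∣ 3 := orderOf_dvd_of_pow_eq_one hx
            have h2 : orderOf x ∣ 2 ^ (n - 1) := by
              have := orderOf_dvd_card (x := x)
              rw [ZMod.card_units_eq_totient, Nat.totient_prime_pow Nat.prime_two hn] at this
              simpa using this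
            have h3 : Nat.Coprime 3 (2 ^ (n - 1)) := Nat.Coprime.pow_right _ (by norm_num)
            exact orderOf_eq_one_iff.mp (Nat.eq_one_of_dvd_coprimes h3 h1 h2)
          exact ⟨fun x y => Subtype.ext (by rw [aux _ x.2, aux _ y.2])⟩
        exact ((Finite.card_le_one_iff_subsingleton).mpr this).trans (by norm_num)
    · have := ZMod.isCyclic_units_of_prime_pow p hp hp2 n
      have h := IsCyclic.card_pow_eq_one_le (α := (ZMod (p ^ n))ˣ) (n := k)
        (by rcases hk with rfl | rfl <;> norm_num)
      rw [Nat.card_eq_fintype_card, Fintype.card_subtype]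
      exact h.trans (by rcases hk with rfl | rfl <;> norm_num)
  | coprime a b ha hb hab iha ihb =>
    have : NeZero a := ⟨by omega⟩
    have : NeZero b := ⟨by omega⟩
    have iha' := iha (by omega)
    have ihb' := ihb (by omega)
    let e : (ZMod (a * b))ˣ ≃* (ZMod a)ˣ × (ZMod b)ˣ :=
      (Units.mapEquiv (ZMod.chineseRemainder hab).toMulEquiv).trans MulEquiv.prodUnits
    let f : {x : (ZMod (a * b))ˣ // x ^ k = 1} →
        {x : (ZMod a)ˣ // x ^ k = 1} × {x : (ZMod b)ˣ // x ^ k = 1} := fun x =>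
      (⟨(e x.1).1, by rw [← Prod.pow_fst, ← map_pow, x.2, map_one]; rfl⟩,
       ⟨(e x.1).2, by rw [← Prod.pow_snd, ← map_pow, x.2, map_one]; rfl⟩)
    have hf : Function.Injective f := by
      intro x y h
      have h1 := congrArg Subtype.val (congrArg Prod.fst h)
      have h2 := congrArg Subtype.val (congrArg Prod.snd h)
      exact Subtype.ext (e.injective (Prod.ext h1 h2))
    calc _ ≤ _ := Nat.card_le_card_of_injective f hf
      _ = _ := Nat.card_prod _ _
      _ ≤ _ := Nat.mul_le_mul iha' ihb'
      _ = _ := by rw [hab.card_divisors_mul, mul_pow]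

theorem card_pow_eq_le {k : ℕ} (hk : k = 2 ∨ k = 3) {m : ℕ} (hm : m ≠ 0) (c : ZMod m)
    (hc : IsUnit c) (T : Finset (ZMod m)) (hT : ∀ x ∈ T, x ^ k = c) :
    T.card ≤ m.divisors.card ^ 2 := by
  classical
  have : NeZero m := ⟨hm⟩
  have hk0 : k ≠ 0 := by rcases hk with rfl | rfl <;> norm_num
  rcases T.eq_empty_or_nonempty with rfl | ⟨x₀, hx₀⟩
  · simp
  have hu : ∀ x ∈ T, IsUnit x := fun x hx => (isUnit_pow_iff hk0).mp (by rw [hT x hx]; exact hc)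
  let u : T → (ZMod m)ˣ := fun x => (hu x.1 x.2).unit
  have hupow : ∀ x : T, (u x) ^ k = hc.unit := fun x => Units.ext (by simp [u, hT x.1 x.2])
  let f : T → {x : (ZMod m)ˣ // x ^ k = 1} := fun x =>
    ⟨u x * (u ⟨x₀, hx₀⟩)⁻¹, by rw [mul_pow, inv_pow, hupow, hupow, mul_inv_cancel]⟩
  have hf : Function.Injective f := by
    intro x y h
    have h1 := mul_right_cancel (congrArg Subtype.val h)
    exact Subtype.ext (by simpa [u] using congrArg Units.val h1)
  calc T.card = Nat.card T := by simp
    _ ≤ _ := Nat.card_le_card_of_injective f hf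
    _ ≤ _ := card_units_pow_eq_one_le hk m hm

/-- An interval of length `L` contains at most `τ(m)² (L / m + 1)` solutions of the congruence
`x ^ k ≡ c` modulo `m`, for `k = 2, 3` and `c` coprime to `m`. -/
theorem card_pow_congr_le {k : ℕ} (hk : k = 2 ∨ k = 3) {m : ℕ} (hm : m ≠ 0) (c : ℤ)
    (hc : IsCoprime c (m : ℤ)) (S : Finset ℤ) (A : ℤ) (L : ℕ)
    (hS : ∀ x ∈ S, A ≤ x ∧ x ≤ A + L ∧ (m : ℤ) ∣ x ^ k - c) :
    S.card ≤ m.divisors.card ^ 2 * (L / m + 1) := by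
  classical
  have hm0 : (0 : ℤ) < m := by exact_mod_cast Nat.pos_of_ne_zero hm
  let T : Finset (ZMod m) := S.image (fun x : ℤ => (x : ZMod m))
  have hcu : IsUnit (c : ZMod m) := by
    obtain ⟨a, b, hab⟩ := hc
    refine IsUnit.of_mul_eq_one (a : ZMod m) ?_
    have := congrArg (fun z : ℤ => (z : ZMod m)) hab
    push_cast at this
    rw [ZMod.natCast_self, mul_zero, add_zero] at this
    rw [mul_comm]; exact this
  have hT : T.card ≤ m.divisors.card ^ 2 := by
    refine card_pow_eq_le hk hm _ hcu T fun x hx => ?_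
    obtain ⟨y, hy, rfl⟩ := Finset.mem_image.mp hx
    have := (ZMod.intCast_zmod_eq_zero_iff_dvd _ _).mpr (hS y hy).2.2
    push_cast at this
    exact sub_eq_zero.mp this
  let g : ℤ → ZMod m × ℕ := fun x => ((x : ZMod m), ((x - A) / m).toNat)
  have hmaps : ∀ x ∈ S, g x ∈ T ×ˢ Finset.range (L / m + 1) := by
    intro x hx
    obtain ⟨h1, h2, -⟩ := hS x hx
    refine Finset.mem_product.mpr ⟨Finset.mem_image_of_mem _ hx, ?_⟩
    rw [Finset.mem_range]
    have h3 : (x - A) / m ≤ (L : ℤ) / m := Int.ediv_le_ediv hm0 (by linarith)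
    have h4 : 0 ≤ (x - A) / m := Int.ediv_nonneg (by linarith) hm0.le
    have h5 : ((L / m : ℕ) : ℤ) = (L : ℤ) / m := by push_cast; rfl
    simp only [g]
    omega
  have hinj : Set.InjOn g S := by
    intro x hx y hy h
    have h1 : (x : ZMod m) = (y : ZMod m) := congrArg Prod.fst h
    have h2 : ((x - A) / m).toNat = ((y - A) / m).toNat := congrArg Prod.snd h
    have hx4 : 0 ≤ (x - A) / m := Int.ediv_nonneg (by linarith [(hS x hx).1]) hm0.le
    have hy4 : 0 ≤ (y - A) / m := Int.ediv_nonneg (by linarith [(hS y hy).1]) hm0.le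
    have h3 : (x - A) / m = (y - A) / m := by omega
    have h4 : (x - A) % m = (y - A) % m := by
      rw [ZMod.intCast_eq_intCast_iff] at h1
      exact Int.ModEq.sub_right A h1
    have := Int.emod_add_mul_ediv (x - A) m
    have := Int.emod_add_mul_ediv (y - A) m
    rw [h3, h4] at *
    linarith
  calc S.card ≤ (T ×ˢ Finset.range (L / m + 1)).card :=
        Finset.card_le_card_of_injOn g hmaps hinj
    _ = T.card * (L / m + 1) := by simp
    _ ≤ _ := by gcongr

open NumberTheorySymbols in
theorem exists_jacobiSym_eq_neg_one {a : ℕ} (ha : a ≠ 0) (hsq : ¬ IsSquare a) :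
    ∃ n : ℕ, Odd n ∧ jacobiSym a n = -1 := by
  by_cases h : ∃ q, q.Prime ∧ q ≠ 2 ∧ Odd (a.factorization q)
  · obtain ⟨q, hq, hq2, hf⟩ := h
    have : Fact q.Prime := ⟨hq⟩
    obtain ⟨b, hb⟩ := FiniteField.exists_nonsquare (F := ZMod q) (by rwa [ZMod.ringChar_zmod_n])
    set s := ordCompl[q] a with hs
    have hs0 : s ≠ 0 := (Nat.ordCompl_pos q ha).ne'
    set e := s.factorization 2
    set r := ordCompl[2] s with hr
    have hr0 : r ≠ 0 := (Nat.ordCompl_pos 2 hs0).ne'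
    have hrodd : Odd r := Nat.odd_iff.mpr (Nat.two_dvd_ne_zero.mp
      (Nat.not_dvd_ordCompl Nat.prime_two hs0))
    have hqodd : Odd q := hq.odd_of_ne_two hq2
    have hqs : q.Coprime s := Nat.coprime_ordCompl hq ha
    have hqr : q.Coprime r := hqs.coprime_dvd_right (Nat.ordCompl_dvd s 2)
    have hcop : Nat.Coprime (8 * r) q := by
      refine Nat.Coprime.mul_left ?_ hqr.symm
      have : Nat.Coprime 2 q := (Nat.coprime_two_left).mpr hqodd
      simpa using this.pow_left 3
    obtain ⟨n, hn1, hn2⟩ := Nat.chineseRemainder hcop 1 b.val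
    have hn8 : n % 8 = 1 := (hn1.of_dvd ⟨r, rfl⟩ : n ≡ 1 [MOD 8])
    have hnr : n ≡ 1 [MOD r] := hn1.of_dvd ⟨8, mul_comm _ _⟩
    have hnodd : Odd n := by rw [Nat.odd_iff]; omega
    refine ⟨n, hnodd, ?_⟩
    have h2 : jacobiSym (2 : ℕ) n = 1 := by
      rw [Nat.cast_ofNat, jacobiSym.at_two hnodd, ZMod.χ₈_nat_mod_eight, hn8]; rfl
    have hrn : jacobiSym r n = 1 := by
      rw [jacobiSym.quadratic_reciprocity_one_mod_four' hrodd (by omega)]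
      have : jacobiSym (n : ℤ) r = jacobiSym (1 : ℤ) r :=
        jacobiSym.mod_left' (by exact_mod_cast hnr)
      rw [this, jacobiSym.one_left]
    have hqn : jacobiSym q n = -1 := by
      rw [jacobiSym.quadratic_reciprocity_one_mod_four' hqodd (by omega),
        ← jacobiSym.legendreSym.to_jacobiSym, legendreSym.eq_neg_one_iff]
      have : ((n : ℤ) : ZMod q) = b := by
        have := (ZMod.natCast_eq_natCast_iff n b.val q).mpr hn2
        rw [Int.cast_natCast, this, ZMod.natCast_zmod_val]
      rwa [this]
    have hfact : a = q ^ (a.factorization q) * (2 ^ e * r) := by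
      rw [Nat.ordProj_mul_ordCompl_eq_self s 2, Nat.ordProj_mul_ordCompl_eq_self a q]
    rw [hfact]
    push_cast
    rw [jacobiSym.mul_left, jacobiSym.mul_left, jacobiSym.pow_left, jacobiSym.pow_left, hqn, hrn]
    rw [Nat.cast_ofNat] at h2
    rw [h2, hf.neg_one_pow]; simp
  · push Not at h
    set e := a.factorization 2 with he
    set r := ordCompl[2] a with hr
    have hr0 : r ≠ 0 := (Nat.ordCompl_pos 2 ha).ne'
    have hrodd : Odd r := Nat.odd_iff.mpr (Nat.two_dvd_ne_zero.mp
      (Nat.not_dvd_ordCompl Nat.prime_two ha))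
    have hrsq : IsSquare r := by
      have : ∀ q, Even (r.factorization q) := by
        intro q
        by_cases hq : q.Prime
        · by_cases hq2 : q = 2
          · subst hq2; rw [hr, Nat.factorization_ordCompl]; simp
          · rw [hr, Nat.factorization_ordCompl, Finsupp.erase_ne hq2]
            exact Nat.not_odd_iff_even.mp (h q hq hq2)
        · rw [Nat.factorization_eq_zero_of_not_prime _ hq]; simp
      refine ⟨∏ p ∈ r.primeFactors, p ^ (r.factorization p / 2), ?_⟩
      rw [← Finset.prod_mul_distrib]
      conv_lhs => rw [← Nat.prod_factorization_pow_eq_self hr0]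
      rw [Finsupp.prod]
      refine Finset.prod_congr rfl fun p _ => ?_
      rw [← pow_add]
      congr 1
      obtain ⟨t, ht⟩ := this p
      omega
    have hfact : a = 2 ^ e * r := (Nat.ordProj_mul_ordCompl_eq_self a 2).symm
    have heodd : Odd e := by
      by_contra h'
      rw [Nat.not_odd_iff_even] at h'
      exact hsq (by rw [hfact]; exact (h'.isSquare_pow 2).mul hrsq)
    have hcop : Nat.Coprime 8 r := by
      have : Nat.Coprime 2 r := (Nat.coprime_two_left).mpr hrodd
      simpa using this.pow_left 3
    obtain ⟨n, hn1, hn2⟩ := Nat.chineseRemainder hcop 5 1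
    have hn8 : n % 8 = 5 := hn1
    have hnodd : Odd n := by rw [Nat.odd_iff]; omega
    refine ⟨n, hnodd, ?_⟩
    have h2 : jacobiSym 2 n = -1 := by
      rw [jacobiSym.at_two hnodd, ZMod.χ₈_nat_mod_eight, hn8]; rfl
    have hrn : jacobiSym r n = 1 := by
      rw [jacobiSym.quadratic_reciprocity_one_mod_four' hrodd (by omega)]
      have : jacobiSym (n : ℤ) r = jacobiSym (1 : ℤ) r :=
        jacobiSym.mod_left' (by exact_mod_cast hn2)
      rw [this, jacobiSym.one_left]
    rw [hfact]
    push_cast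
    rw [jacobiSym.mul_left, jacobiSym.pow_left, h2, hrn, heodd.neg_one_pow]; simp

/-- The Jacobi symbol `(a / n)` as a function of `n`, set to `0` at even `n`. -/
def oddJacobi (a : ℤ) : ℕ →* ℤ where
  toFun n := if Odd n then jacobiSym a n else 0
  map_one' := by simp
  map_mul' m n := by
    by_cases hm : Odd m
    · by_cases hn : Odd n
      · rw [if_pos hm, if_pos hn, if_pos (hm.mul hn),
          jacobiSym.mul_right' a hm.pos.ne' hn.pos.ne']
      · rw [if_neg hn, if_neg (fun h => hn (Nat.odd_mul.mp h).2), mul_zero]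
    · rw [if_neg hm, if_neg (fun h => hm (Nat.odd_mul.mp h).1), zero_mul]

theorem oddJacobi_apply (a : ℤ) (n : ℕ) :
    oddJacobi a n = if Odd n then jacobiSym a n else 0 := rfl

theorem oddJacobi_mul_left (a b : ℤ) (n : ℕ) :
    oddJacobi (a * b) n = oddJacobi a n * oddJacobi b n := by
  simp only [oddJacobi_apply]
  split_ifs
  · exact jacobiSym.mul_left a b n
  · simp

theorem abs_oddJacobi_le (a : ℤ) (n : ℕ) : |oddJacobi a n| ≤ 1 := by
  rw [oddJacobi_apply]
  split_ifs
  · rcases jacobiSym.trichotomy a n with h | h | h <;> rw [h] <;> norm_num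
  · simp

theorem oddJacobi_periodic (a : ℕ) : Function.Periodic (oddJacobi a) (4 * a) := by
  intro n
  simp only [oddJacobi_apply]
  have hpar : Odd (n + 4 * a) ↔ Odd n := by simp only [Nat.odd_iff]; omega
  by_cases h : Odd n
  · rw [if_pos h, if_pos (hpar.mpr h), jacobiSym.mod_right' a h,
      jacobiSym.mod_right' a (hpar.mpr h), Nat.add_mod_right]
  · rw [if_neg h, if_neg (fun h' => h (hpar.mp h'))]

theorem sum_oddJacobi_period {a : ℕ} (ha : a ≠ 0) (hsq : ¬ IsSquare a) :
    ∑ n ∈ Finset.range (4 * a), oddJacobi a n = 0 := by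
  obtain ⟨n₀, hodd, hn₀⟩ := exists_jacobiSym_eq_neg_one ha hsq
  set M := 4 * a with hM
  have hM0 : 0 < M := by omega
  have hcop : Nat.Coprime n₀ M := by
    have h1 : Nat.Coprime n₀ a := by
      by_contra h
      have : jacobiSym a n₀ = 0 := jacobiSym.eq_zero_iff.mpr
        ⟨hodd.pos.ne', by rw [Int.gcd_natCast_natCast, Nat.gcd_comm]; exact h⟩
      omega
    refine Nat.Coprime.mul_right ?_ h1
    have : Nat.Coprime n₀ 2 := Nat.coprime_two_right.mpr hodd
    simpa using this.pow_right 2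
  have hinj : Set.InjOn (fun n => n * n₀ % M) (Finset.range M) := by
    intro x hx y hy h
    simp only [Finset.coe_range, Set.mem_Iio] at hx hy
    have : x * n₀ ≡ y * n₀ [MOD M] := h
    have := Nat.ModEq.cancel_right_of_coprime (by rwa [Nat.coprime_comm] at hcop) this
    rw [Nat.ModEq, Nat.mod_eq_of_lt hx, Nat.mod_eq_of_lt hy] at this
    exact this
  have himg : (Finset.range M).image (fun n => n * n₀ % M) = Finset.range M := by
    refine Finset.eq_of_subset_of_card_le ?_ ?_
    · intro x hx
      obtain ⟨y, -, rfl⟩ := Finset.mem_image.mp hx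
      exact Finset.mem_range.mpr (Nat.mod_lt _ hM0)
    · rw [Finset.card_image_of_injOn hinj]
  have hval : oddJacobi a n₀ = -1 := by rw [oddJacobi_apply, if_pos hodd, hn₀]
  have h1 : ∑ n ∈ Finset.range M, oddJacobi a n = - ∑ n ∈ Finset.range M, oddJacobi a n := by
    conv_lhs => rw [← himg, Finset.sum_image hinj]
    rw [← Finset.sum_neg_distrib]
    refine Finset.sum_congr rfl fun n _ => ?_
    rw [(oddJacobi_periodic a).map_mod_nat, map_mul, hval]; ring
  omega

theorem abs_sum_oddJacobi_le {a : ℕ} (ha : a ≠ 0) (hsq : ¬ IsSquare a) (N : ℕ) :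
    |∑ n ∈ Finset.range N, oddJacobi a n| ≤ 4 * a := by
  have hper : Function.Periodic (fun N => ∑ n ∈ Finset.range N, oddJacobi a n) (4 * a) := by
    intro N
    dsimp only
    rw [add_comm, Finset.sum_range_add, sum_oddJacobi_period ha hsq, zero_add]
    refine Finset.sum_congr rfl fun n _ => ?_
    rw [add_comm, oddJacobi_periodic a n]
  rw [← hper.map_mod_nat N]
  calc _ ≤ ∑ n ∈ Finset.range (N % (4 * a)), |oddJacobi a n| := Finset.abs_sum_le_sum_abs _ _
    _ ≤ ∑ n ∈ Finset.range (N % (4 * a)), 1 := Finset.sum_le_sum fun n _ => abs_oddJacobi_le _ _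
    _ = ((N % (4 * a) : ℕ) : ℤ) := by simp
    _ ≤ _ := by exact_mod_cast (Nat.mod_lt N (by omega)).le

theorem not_isSquare_mul_of_squarefree {d e : ℕ} (hd : Squarefree d) (he : Squarefree e)
    (hde : d ≠ e) : ¬ IsSquare (d * e) := by
  rintro ⟨r, hr⟩
  apply hde
  have hd0 := hd.ne_zero
  have he0 := he.ne_zero
  have hr0 : r ≠ 0 := by
    rintro rfl
    simp [hd0, he0] at hr
  refine Nat.eq_of_factorization_eq hd0 he0 fun p => ?_
  have h1 := congrArg (fun n => n.factorization p) hr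
  simp only [Nat.factorization_mul hd0 he0, Nat.factorization_mul hr0 hr0,
    Finsupp.add_apply] at h1
  have h2 := hd.natFactorization_le_one p
  have h3 := he.natFactorization_le_one p
  omega

/-- Few `d` have a large character sum over the odd primes up to `Z`. -/
theorem card_large_charSum_le {E : Finset ℕ} {D Z k : ℕ} (hk : Even k) {L : ℝ}
    (hE : ∀ d ∈ E, Squarefree d ∧ d ≤ 2 * D) (hZ : 1 ≤ Z)
    (hL : ∀ n : ℕ, n ≠ 0 → n ≤ Z ^ k → (n.divisors.card : ℝ) ≤ L) {W : ℝ} (hW : 0 ≤ W)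
    (hbig : ∀ d ∈ E, W ≤ |((∑ p ∈ oddPrimesLE Z, oddJacobi (-(d : ℤ)) p : ℤ) : ℝ)|) :
    ((E.card : ℝ) * W ^ k) ^ 2 ≤ L ^ (2 * k) * (Z ^ k + 1 : ℝ) *
      (E.card * (Z ^ k + 1 : ℝ) + E.card ^ 2 * (16 * D ^ 2)) := by
  classical
  set P := oddPrimesLE Z
  set N := Z ^ k + 1 with hN
  let B : ℕ → ℝ := fun n => ∑ d ∈ E, (oddJacobi (-(d : ℤ)) n : ℝ)
  let 𝒯 := Fintype.piFinset (fun _ : Fin k => P)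
  let a : ℕ → ℝ := fun n => ({t ∈ 𝒯 | ∏ i, t i = n}.card : ℝ)
  have hmem : ∀ t ∈ 𝒯, ∀ i, t i ∈ P := fun t ht i => Fintype.mem_piFinset.mp ht i
  have hprodle : ∀ t ∈ 𝒯, ∏ i, t i ∈ Finset.range N := by
    intro t ht
    rw [Finset.mem_range, hN, Nat.lt_succ_iff]
    calc ∏ i, t i ≤ ∏ _i : Fin k, Z :=
          Finset.prod_le_prod' fun i _ => (mem_oddPrimesLE.mp (hmem t ht i)).2.1
      _ = Z ^ k := by simp
  have hpow : ∀ d : ℕ, ((∑ p ∈ P, oddJacobi (-(d : ℤ)) p : ℤ) : ℝ) ^ k =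
      ∑ t ∈ 𝒯, (oddJacobi (-(d : ℤ)) (∏ i, t i) : ℝ) := by
    intro d
    rw [Int.cast_sum, Finset.sum_pow']
    refine Finset.sum_congr rfl fun t _ => ?_
    rw [map_prod]; push_cast; rfl
  have hlower : (E.card : ℝ) * W ^ k ≤ ∑ n ∈ Finset.range N, a n * B n := by
    calc (E.card : ℝ) * W ^ k = ∑ d ∈ E, W ^ k := by simp
      _ ≤ ∑ d ∈ E, ((∑ p ∈ P, oddJacobi (-(d : ℤ)) p : ℤ) : ℝ) ^ k := by
          refine Finset.sum_le_sum fun d hd => ?_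
          have := pow_le_pow_left₀ hW (hbig d hd) k
          rwa [hk.pow_abs] at this
      _ = ∑ t ∈ 𝒯, B (∏ i, t i) := by
          simp_rw [hpow]; rw [Finset.sum_comm]
      _ = _ := by
          rw [← Finset.sum_fiberwise_of_maps_to hprodle]
          refine Finset.sum_congr rfl fun n _ => ?_
          rw [Finset.sum_congr rfl (g := fun _ => B n)
            (fun t ht => by rw [(Finset.mem_filter.mp ht).2])]
          simp [a]
  have hL0 : 0 ≤ L := (Nat.cast_nonneg _).trans (hL 1 one_ne_zero (Nat.one_le_pow _ _ hZ))
  have ha : ∀ n ∈ Finset.range N, a n ^ 2 ≤ L ^ (2 * k) := by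
    intro n hn
    rw [mul_comm 2 k, pow_mul]
    refine pow_le_pow_left₀ (by positivity) ?_ 2
    rcases eq_or_ne n 0 with rfl | hn0
    · have : {t ∈ 𝒯 | ∏ i, t i = 0} = ∅ := by
        rw [Finset.filter_eq_empty_iff]
        intro t ht h
        obtain ⟨i, -, hi⟩ := Finset.prod_eq_zero_iff.mp h
        have := (mem_oddPrimesLE.mp (hmem t ht i)).1
        omega
      simp only [a, this]; simp; positivity
    · have h1 : {t ∈ 𝒯 | ∏ i, t i = n}.card ≤ n.divisors.card ^ k := by
        calc _ ≤ (Fintype.piFinset (fun _ : Fin k => n.divisors)).card := by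
              refine Finset.card_le_card fun t ht => ?_
              rw [Fintype.mem_piFinset]
              intro i
              rw [Nat.mem_divisors]
              refine ⟨?_, hn0⟩
              rw [← (Finset.mem_filter.mp ht).2]
              exact Finset.dvd_prod_of_mem _ (Finset.mem_univ i)
          _ = _ := by simp
      calc a n ≤ (n.divisors.card : ℝ) ^ k := by
            simp only [a]
            exact_mod_cast h1
        _ ≤ _ := by
          gcongr
          exact hL n hn0 (Nat.lt_succ_iff.mp (Finset.mem_range.mp hn))
  have hB : ∑ n ∈ Finset.range N, B n ^ 2 ≤ E.card * (N : ℝ) + E.card ^ 2 * (16 * D ^ 2) := by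
    have hexp : ∑ n ∈ Finset.range N, B n ^ 2 =
        ∑ d ∈ E, ∑ e ∈ E, ((∑ n ∈ Finset.range N, oddJacobi ((d * e : ℕ) : ℤ) n : ℤ) : ℝ) := by
      simp_rw [B, sq, Finset.sum_mul_sum]
      rw [Finset.sum_comm]
      refine Finset.sum_congr rfl fun d _ => ?_
      rw [Finset.sum_comm]
      refine Finset.sum_congr rfl fun e _ => ?_
      push_cast
      refine Finset.sum_congr rfl fun n _ => ?_
      rw [← Int.cast_mul, ← oddJacobi_mul_left]; simp
    rw [hexp]
    calc _ ≤ ∑ d ∈ E, ∑ e ∈ E, ((if d = e then (N : ℝ) else 0) + 16 * D ^ 2) := by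
          refine Finset.sum_le_sum fun d hd => Finset.sum_le_sum fun e he => ?_
          split_ifs with h
          · have : (∑ n ∈ Finset.range N, oddJacobi ((d * e : ℕ) : ℤ) n) ≤ (N : ℤ) := by
              calc _ ≤ ∑ n ∈ Finset.range N, (1 : ℤ) := Finset.sum_le_sum fun n _ =>
                    (le_abs_self _).trans (abs_oddJacobi_le _ _)
                _ = _ := by simp
            have h2 : ((∑ n ∈ Finset.range N, oddJacobi ((d * e : ℕ) : ℤ) n : ℤ) : ℝ) ≤ N := by
              exact_mod_cast this
            have : (0 : ℝ) ≤ 16 * D ^ 2 := by positivity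
            linarith
          · have h1 := abs_sum_oddJacobi_le (mul_ne_zero (hE d hd).1.ne_zero (hE e he).1.ne_zero)
              (not_isSquare_mul_of_squarefree (hE d hd).1 (hE e he).1 h) N
            have h2 : ((∑ n ∈ Finset.range N, oddJacobi ((d * e : ℕ) : ℤ) n : ℤ) : ℝ) ≤
                4 * (d * e : ℕ) := by exact_mod_cast (le_abs_self _).trans h1
            have h3 : d * e ≤ (2 * D) * (2 * D) := Nat.mul_le_mul (hE d hd).2 (hE e he).2
            have h4 : ((d * e : ℕ) : ℝ) ≤ (2 * D) * (2 * D) := by exact_mod_cast h3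
            nlinarith
      _ = _ := by
          simp_rw [Finset.sum_add_distrib]
          simp
          ring
  have hCS := Finset.sum_mul_sq_le_sq_mul_sq (Finset.range N) a B
  have hNcast : (N : ℝ) = Z ^ k + 1 := by rw [hN]; push_cast; ring
  have h0 : 0 ≤ (E.card : ℝ) * W ^ k := by positivity
  calc ((E.card : ℝ) * W ^ k) ^ 2 ≤ (∑ n ∈ Finset.range N, a n * B n) ^ 2 :=
        pow_le_pow_left₀ h0 hlower 2
    _ ≤ _ := hCS
    _ ≤ (L ^ (2 * k) * N) * (E.card * (N : ℝ) + E.card ^ 2 * (16 * D ^ 2)) := by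
        gcongr
        calc _ ≤ ∑ n ∈ Finset.range N, L ^ (2 * k) := Finset.sum_le_sum ha
          _ = _ := by simp; ring
    _ = _ := by rw [hNcast]

/-- Data exhibiting a ring `R` as an order-like ring between `ℤ[√-d]` and the half-integral
lattice, embedded in `ℂ`. -/
structure ImagQuad (R : Type*) [CommRing R] (d : ℕ) where
  ι : R →+* ℂ
  inj : Function.Injective ι
  θ : R
  map_θ : ι θ = (Real.sqrt d : ℂ) * Complex.I
  exists_coords : ∀ z : R, ∃ u v : ℤ, 2 * z = u + v * θ ∧ 4 ∣ u ^ 2 + d * v ^ 2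

namespace ImagQuad

variable {R : Type*} [CommRing R] {d : ℕ}

theorem θ_mul_θ (q : ImagQuad R d) : q.θ * q.θ = -(d : R) := by
  apply q.inj
  have h : ((Real.sqrt d : ℝ) : ℂ) * (Real.sqrt d : ℝ) = (d : ℂ) := by
    rw [← Complex.ofReal_mul, Real.mul_self_sqrt (Nat.cast_nonneg d)]; simp
  rw [map_mul, q.map_θ, map_neg, map_natCast]
  linear_combination ((Real.sqrt d : ℝ) : ℂ) * (Real.sqrt d : ℝ) * Complex.I_mul_I - h

theorem re_im_of_two_mul (q : ImagQuad R d) {z : R} {u v : ℤ} (h : 2 * z = u + v * q.θ) :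
    (q.ι z).re = u / 2 ∧ (q.ι z).im = v * Real.sqrt d / 2 := by
  have h1 := congrArg q.ι h
  rw [map_mul, map_add, map_mul, q.map_θ, map_intCast, map_intCast, map_ofNat] at h1
  have hre := congrArg Complex.re h1
  have him := congrArg Complex.im h1
  simp at hre him
  constructor <;> linarith

theorem eq_of_coords (q : ImagQuad R d) (hd : 0 < d) {u v u' v' : ℤ}
    (h : (u : R) + v * q.θ = u' + v' * q.θ) : u = u' ∧ v = v' := by
  have h1 := congrArg q.ι h
  simp only [map_add, map_mul, q.map_θ, map_intCast] at h1
  have hre := congrArg Complex.re h1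
  have him := congrArg Complex.im h1
  simp at hre him
  exact ⟨hre, him.resolve_right hd.ne'⟩

theorem exists_conj (q : ImagQuad R d) :
    ∃ σ : R →+* R, ∀ z, q.ι (σ z) = (starRingEnd ℂ) (q.ι z) := by
  have key : ∀ z : R, ∃ w : R, q.ι w = (starRingEnd ℂ) (q.ι z) := by
    intro z
    obtain ⟨u, v, h, -⟩ := q.exists_coords z
    obtain ⟨h1, h2⟩ := q.re_im_of_two_mul h
    refine ⟨u - z, ?_⟩
    apply Complex.ext
    · simp [h1]; ring
    · simp
  choose f hf using key
  refine ⟨{ toFun := f, map_one' := q.inj ?_, map_mul' := fun x y => q.inj ?_,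
            map_zero' := q.inj ?_, map_add' := fun x y => q.inj ?_ }, hf⟩ <;>
  simp [hf]

/-- Complex conjugation on `R`. -/
noncomputable def conj (q : ImagQuad R d) : R →+* R := q.exists_conj.choose

theorem map_conj (q : ImagQuad R d) (z : R) : q.ι (q.conj z) = (starRingEnd ℂ) (q.ι z) :=
  q.exists_conj.choose_spec z

theorem conj_θ (q : ImagQuad R d) : q.conj q.θ = -q.θ := by
  apply q.inj
  rw [q.map_conj, map_neg, q.map_θ]; simp

theorem conj_coords (q : ImagQuad R d) {z : R} {u v : ℤ} (h : 2 * z = u + v * q.θ) :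
    2 * q.conj z = u - v * q.θ := by
  have := congrArg q.conj h
  rw [map_mul, map_add, map_mul, q.conj_θ, map_intCast, map_intCast, map_ofNat] at this
  rw [this]; ring

theorem two_mul_inj (q : ImagQuad R d) {a b : R} (h : 2 * a = 2 * b) : a = b := by
  apply q.inj
  have := congrArg q.ι h
  rw [map_mul, map_mul, map_ofNat] at this
  exact mul_left_cancel₀ two_ne_zero this

theorem four_mul_norm (q : ImagQuad R d) {z : R} {u v : ℤ} (h : 2 * z = u + v * q.θ) :
    4 * (z * q.conj z) = ((u ^ 2 + d * v ^ 2 : ℤ) : R) := by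
  have h2 := q.conj_coords h
  have h3 := q.θ_mul_θ
  push_cast
  linear_combination (2 * q.conj z) * h + (u + v * q.θ) * h2 - v ^ 2 * h3

theorem exists_norm (q : ImagQuad R d) (z : R) : ∃ n : ℕ, z * q.conj z = n := by
  obtain ⟨u, v, h, m, hm⟩ := q.exists_coords z
  have h4 := q.four_mul_norm h
  have hm0 : 0 ≤ m := by nlinarith [sq_nonneg u, mul_nonneg (Int.natCast_nonneg d) (sq_nonneg v)]
  refine ⟨m.toNat, q.two_mul_inj (q.two_mul_inj ?_)⟩
  have h5 : ((m.toNat : ℕ) : R) = ((m : ℤ) : R) := by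
    rw [← Int.cast_natCast, Int.toNat_of_nonneg hm0]
  rw [h5, ← mul_assoc, ← mul_assoc]
  rw [hm] at h4
  push_cast at h4
  linear_combination h4

/-- The norm of an element of `R`, as a natural number. -/
noncomputable def norm (q : ImagQuad R d) (z : R) : ℕ := (q.exists_norm z).choose

theorem mul_conj (q : ImagQuad R d) (z : R) : z * q.conj z = q.norm z :=
  (q.exists_norm z).choose_spec

theorem norm_eq_normSq (q : ImagQuad R d) (z : R) : (q.norm z : ℝ) = Complex.normSq (q.ι z) := by
  have := congrArg q.ι (q.mul_conj z)
  rw [map_mul, q.map_conj, Complex.mul_conj, map_natCast] at this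
  exact_mod_cast this.symm

theorem norm_mul (q : ImagQuad R d) (z w : R) : q.norm (z * w) = q.norm z * q.norm w := by
  have : (q.norm (z * w) : ℝ) = q.norm z * q.norm w := by
    simp only [q.norm_eq_normSq, map_mul]
  exact_mod_cast this

theorem norm_natCast (q : ImagQuad R d) (n : ℕ) : q.norm (n : R) = n ^ 2 := by
  have : (q.norm (n : R) : ℝ) = n ^ 2 := by
    rw [q.norm_eq_normSq, map_natCast, Complex.normSq_natCast, sq]
  exact_mod_cast this

theorem norm_one (q : ImagQuad R d) : q.norm (1 : R) = 1 := by
  simpa using q.norm_natCast 1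

theorem natCast_inj (q : ImagQuad R d) {m n : ℕ} (h : (m : R) = n) : m = n := by
  have := congrArg q.ι h
  simpa using this

theorem norm_unit (q : ImagQuad R d) {z : R} (hz : IsUnit z) : q.norm z = 1 := by
  obtain ⟨w, hw⟩ := hz.exists_right_inv
  have := q.norm_mul z w
  rw [hw, q.norm_one] at this
  exact Nat.eq_one_of_mul_eq_one_right this.symm

theorem norm_eq_of_span_eq (q : ImagQuad R d) [IsDomain R] {z : R} {n : ℕ}
    (h : Ideal.span {z * q.conj z} = Ideal.span {(n : R)}) : q.norm z = n := by
  rw [Ideal.span_singleton_eq_span_singleton] at h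
  obtain ⟨w, hw⟩ := h
  rw [q.mul_conj] at hw
  have h1 := q.norm_mul (q.norm z : R) w
  rw [hw, q.norm_natCast, q.norm_natCast, q.norm_unit w.isUnit, mul_one] at h1
  exact (Nat.pow_left_injective two_ne_zero h1).symm

theorem not_isUnit_natCast (q : ImagQuad R d) {n : ℕ} (hn : n ≠ 1) : ¬ IsUnit (n : R) := by
  intro h
  have := q.norm_unit h
  rw [q.norm_natCast] at this
  exact hn ((Nat.pow_eq_one.mp this).resolve_right two_ne_zero)

/-- The prime ideal above `p` determined by a square root `b` of `-d` modulo `p`. -/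
def primeAbove (q : ImagQuad R d) (p : ℕ) (b : ℤ) : Ideal R := Ideal.span {(p : R), b + q.θ}

theorem primeAbove_conj (q : ImagQuad R d) (p : ℕ) (b : ℤ) :
    (q.primeAbove p b).map q.conj = q.primeAbove p (-b) := by
  have h : ((-b : ℤ) : R) + q.θ = -(b - q.θ) := by push_cast; ring
  unfold primeAbove
  rw [Ideal.map_span, Set.image_pair, map_natCast, map_add, map_intCast, q.conj_θ, h,
    Ideal.span_pair_neg, sub_eq_add_neg]

end ImagQuad

namespace ImagQuad

variable {R : Type*} [CommRing R] {d : ℕ}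

theorem natCast_mem_primeAbove (q : ImagQuad R d) (p : ℕ) (b : ℤ) :
    (p : R) ∈ q.primeAbove p b := Ideal.subset_span (by simp)

theorem intCast_add_θ_mem_primeAbove (q : ImagQuad R d) (p : ℕ) (b : ℤ) :
    (b : R) + q.θ ∈ q.primeAbove p b := Ideal.subset_span (by simp)

theorem isCoprime_two_mul {p : ℕ} {b : ℤ} (hp : p.Prime) (hp2 : p ≠ 2) (hpd : ¬ p ∣ d)
    (hb : (p : ℤ) ∣ b ^ 2 + d) : IsCoprime (2 * b) (p : ℤ) := by
  have hpi : Prime (p : ℤ) := Nat.prime_iff_prime_int.mp hp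
  rw [isCoprime_comm, hpi.coprime_iff_not_dvd]
  intro h
  rcases hpi.dvd_or_dvd h with h | h
  · exact hp2 ((Nat.prime_dvd_prime_iff_eq hp Nat.prime_two).mp (by exact_mod_cast h))
  · have : (p : ℤ) ∣ d := (dvd_add_right (dvd_pow h two_ne_zero)).mp hb
    exact hpd (by exact_mod_cast this)

theorem primeAbove_mul_conj (q : ImagQuad R d) {p : ℕ} {b : ℤ} (hp : p.Prime) (hp2 : p ≠ 2)
    (hpd : ¬ p ∣ d) (hb : (p : ℤ) ∣ b ^ 2 + d) :
    q.primeAbove p b * q.primeAbove p (-b) = Ideal.span {(p : R)} := by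
  obtain ⟨x, y, hxy⟩ := isCoprime_two_mul hp hp2 hpd hb
  obtain ⟨m, hm⟩ := hb
  have hxy' : (x : R) * (2 * b) + y * p = 1 := by exact_mod_cast congrArg (Int.cast (R := R)) hxy
  have hm' : (b : R) ^ 2 + d = p * m := by exact_mod_cast congrArg (Int.cast (R := R)) hm
  have hθ := q.θ_mul_θ
  apply le_antisymm
  · unfold primeAbove
    rw [Ideal.span_pair_mul_span_pair, Ideal.span_le]
    rintro z (rfl | rfl | rfl | rfl) <;> rw [SetLike.mem_coe, Ideal.mem_span_singleton]
    · exact dvd_mul_right _ _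
    · exact dvd_mul_right _ _
    · exact dvd_mul_left _ _
    · refine ⟨-m, ?_⟩
      push_cast
      linear_combination hθ - hm'
  · rw [Ideal.span_singleton_le_iff_mem]
    have h1 := Ideal.mul_mem_mul (q.natCast_mem_primeAbove p b) (q.natCast_mem_primeAbove p (-b))
    have h2 := Ideal.mul_mem_mul (q.natCast_mem_primeAbove p b)
      (q.intCast_add_θ_mem_primeAbove p (-b))
    have h3 := Ideal.mul_mem_mul (q.intCast_add_θ_mem_primeAbove p b)
      (q.natCast_mem_primeAbove p (-b))
    have : (p : R) = x * ((b + q.θ) * p - p * (((-b : ℤ) : R) + q.θ)) + y * (p * p) := by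
      push_cast
      linear_combination (-(p : R)) * hxy'
    rw [this]
    exact Ideal.add_mem _ (Ideal.mul_mem_left _ _ (Ideal.sub_mem _ h3 h2))
      (Ideal.mul_mem_left _ _ h1)

theorem isCoprime_primeAbove_conj (q : ImagQuad R d) {p : ℕ} {b : ℤ} (hp : p.Prime) (hp2 : p ≠ 2)
    (hpd : ¬ p ∣ d) (hb : (p : ℤ) ∣ b ^ 2 + d) :
    IsCoprime (q.primeAbove p b) (q.primeAbove p (-b)) := by
  obtain ⟨x, y, hxy⟩ := isCoprime_two_mul hp hp2 hpd hb
  have hxy' : (x : R) * (2 * b) + y * p = 1 := by exact_mod_cast congrArg (Int.cast (R := R)) hxy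
  rw [Ideal.isCoprime_iff_exists]
  refine ⟨x * (b + q.θ) + y * p, Ideal.add_mem _
    (Ideal.mul_mem_left _ _ (q.intCast_add_θ_mem_primeAbove p b))
    (Ideal.mul_mem_left _ _ (q.natCast_mem_primeAbove p b)),
    (-x) * (((-b : ℤ) : R) + q.θ), Ideal.mul_mem_left _ _ (q.intCast_add_θ_mem_primeAbove p (-b)), ?_⟩
  push_cast
  linear_combination hxy'

theorem isCoprime_primeAbove (q : ImagQuad R d) {p p' : ℕ} (b b' : ℤ) (hp : p.Prime)
    (hp' : p'.Prime) (h : p ≠ p') : IsCoprime (q.primeAbove p b) (q.primeAbove p' b') := by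
  obtain ⟨x, y, hxy⟩ := Nat.isCoprime_iff_coprime.mpr ((Nat.coprime_primes hp hp').mpr h)
  rw [Ideal.isCoprime_iff_exists]
  exact ⟨x * p, Ideal.mul_mem_left _ _ (q.natCast_mem_primeAbove p b), y * p',
    Ideal.mul_mem_left _ _ (q.natCast_mem_primeAbove p' b'), by exact_mod_cast congrArg (Int.cast (R := R)) hxy⟩

theorem primeAbove_ne_top (q : ImagQuad R d) {p : ℕ} {b : ℤ} (hp : p.Prime) (hp2 : p ≠ 2)
    (hpd : ¬ p ∣ d) (hb : (p : ℤ) ∣ b ^ 2 + d) : q.primeAbove p b ≠ ⊤ := by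
  intro h
  have h1 := q.primeAbove_mul_conj hp hp2 hpd hb
  have h2 : q.primeAbove p (-b) = ⊤ := by rw [← q.primeAbove_conj, h, Ideal.map_top]
  rw [h, h2, Ideal.mul_top, eq_comm, Ideal.span_singleton_eq_top] at h1
  exact q.not_isUnit_natCast hp.ne_one h1

/-- `p` is an odd prime not dividing `d` and `b` is a square root of `-d` modulo `p`. -/
structure IsSplit (d p : ℕ) (b : ℤ) : Prop where
  prime : p.Prime
  ne_two : p ≠ 2
  not_dvd : ¬ p ∣ d
  dvd : (p : ℤ) ∣ b ^ 2 + d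

theorem IsSplit.neg {p : ℕ} {b : ℤ} (h : IsSplit d p b) : IsSplit d p (-b) :=
  ⟨h.prime, h.ne_two, h.not_dvd, by rw [neg_sq]; exact h.dvd⟩

/-- If `p` divides `v` and `u² + dv²`, then `p` divides the element with coordinates `u, v`. -/
theorem mem_span_of_dvd (q : ImagQuad R d) {p : ℕ} (hp : p.Prime) (hp2 : p ≠ 2) {z : R} {u v n : ℤ}
    (h : 2 * z = u + v * q.θ) (hn : u ^ 2 + d * v ^ 2 = p * n) (hv : (p : ℤ) ∣ v) :
    z ∈ Ideal.span {(p : R)} := by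
  have hpi : Prime (p : ℤ) := Nat.prime_iff_prime_int.mp hp
  have hu : (p : ℤ) ∣ u := by
    apply hpi.dvd_of_dvd_pow (n := 2)
    have : u ^ 2 = p * n - d * v * v := by linarith
    rw [this]
    exact dvd_sub (dvd_mul_right _ _) (hv.mul_left _)
  obtain ⟨s, rfl⟩ := hu
  obtain ⟨t, rfl⟩ := hv
  obtain ⟨x, y, hxy⟩ := Nat.isCoprime_iff_coprime.mpr
    ((Nat.coprime_primes Nat.prime_two hp).mpr hp2.symm)
  have hxy' : (x : R) * 2 + y * p = 1 := by exact_mod_cast congrArg (Int.cast (R := R)) hxy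
  rw [Ideal.mem_span_singleton]
  refine ⟨x * (s + t * q.θ) + y * z, ?_⟩
  push_cast at h
  linear_combination (-z) * hxy' + x * h

theorem not_dvd_coord (q : ImagQuad R d) {p : ℕ} {b : ℤ} (hp : IsSplit d p b) {z : R} {u v n : ℤ}
    (h : 2 * z = u + v * q.θ) (hn : u ^ 2 + d * v ^ 2 = p * n) {J : Ideal R}
    (hJ : Ideal.span {z} = J) (hcop : IsCoprime J (q.primeAbove p b)) : ¬ (p : ℤ) ∣ v := by
  intro hv
  have h1 := q.mem_span_of_dvd hp.prime hp.ne_two h hn hv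
  have h2 : J ≤ q.primeAbove p b := by
    rw [← hJ, Ideal.span_singleton_le_iff_mem]
    have h3 := q.primeAbove_mul_conj hp.prime hp.ne_two hp.not_dvd hp.dvd
    exact Ideal.mul_le_left (I := q.primeAbove p b) (J := q.primeAbove p (-b)) (h3 ▸ h1)
  have hcop := Ideal.isCoprime_iff_sup_eq.mp hcop
  rw [sup_eq_right.mpr h2] at hcop
  exact q.primeAbove_ne_top hp.prime hp.ne_two hp.not_dvd hp.dvd hcop

/-- A generator of `P₁³ P̄₂³`, where `Pᵢ` lies above `pᵢ`, yields a solution of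
`u² + d v² = 4 (p₁ p₂)³`. -/
theorem exists_generator_coords (q : ImagQuad R d) [IsDomain R] {p₁ p₂ : ℕ} {b₁ b₂ : ℤ}
    (h₁ : IsSplit d p₁ b₁) (h₂ : IsSplit d p₂ b₂) (hne : p₁ ≠ p₂)
    (hJ : (q.primeAbove p₁ b₁ ^ 3 * q.primeAbove p₂ (-b₂) ^ 3).IsPrincipal) :
    ∃ z : R, ∃ u v : ℤ, Ideal.span {z} = q.primeAbove p₁ b₁ ^ 3 * q.primeAbove p₂ (-b₂) ^ 3 ∧
      2 * z = u + v * q.θ ∧ u ^ 2 + d * v ^ 2 = 4 * ((p₁ : ℤ) * p₂) ^ 3 ∧ 0 < v ∧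
      ¬ (p₁ : ℤ) ∣ v ∧ ¬ (p₂ : ℤ) ∣ v := by
  obtain ⟨z, hz⟩ := hJ
  set J := q.primeAbove p₁ b₁ ^ 3 * q.primeAbove p₂ (-b₂) ^ 3 with hJdef
  have hz' : Ideal.span {z} = J := hz.symm
  have hconj : Ideal.span {q.conj z} = q.primeAbove p₁ (-b₁) ^ 3 * q.primeAbove p₂ b₂ ^ 3 := by
    have := congrArg (Ideal.map q.conj) hz'
    rw [Ideal.map_span, Set.image_singleton, hJdef, Ideal.map_mul, Ideal.map_pow, Ideal.map_pow,
      q.primeAbove_conj, q.primeAbove_conj, neg_neg] at this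
    exact this
  have hnorm : q.norm z = (p₁ * p₂) ^ 3 := by
    apply q.norm_eq_of_span_eq
    have e1 := q.primeAbove_mul_conj h₁.prime h₁.ne_two h₁.not_dvd h₁.dvd
    have e2 := q.primeAbove_mul_conj h₂.prime h₂.ne_two h₂.not_dvd h₂.dvd
    rw [← Ideal.span_singleton_mul_span_singleton, hz', hconj, hJdef]
    calc _ = (q.primeAbove p₁ b₁ * q.primeAbove p₁ (-b₁)) ^ 3 *
          (q.primeAbove p₂ b₂ * q.primeAbove p₂ (-b₂)) ^ 3 := by ring
      _ = _ := by
          rw [e1, e2, Ideal.span_singleton_pow, Ideal.span_singleton_pow,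
            Ideal.span_singleton_mul_span_singleton]
          push_cast; rw [mul_pow]
  have key : ∀ z' : R, Ideal.span {z'} = J → q.norm z' = (p₁ * p₂) ^ 3 → ∀ u v : ℤ,
      2 * z' = u + v * q.θ → u ^ 2 + d * v ^ 2 = 4 * ((p₁ : ℤ) * p₂) ^ 3 ∧
      ¬ (p₁ : ℤ) ∣ v ∧ ¬ (p₂ : ℤ) ∣ v := by
    intro z' hzJ hzn u v h
    have heq : u ^ 2 + d * v ^ 2 = 4 * ((p₁ : ℤ) * p₂) ^ 3 := by
      have h4 := q.four_mul_norm h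
      rw [q.mul_conj, hzn] at h4
      have h5 := congrArg q.ι h4
      rw [map_intCast] at h5
      push_cast at h5
      simp only [map_mul, map_pow, map_natCast, map_ofNat] at h5
      exact_mod_cast h5.symm
    refine ⟨heq, ?_, ?_⟩
    · refine q.not_dvd_coord h₁.neg (n := 4 * p₁ ^ 2 * p₂ ^ 3) h (by rw [heq]; ring) hzJ ?_
      exact IsCoprime.mul_left
        (q.isCoprime_primeAbove_conj h₁.prime h₁.ne_two h₁.not_dvd h₁.dvd).pow_left
        (q.isCoprime_primeAbove _ _ h₂.prime h₁.prime hne.symm).pow_left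
    · refine q.not_dvd_coord h₂ (n := 4 * p₁ ^ 3 * p₂ ^ 2) h (by rw [heq]; ring) hzJ ?_
      exact IsCoprime.mul_left
        (q.isCoprime_primeAbove _ _ h₁.prime h₂.prime hne).pow_left
        (q.isCoprime_primeAbove_conj h₂.prime h₂.ne_two h₂.not_dvd h₂.dvd).symm.pow_left
  obtain ⟨u, v, h, -⟩ := q.exists_coords z
  obtain ⟨h1, h2, h3⟩ := key z hz' hnorm u v h
  rcases lt_trichotomy v 0 with hv | rfl | hv
  · refine ⟨-z, -u, -v, by rw [Ideal.span_singleton_neg, hz'], ?_, by rw [neg_sq, neg_sq, h1],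
      by omega, by rwa [dvd_neg], by rwa [dvd_neg]⟩
    push_cast
    linear_combination -h
  · simp at h2
  · exact ⟨z, u, v, hz', h, h1, hv, h2, h3⟩

end ImagQuad

/-- A solution of `u² + d v² = 4 (p₁ p₂)³` with `v > 0` prime to `p₁ p₂`. -/
def PairRel (d p₁ p₂ : ℕ) : Prop :=
  ∃ u v : ℤ, u ^ 2 + d * v ^ 2 = 4 * ((p₁ : ℤ) * p₂) ^ 3 ∧ 0 < v ∧
    ¬ (p₁ : ℤ) ∣ v ∧ ¬ (p₂ : ℤ) ∣ v

/-- Two compatible solutions of the equation in `PairRel`, for `(p₁, p₂)` and `(p₁, p₃)`. -/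
def TripleRel (d p₁ p₂ p₃ : ℕ) : Prop :=
  ∃ u v u' v' w : ℤ, u ^ 2 + d * v ^ 2 = 4 * ((p₁ : ℤ) * p₂) ^ 3 ∧ 0 < v ∧
    ¬ (p₁ : ℤ) ∣ v ∧ ¬ (p₂ : ℤ) ∣ v ∧
    u' ^ 2 + d * v' ^ 2 = 4 * ((p₁ : ℤ) * p₃) ^ 3 ∧ 0 < v' ∧
    ¬ (p₁ : ℤ) ∣ v' ∧ ¬ (p₃ : ℤ) ∣ v' ∧ u * v' - v * u' = 2 * (p₁ : ℤ) ^ 3 * w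

/-- The odd primes `p ≤ Z` with `(-d / p) = 1`. -/
def splitPrimes (d Z : ℕ) : Finset ℕ :=
  (oddPrimesLE Z).filter fun p => oddJacobi (-(d : ℤ)) p = 1

theorem exists_isSplit {d Z p : ℕ} (hp : p ∈ splitPrimes d Z) :
    ∃ b : ℤ, ImagQuad.IsSplit d p b := by
  obtain ⟨hp1, hp2⟩ := Finset.mem_filter.mp hp
  obtain ⟨h3, -, hpr⟩ := mem_oddPrimesLE.mp hp1
  have : Fact p.Prime := ⟨hpr⟩
  have hp2' : p ≠ 2 := by omega
  rw [oddJacobi_apply, if_pos (hpr.odd_of_ne_two hp2'), ← jacobiSym.legendreSym.to_jacobiSym] at hp2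
  have h0 : ((-(d : ℤ) : ℤ) : ZMod p) ≠ 0 := by
    intro h
    rw [(legendreSym.eq_zero_iff p _).mpr h] at hp2
    exact zero_ne_one hp2
  obtain ⟨c, hc⟩ := (legendreSym.eq_one_iff p h0).mp hp2
  refine ⟨c.val, hpr, hp2', ?_, ?_⟩
  · intro h
    apply h0
    have : ((d : ℕ) : ZMod p) = 0 := (ZMod.natCast_eq_zero_iff _ _).mpr h
    push_cast; rw [this, neg_zero]
  · rw [← ZMod.intCast_zmod_eq_zero_iff_dvd]
    push_cast at hc ⊢
    rw [ZMod.natCast_zmod_val, sq, ← hc]; ring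

namespace ImagQuad

variable {R : Type*} [CommRing R] {d : ℕ}

theorem tripleRel_of_generators (q : ImagQuad R d) [IsDomain R] (hd : 0 < d) {p₁ p₂ p₃ : ℕ}
    {b₁ b₂ b₃ : ℤ} (h₁ : IsSplit d p₁ b₁) (h₂ : IsSplit d p₂ b₂) (h₃ : IsSplit d p₃ b₃)
    (h₁₂ : p₁ ≠ p₂) (h₁₃ : p₁ ≠ p₃)
    (hJ : (q.primeAbove p₁ b₁ ^ 3 * q.primeAbove p₂ (-b₂) ^ 3).IsPrincipal)
    (hJ' : (q.primeAbove p₁ b₁ ^ 3 * q.primeAbove p₃ (-b₃) ^ 3).IsPrincipal) :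
    TripleRel d p₁ p₂ p₃ := by
  obtain ⟨z, u, v, hz, hc, he, hv, hv1, hv2⟩ := q.exists_generator_coords h₁ h₂ h₁₂ hJ
  obtain ⟨z', u', v', hz', hc', he', hv', hv1', hv2'⟩ := q.exists_generator_coords h₁ h₃ h₁₃ hJ'
  have hdvd : (p₁ : R) ^ 3 ∣ q.conj z * z' := by
    rw [← Ideal.mem_span_singleton]
    have hconj : Ideal.span {q.conj z} = q.primeAbove p₁ (-b₁) ^ 3 * q.primeAbove p₂ b₂ ^ 3 := by
      have := congrArg (Ideal.map q.conj) hz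
      rw [Ideal.map_span, Set.image_singleton, Ideal.map_mul, Ideal.map_pow, Ideal.map_pow,
        q.primeAbove_conj, q.primeAbove_conj, neg_neg] at this
      exact this
    have hprod : Ideal.span {q.conj z * z'} = Ideal.span {(p₁ : R) ^ 3} *
        (q.primeAbove p₂ b₂ ^ 3 * q.primeAbove p₃ (-b₃) ^ 3) := by
      rw [← Ideal.span_singleton_mul_span_singleton, hz', hconj, ← Ideal.span_singleton_pow,
        ← q.primeAbove_mul_conj h₁.prime h₁.ne_two h₁.not_dvd h₁.dvd]
      ring
    have : q.conj z * z' ∈ Ideal.span {q.conj z * z'} := Ideal.mem_span_singleton_self _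
    rw [hprod] at this
    exact Ideal.mul_le_left this
  obtain ⟨y, hy⟩ := hdvd
  obtain ⟨x, w, hxw, -⟩ := q.exists_coords y
  refine ⟨u, v, u', v', w, he, hv, hv1, hv2, he', hv', hv1', hv2', ?_⟩
  have h2 := q.conj_coords hc
  have hθ := q.θ_mul_θ
  have key : ((u * u' + d * v * v' : ℤ) : R) + ((u * v' - v * u' : ℤ) : R) * q.θ =
      ((2 * (p₁ : ℤ) ^ 3 * x : ℤ) : R) + ((2 * (p₁ : ℤ) ^ 3 * w : ℤ) : R) * q.θ := by
    push_cast
    linear_combination (-2 * z') * h2 - (u - v * q.θ) * hc' + 4 * hy + 2 * (p₁ : R) ^ 3 * hxw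
      + v * v' * hθ
  exact (q.eq_of_coords hd key).2

theorem exists_cube_map (q : ImagQuad R d) [IsDedekindDomain R] (hd : 0 < d) (Z : ℕ) :
    ∃ F : ℕ → ClassGroup R, (∀ p, ∃ c, c ^ 3 = F p) ∧
      (∀ p₁ ∈ splitPrimes d Z, ∀ p₂ ∈ splitPrimes d Z, p₁ ≠ p₂ → F p₁ = F p₂ → PairRel d p₁ p₂) ∧
      (∀ p₁ ∈ splitPrimes d Z, ∀ p₂ ∈ splitPrimes d Z, ∀ p₃ ∈ splitPrimes d Z, p₁ ≠ p₂ → p₁ ≠ p₃ →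
        F p₁ = F p₂ → F p₁ = F p₃ → TripleRel d p₁ p₂ p₃) := by
  classical
  have hb : ∀ p, ∃ b : ℤ, p ∈ splitPrimes d Z → IsSplit d p b := fun p => by
    by_cases hp : p ∈ splitPrimes d Z
    · obtain ⟨b, hb⟩ := exists_isSplit hp
      exact ⟨b, fun _ => hb⟩
    · exact ⟨0, fun h => absurd h hp⟩
  choose b hb using hb
  have hne : ∀ {p : ℕ} (c : ℤ), p ∈ splitPrimes d Z →
      q.primeAbove p c ∈ nonZeroDivisors (Ideal R) := by
    intro p c hp
    rw [mem_nonZeroDivisors_iff_ne_zero]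
    intro h
    have h1 := q.natCast_mem_primeAbove p c
    rw [h, Ideal.zero_eq_bot, Ideal.mem_bot] at h1
    exact (hb p hp).prime.ne_zero (q.natCast_inj (by rw [h1, Nat.cast_zero]))
  have hspan : ∀ {p : ℕ}, p ∈ splitPrimes d Z →
      Ideal.span {(p : R)} ∈ nonZeroDivisors (Ideal R) := by
    intro p hp
    rw [mem_nonZeroDivisors_iff_ne_zero, Ideal.zero_eq_bot, Ne, Ideal.span_singleton_eq_bot]
    intro h1
    exact (hb p hp).prime.ne_zero (q.natCast_inj (by rw [h1, Nat.cast_zero]))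
  let G : ℕ → ClassGroup R := fun p =>
    if hp : p ∈ splitPrimes d Z then ClassGroup.mk0 ⟨q.primeAbove p (b p), hne _ hp⟩ else 1
  have hprin : ∀ p₁ ∈ splitPrimes d Z, ∀ p₂ ∈ splitPrimes d Z, G p₁ ^ 3 = G p₂ ^ 3 →
      (q.primeAbove p₁ (b p₁) ^ 3 * q.primeAbove p₂ (-b p₂) ^ 3).IsPrincipal := by
    intro p₁ hp₁ p₂ hp₂ h
    have hinv : G p₂ * ClassGroup.mk0 ⟨q.primeAbove p₂ (-b p₂), hne _ hp₂⟩ = 1 := by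
      simp only [G, dif_pos hp₂]
      rw [← map_mul]
      have := (ClassGroup.mk0_eq_one_iff (hspan hp₂)).mpr ⟨_, rfl⟩
      rw [← this]
      congr 1
      exact Subtype.ext (q.primeAbove_mul_conj (hb p₂ hp₂).prime (hb p₂ hp₂).ne_two
        (hb p₂ hp₂).not_dvd (hb p₂ hp₂).dvd)
    have h3 : G p₁ ^ 3 * ClassGroup.mk0 ⟨q.primeAbove p₂ (-b p₂), hne _ hp₂⟩ ^ 3 = 1 := by
      rw [h, ← mul_pow, hinv, one_pow]
    simp only [G, dif_pos hp₁] at h3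
    rw [← map_pow, ← map_pow, ← map_mul] at h3
    exact (ClassGroup.mk0_eq_one_iff _).mp h3
  refine ⟨fun p => G p ^ 3, fun p => ⟨G p, rfl⟩, ?_, ?_⟩
  · intro p₁ hp₁ p₂ hp₂ hne h
    obtain ⟨z, u, v, -, -, h1, h2, h3, h4⟩ :=
      q.exists_generator_coords (hb p₁ hp₁) (hb p₂ hp₂) hne (hprin p₁ hp₁ p₂ hp₂ h)
    exact ⟨u, v, h1, h2, h3, h4⟩
  · intro p₁ hp₁ p₂ hp₂ p₃ hp₃ h₁₂ h₁₃ h h'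
    exact q.tripleRel_of_generators hd (hb p₁ hp₁) (hb p₂ hp₂) (hb p₃ hp₃) h₁₂ h₁₃
      (hprin p₁ hp₁ p₂ hp₂ h) (hprin p₁ hp₁ p₃ hp₃ h')

end ImagQuad

section PowerMeans

variable {G : Type*}

theorem card_torsion_mul_card_cubes [CommGroup G] :
    Nat.card {c : G // c ^ 3 = 1} * Nat.card (powMonoidHom 3 : G →* G).range = Nat.card G := by
  have h := Subgroup.card_mul_index (powMonoidHom 3 : G →* G).ker
  rw [Subgroup.index_ker] at h
  exact h

open Classical in
theorem exists_finset_range [CommGroup G] [Finite G] (F : ℕ → G) (hF : ∀ p, ∃ c, c ^ 3 = F p) :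
    ∃ s : Finset G, (∀ p, F p ∈ s) ∧ Nat.card {c : G // c ^ 3 = 1} * s.card = Nat.card G := by
  refine ⟨(Set.toFinite ((powMonoidHom 3 : G →* G).range : Set G)).toFinset, fun p => ?_, ?_⟩
  · obtain ⟨c, hc⟩ := hF p
    simp only [Set.Finite.mem_toFinset, SetLike.mem_coe, MonoidHom.mem_range]
    exact ⟨c, hc⟩
  · rw [← card_torsion_mul_card_cubes (G := G), ← Nat.card_eq_card_finite_toFinset]
    rfl

open Classical in
theorem card_eq_pairs (A : Finset ℕ) (F : ℕ → G) (s : Finset G) (hs : ∀ p, F p ∈ s) :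
    ((A ×ˢ A).filter fun t => F t.1 = F t.2).card =
      ∑ c ∈ s, (A.filter fun p => F p = c).card ^ 2 := by
  rw [Finset.card_eq_sum_card_fiberwise (f := fun t => F t.1) (t := s) fun t _ => hs _]
  refine Finset.sum_congr rfl fun c _ => ?_
  rw [sq, ← Finset.card_product]
  congr 1
  ext ⟨x, y⟩
  simp only [Finset.mem_filter, Finset.mem_product]
  constructor
  · rintro ⟨⟨⟨hx, hy⟩, h⟩, rfl⟩; exact ⟨⟨hx, rfl⟩, hy, h.symm⟩
  · rintro ⟨⟨hx, rfl⟩, hy, h⟩; exact ⟨⟨⟨hx, hy⟩, h.symm⟩, rfl⟩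

open Classical in
theorem card_eq_triples (A : Finset ℕ) (F : ℕ → G) (s : Finset G) (hs : ∀ p, F p ∈ s) :
    ((A ×ˢ A ×ˢ A).filter fun t => F t.1 = F t.2.1 ∧ F t.1 = F t.2.2).card =
      ∑ c ∈ s, (A.filter fun p => F p = c).card ^ 3 := by
  rw [Finset.card_eq_sum_card_fiberwise (f := fun t => F t.1) (t := s) fun t _ => hs _]
  refine Finset.sum_congr rfl fun c _ => ?_
  have : ∀ n : ℕ, n ^ 3 = n * (n * n) := fun n => by ring
  rw [this, ← Finset.card_product, ← Finset.card_product]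
  congr 1
  ext ⟨x, y, z⟩
  simp only [Finset.mem_filter, Finset.mem_product]
  constructor
  · rintro ⟨⟨⟨hx, hy, hz⟩, h, h'⟩, rfl⟩; exact ⟨⟨hx, rfl⟩, ⟨hy, h.symm⟩, hz, h'.symm⟩
  · rintro ⟨⟨hx, rfl⟩, ⟨hy, h⟩, hz, h'⟩; exact ⟨⟨⟨hx, hy, hz⟩, h.symm, h'.symm⟩, rfl⟩

open Classical in
theorem card_pairs_le (A : Finset ℕ) (F : ℕ → G) :
    ((A ×ˢ A).filter fun t => F t.1 = F t.2).card ≤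
      A.card + ((A ×ˢ A).filter fun t => t.1 ≠ t.2 ∧ F t.1 = F t.2).card := by
  calc _ ≤ (A.image (fun p => (p, p)) ∪
        ((A ×ˢ A).filter fun t => t.1 ≠ t.2 ∧ F t.1 = F t.2)).card := by
        refine Finset.card_le_card ?_
        rintro ⟨x, y⟩ h
        simp only [Finset.mem_filter, Finset.mem_product, Finset.mem_union, Finset.mem_image,
          Prod.mk.injEq] at h ⊢
        by_cases hxy : x = y
        · exact Or.inl ⟨x, h.1.1, rfl, hxy⟩
        · exact Or.inr ⟨h.1, hxy, h.2⟩
    _ ≤ _ := (Finset.card_union_le _ _).trans (by gcongr; exact Finset.card_image_le)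

open Classical in
theorem card_triples_le (A : Finset ℕ) (F : ℕ → G) :
    ((A ×ˢ A ×ˢ A).filter fun t => F t.1 = F t.2.1 ∧ F t.1 = F t.2.2).card ≤
      3 * ((A ×ˢ A).filter fun t => F t.1 = F t.2).card +
      ((A ×ˢ A ×ˢ A).filter fun t => t.1 ≠ t.2.1 ∧ t.1 ≠ t.2.2 ∧ t.2.1 ≠ t.2.2 ∧
        F t.1 = F t.2.1 ∧ F t.1 = F t.2.2).card := by
  set B := (A ×ˢ A).filter fun t => F t.1 = F t.2
  set T := (A ×ˢ A ×ˢ A).filter fun t => t.1 ≠ t.2.1 ∧ t.1 ≠ t.2.2 ∧ t.2.1 ≠ t.2.2 ∧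
        F t.1 = F t.2.1 ∧ F t.1 = F t.2.2
  calc _ ≤ (((B.image (fun t => (t.1, t.1, t.2)) ∪ B.image (fun t => (t.1, t.2, t.1))) ∪
        B.image (fun t => (t.1, t.2, t.2))) ∪ T).card := by
        refine Finset.card_le_card ?_
        rintro ⟨x, y, z⟩ h
        simp only [Finset.mem_filter, Finset.mem_product, Finset.mem_union, Finset.mem_image,
          Prod.mk.injEq, Prod.exists, B, T] at h ⊢
        obtain ⟨⟨hx, hy, hz⟩, h1, h2⟩ := h
        by_cases hxy : x = y
        · exact Or.inl (Or.inl (Or.inl ⟨x, z, ⟨⟨hx, hz⟩, h2⟩, rfl, hxy, rfl⟩))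
        by_cases hxz : x = z
        · exact Or.inl (Or.inl (Or.inr ⟨x, y, ⟨⟨hx, hy⟩, h1⟩, rfl, rfl, hxz⟩))
        by_cases hyz : y = z
        · exact Or.inl (Or.inr ⟨x, y, ⟨⟨hx, hy⟩, h1⟩, rfl, rfl, hyz⟩)
        · exact Or.inr ⟨⟨hx, hy, hz⟩, hxy, hxz, hyz, h1, h2⟩
    _ ≤ ((B.card + B.card) + B.card) + T.card := by
        refine (Finset.card_union_le _ _).trans (Nat.add_le_add_right ?_ _)
        refine (Finset.card_union_le _ _).trans (Nat.add_le_add ?_ Finset.card_image_le)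
        exact (Finset.card_union_le _ _).trans
          (Nat.add_le_add Finset.card_image_le Finset.card_image_le)
    _ = _ := by ring

open Classical in
theorem card_torsion_mul_sq_le [CommGroup G] [Finite G] (A : Finset ℕ) (F : ℕ → G)
    (hF : ∀ p, ∃ c, c ^ 3 = F p) :
    Nat.card {c : G // c ^ 3 = 1} * A.card ^ 2 ≤ Nat.card G *
      (A.card + ((A ×ˢ A).filter fun t => t.1 ≠ t.2 ∧ F t.1 = F t.2).card) := by
  obtain ⟨s, hs, hcard⟩ := exists_finset_range F hF
  have h1 : A.card ^ 2 ≤ s.card * ((A ×ˢ A).filter fun t => F t.1 = F t.2).card := by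
    rw [card_eq_pairs A F s hs, Finset.card_eq_sum_card_fiberwise (f := F) (t := s) fun t _ => hs _]
    exact_mod_cast sq_sum_le_card_mul_sum_sq (α := ℤ)
      (f := fun c => ((A.filter fun p => F p = c).card : ℤ))
  calc _ ≤ Nat.card {c : G // c ^ 3 = 1} *
        (s.card * ((A ×ˢ A).filter fun t => F t.1 = F t.2).card) := Nat.mul_le_mul_left _ h1
    _ = Nat.card G * ((A ×ˢ A).filter fun t => F t.1 = F t.2).card := by rw [← mul_assoc, hcard]
    _ ≤ _ := Nat.mul_le_mul_left _ (card_pairs_le A F)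

open Classical in
theorem card_torsion_sq_mul_cube_le [CommGroup G] [Finite G] (A : Finset ℕ) (F : ℕ → G)
    (hF : ∀ p, ∃ c, c ^ 3 = F p) :
    Nat.card {c : G // c ^ 3 = 1} ^ 2 * A.card ^ 3 ≤ Nat.card G ^ 2 *
      (36 * A.card + 2 * ((A ×ˢ A ×ˢ A).filter fun t => t.1 ≠ t.2.1 ∧ t.1 ≠ t.2.2 ∧
        t.2.1 ≠ t.2.2 ∧ F t.1 = F t.2.1 ∧ F t.1 = F t.2.2).card) := by
  obtain ⟨s, hs, hcard⟩ := exists_finset_range F hF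
  have hA := Finset.card_eq_sum_card_fiberwise (f := F) (s := A) (t := s) fun t _ => hs _
  have h1 : A.card ^ 3 ≤ s.card ^ 2 * ∑ c ∈ s, (A.filter fun p => F p = c).card ^ 3 := by
    rcases s.eq_empty_or_nonempty with h0 | h0
    · exact absurd (hs 0) (by simp [h0])
    have hpos : (0 : ℝ) < s.card := by exact_mod_cast h0.card_pos
    have := pow_sum_div_card_le_sum_pow (α := ℝ) (s := s)
      (f := fun c => ((A.filter fun p => F p = c).card : ℝ)) (fun _ _ => by positivity) 2
    rw [div_le_iff₀ (by positivity), mul_comm] at this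
    rw [hA]
    exact_mod_cast this
  have h2 := card_triples_le A F
  rw [card_eq_triples A F s hs, card_eq_pairs A F s hs] at h2
  have h3 : 6 * ∑ c ∈ s, (A.filter fun p => F p = c).card ^ 2 ≤
      ∑ c ∈ s, (A.filter fun p => F p = c).card ^ 3 + 36 * A.card := by
    rw [hA, Finset.mul_sum, Finset.mul_sum, ← Finset.sum_add_distrib]
    refine Finset.sum_le_sum fun c _ => ?_
    set n := (A.filter fun p => F p = c).card
    zify
    nlinarith [mul_nonneg (Nat.cast_nonneg (α := ℤ) n) (sq_nonneg ((n : ℤ) - 3))]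
  calc _ ≤ Nat.card {c : G // c ^ 3 = 1} ^ 2 *
        (s.card ^ 2 * ∑ c ∈ s, (A.filter fun p => F p = c).card ^ 3) := Nat.mul_le_mul_left _ h1
    _ = Nat.card G ^ 2 * ∑ c ∈ s, (A.filter fun p => F p = c).card ^ 3 := by
        rw [← mul_assoc, ← mul_pow, hcard]
    _ ≤ _ := Nat.mul_le_mul_left _ (by omega)

end PowerMeans

namespace ImagQuad

variable {R : Type*} [CommRing R] {d : ℕ}

theorem eq_intCast_mul_of_im_eq_zero (q : ImagQuad R d) {J : Ideal R} {α : R} (hα : α ≠ 0)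
    (hαJ : α ∈ J) (hmin : ∀ z ∈ J, z ≠ 0 → q.norm α ≤ q.norm z) {z : R} (hz : z ∈ J)
    (him : (q.ι z / q.ι α).im = 0) : ∃ n : ℤ, z = n * α := by
  have hα' : q.ι α ≠ 0 := (map_ne_zero_iff _ q.inj).mpr hα
  set r := (q.ι z / q.ι α).re with hr
  have hzr : q.ι z = (r : ℂ) * q.ι α := by
    rw [← div_eq_iff hα']
    exact Complex.ext (by simp [hr]) (by simp [him])
  refine ⟨round r, ?_⟩
  by_contra hne
  have h1 := hmin (z - round r * α) (J.sub_mem hz (J.mul_mem_left _ hαJ)) (sub_ne_zero.mpr hne)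
  have h2 : (q.norm α : ℝ) ≤ q.norm (z - round r * α) := by exact_mod_cast h1
  have h3 : q.ι (z - round r * α) = ((r - round r : ℝ) : ℂ) * q.ι α := by
    rw [map_sub, map_mul, hzr, map_intCast]; push_cast; ring
  rw [q.norm_eq_normSq, q.norm_eq_normSq, h3, Complex.normSq_mul, Complex.normSq_ofReal] at h2
  have h4 : 0 < Complex.normSq (q.ι α) := Complex.normSq_pos.mpr hα'
  have h5 : |r - round r| ≤ 1 / 2 := abs_sub_round r
  have h6 : (r - round r) * (r - round r) ≤ 1 / 4 := by
    rw [← abs_mul_abs_self]; nlinarith [abs_nonneg (r - round r)]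
  nlinarith

/-- Every nonzero ideal is, up to a principal factor, of the form `(a, θ - k)` with `(a, k)`
reduced. -/
theorem exists_reduced (q : ImagQuad R d) [IsDomain R] (hd : 0 < d) {J : Ideal R} (hJ : J ≠ ⊥) :
    ∃ (a : ℕ) (k : ℤ) (α : R), 0 < a ∧ α ≠ 0 ∧ (a : ℤ) ∣ d + k ^ 2 ∧ k ^ 2 ≤ d ∧
      Ideal.span {(a : R)} * J = Ideal.span {α} * Ideal.span {(a : R), q.θ - k} := by
  classical
  have hsd : 0 < Real.sqrt d := Real.sqrt_pos.mpr (by exact_mod_cast hd)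
  -- an element of minimal norm
  obtain ⟨α, ⟨hαJ, hα⟩, hmin'⟩ : ∃ α, (α ∈ J ∧ α ≠ 0) ∧ ∀ z, z ∈ J ∧ z ≠ 0 → q.norm α ≤ q.norm z := by
    obtain ⟨z, hz⟩ := Submodule.exists_mem_ne_zero_of_ne_bot hJ
    have hex : ∃ n, ∃ α, (α ∈ J ∧ α ≠ 0) ∧ q.norm α = n := ⟨_, z, hz, rfl⟩
    obtain ⟨α, h1, h2⟩ := Nat.find_spec hex
    exact ⟨α, h1, fun z hz => h2 ▸ Nat.find_min' hex ⟨z, hz, rfl⟩⟩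
  have hmin : ∀ z ∈ J, z ≠ 0 → q.norm α ≤ q.norm z := fun z h1 h2 => hmin' z ⟨h1, h2⟩
  have hα' : q.ι α ≠ 0 := (map_ne_zero_iff _ q.inj).mpr hα
  have hN : 0 < Complex.normSq (q.ι α) := by rwa [Complex.normSq_pos]
  -- imaginary parts are integral multiples of a fixed positive real
  set c : ℝ := Real.sqrt d / (2 * Complex.normSq (q.ι α)) with hc
  have hcpos : 0 < c := by positivity
  have him : ∀ z : R, ∃ v : ℤ, (q.ι z / q.ι α).im = v * c := by
    intro z
    obtain ⟨u, v, h, -⟩ := q.exists_coords (z * q.conj α)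
    refine ⟨v, ?_⟩
    have h2 := (q.re_im_of_two_mul h).2
    rw [map_mul, q.map_conj] at h2
    rw [div_eq_mul_inv, Complex.inv_def, ← mul_assoc, Complex.im_mul_ofReal, h2, hc]
    field_simp
  choose f hf using him
  have hfadd : ∀ z w, f (z + w) = f z + f w := by
    intro z w
    have h := hf (z + w)
    rw [map_add, add_div, Complex.add_im, hf, hf, ← add_mul] at h
    exact_mod_cast (mul_right_cancel₀ hcpos.ne' h).symm
  let φ : R →+ ℤ := AddMonoidHom.mk' f hfadd
  obtain ⟨g, hg⟩ := Int.subgroup_cyclic (J.toAddSubgroup.map φ)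
  have hgmem : ∀ z ∈ J, ∃ m : ℤ, f z = m * g := by
    intro z hz
    have : φ z ∈ J.toAddSubgroup.map φ := ⟨z, hz, rfl⟩
    rw [hg, AddSubgroup.mem_closure_singleton] at this
    obtain ⟨m, hm⟩ := this
    exact ⟨m, by rw [← smul_eq_mul, hm]; rfl⟩
  obtain ⟨β₀, hβ₀J, hβ₀⟩ : ∃ β ∈ J, f β = g := by
    have : g ∈ J.toAddSubgroup.map φ := by rw [hg]; exact AddSubgroup.mem_closure_singleton_self g
    obtain ⟨β, h1, h2⟩ := this
    exact ⟨β, h1, h2⟩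
  have hfα : f α = 0 := by
    have := hf α
    rw [div_self hα', Complex.one_im] at this
    exact_mod_cast ((mul_eq_zero.mp this.symm).resolve_right hcpos.ne')
  have hfθα : (q.ι (q.θ * α) / q.ι α) = (Real.sqrt d : ℂ) * Complex.I := by
    rw [map_mul, mul_div_cancel_right₀ _ hα', q.map_θ]
  -- sign and shift normalization
  obtain ⟨β, hβJ, hβpos, hβgen, hβre⟩ : ∃ β ∈ J, 0 < f β ∧ (∀ z ∈ J, ∃ m : ℤ, f z = m * f β) ∧
      |(q.ι β / q.ι α).re| ≤ 1 / 2 := by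
    have hg0 : g ≠ 0 := by
      rintro rfl
      obtain ⟨m, hm⟩ := hgmem (q.θ * α) (J.mul_mem_left _ hαJ)
      have := hf (q.θ * α)
      rw [hfθα, hm] at this
      simp at this
      omega
    obtain ⟨β₁, h1, h2, h3⟩ : ∃ β ∈ J, 0 < f β ∧ (∀ z ∈ J, ∃ m : ℤ, f z = m * f β) := by
      rcases lt_or_gt_of_ne hg0 with h | h
      · have hneg : f (-β₀) = -g := by rw [← hβ₀]; exact map_neg φ β₀
        refine ⟨-β₀, J.neg_mem hβ₀J, by omega, fun z hz => ?_⟩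
        obtain ⟨m, hm⟩ := hgmem z hz
        exact ⟨-m, by rw [hm, hneg]; ring⟩
      · exact ⟨β₀, hβ₀J, by omega, fun z hz => by rw [hβ₀]; exact hgmem z hz⟩
    set r := (q.ι β₁ / q.ι α).re
    have hshift : f (β₁ - round r * α) = f β₁ := by
      have := hf (β₁ - round r * α)
      rw [map_sub, map_mul, map_intCast, sub_div, mul_div_cancel_right₀ _ hα', Complex.sub_im,
        Complex.intCast_im, sub_zero, hf] at this
      exact_mod_cast (mul_right_cancel₀ hcpos.ne' this).symm
    refine ⟨β₁ - round r * α, J.sub_mem h1 (J.mul_mem_left _ hαJ), by rwa [hshift],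
      by rwa [hshift], ?_⟩
    rw [map_sub, map_mul, map_intCast, sub_div, mul_div_cancel_right₀ _ hα', Complex.sub_re,
      Complex.intCast_re]
    exact abs_sub_round r
  have hdecomp : ∀ z ∈ J, ∃ m n : ℤ, z = m * β + n * α := by
    intro z hz
    obtain ⟨m, hm⟩ := hβgen z hz
    have h0 : (q.ι (z - m * β) / q.ι α).im = 0 := by
      rw [map_sub, map_mul, map_intCast, sub_div, mul_div_assoc, Complex.sub_im,
        ← Complex.ofReal_intCast, Complex.im_ofReal_mul, hf, hf, hm]
      push_cast; ring
    obtain ⟨n, hn⟩ := q.eq_intCast_mul_of_im_eq_zero hα hαJ hmin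
      (J.sub_mem hz (J.mul_mem_left _ hβJ)) h0
    exact ⟨m, n, by rw [← hn]; ring⟩
  obtain ⟨a, k, hak⟩ := hdecomp (q.θ * α) (J.mul_mem_left _ hαJ)
  set τ := q.ι β / q.ι α with hτ
  have hβτ : q.ι β = τ * q.ι α := by rw [hτ, div_mul_cancel₀ _ hα']
  have haτ : (a : ℂ) * τ = (Real.sqrt d : ℂ) * Complex.I - k := by
    have h := congrArg q.ι hak
    rw [map_add, map_mul, map_mul, map_mul, hβτ, q.map_θ, map_intCast, map_intCast] at h
    have : ((a : ℂ) * τ - ((Real.sqrt d : ℂ) * Complex.I - k)) * q.ι α = 0 := by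
      linear_combination -h
    exact sub_eq_zero.mp ((mul_eq_zero.mp this).resolve_right hα')
  have hre : (a : ℝ) * τ.re = -k := by simpa using congrArg Complex.re haτ
  have him' : (a : ℝ) * τ.im = Real.sqrt d := by simpa using congrArg Complex.im haτ
  have hτim : 0 < τ.im := by rw [hτ, hf]; exact mul_pos (by exact_mod_cast hβpos) hcpos
  have ha : 0 < (a : ℝ) := by
    by_contra h
    have := mul_nonpos_of_nonpos_of_nonneg (not_lt.mp h) hτim.le
    linarith
  have hτ1 : 1 ≤ Complex.normSq τ := by
    have hβ0 : β ≠ 0 := by rintro rfl; rw [hτ, map_zero, zero_div] at hτim; simp at hτim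
    have h1 : (q.norm α : ℝ) ≤ q.norm β := by exact_mod_cast hmin β hβJ hβ0
    rw [q.norm_eq_normSq, q.norm_eq_normSq, hβτ, Complex.normSq_mul] at h1
    nlinarith
  have hk : (k : ℝ) ^ 2 ≤ d := by
    have hsq : (a : ℝ) ^ 2 * Complex.normSq τ = k ^ 2 + d := by
      rw [Complex.normSq_apply]
      have := Real.mul_self_sqrt (Nat.cast_nonneg (α := ℝ) d)
      rw [← him'] at this
      have h2 : ((a : ℝ) * τ.re) ^ 2 = k ^ 2 := by rw [hre, neg_sq]
      linarith
    have h1 : (a : ℝ) ^ 2 ≤ k ^ 2 + d := by rw [← hsq]; nlinarith [sq_nonneg (a : ℝ)]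
    have h2 : (k : ℝ) ^ 2 ≤ a ^ 2 / 4 := by
      have h3 : ((a : ℝ) * τ.re) ^ 2 = k ^ 2 := by rw [hre, neg_sq]
      have h4 : τ.re ^ 2 ≤ 1 / 4 := by rw [← sq_abs]; nlinarith [abs_nonneg τ.re]
      rw [← h3, mul_pow]
      nlinarith [sq_nonneg (a : ℝ)]
    linarith [sq_nonneg (k : ℝ)]
  have haβ : (a : R) * β = α * (q.θ - k) := by linear_combination -hak
  obtain ⟨x, y, hxy⟩ := hdecomp (q.θ * β) (J.mul_mem_left _ hβJ)
  have hdvd : a ∣ d + k ^ 2 := by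
    have hθ := q.θ_mul_θ
    have e1 : α * (q.θ * (q.θ - k)) = α * (x * (q.θ - k) + a * y) := by
      linear_combination (-q.θ) * haβ + (a : R) * hxy + x * haβ
    have e2 := mul_left_cancel₀ hα e1
    have e3 : ((-d : ℤ) : R) + ((-k : ℤ) : R) * q.θ = ((a * y - x * k : ℤ) : R) + (x : R) * q.θ := by
      push_cast
      linear_combination e2 - hθ
    obtain ⟨e4, e5⟩ := q.eq_of_coords hd e3
    refine ⟨-y, ?_⟩
    rw [← e5] at e4
    linear_combination -e4
  have ha' : 0 < a := by exact_mod_cast ha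
  lift a to ℕ using ha'.le
  refine ⟨a, k, α, by exact_mod_cast ha', hα, hdvd, by exact_mod_cast hk, ?_⟩
  rw [Int.cast_natCast] at haβ
  apply le_antisymm
  · rw [Ideal.span_singleton_mul_le_iff]
    intro z hz
    obtain ⟨m, n, rfl⟩ := hdecomp z hz
    rw [Ideal.mem_span_singleton_mul]
    refine ⟨m * (q.θ - k) + n * a, Ideal.add_mem _ (Ideal.mul_mem_left _ _ (Ideal.subset_span
      (by simp))) (Ideal.mul_mem_left _ _ (Ideal.subset_span (by simp))), ?_⟩
    linear_combination (-m) * haβ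
  · rw [Ideal.span_mul_span', Ideal.span_le]
    rintro _ ⟨w, rfl, z, rfl | rfl, rfl⟩ <;> simp only [SetLike.mem_coe, Ideal.mem_span_singleton_mul]
    · exact ⟨w, hαJ, mul_comm _ _⟩
    · exact ⟨β, hβJ, haβ⟩

theorem card_classGroup_le (q : ImagQuad R d) [IsDedekindDomain R] (hd : 0 < d) :
    Finite (ClassGroup R) ∧ Nat.card (ClassGroup R) ≤
      ∑ k ∈ Finset.Icc (-(Nat.sqrt d : ℤ)) (Nat.sqrt d), (d + k.natAbs ^ 2).divisors.card := by
  classical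
  let S := (Finset.Icc (-(Nat.sqrt d : ℤ)) (Nat.sqrt d)).sigma fun k => (d + k.natAbs ^ 2).divisors
  have hmem : ∀ a : ℕ, 0 < a → ∀ k : ℤ,
      Ideal.span {(a : R), q.θ - k} ∈ nonZeroDivisors (Ideal R) := by
    intro a ha k
    rw [mem_nonZeroDivisors_iff_ne_zero]
    intro h
    have h1 : (a : R) ∈ Ideal.span {(a : R), q.θ - k} := Ideal.subset_span (by simp)
    rw [h, Ideal.zero_eq_bot, Ideal.mem_bot] at h1
    exact ha.ne' (q.natCast_inj (by rw [h1, Nat.cast_zero]))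
  let F : S → ClassGroup R := fun t =>
    ClassGroup.mk0 ⟨_, hmem t.1.2 (Nat.pos_of_mem_divisors (Finset.mem_sigma.mp t.2).2) t.1.1⟩
  have hF : Function.Surjective F := by
    intro c
    obtain ⟨⟨J, hJ⟩, rfl⟩ := ClassGroup.mk0_surjective c
    obtain ⟨a, k, α, ha, hα, hdvd, hk, h⟩ := q.exists_reduced hd (mem_nonZeroDivisors_iff_ne_zero.mp hJ)
    have hkabs : k.natAbs ≤ Nat.sqrt d := by
      rw [Nat.le_sqrt']
      zify
      rwa [sq_abs]
    have hS : (⟨k, a⟩ : Σ _ : ℤ, ℕ) ∈ S := by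
      rw [Finset.mem_sigma, Finset.mem_Icc, Nat.mem_divisors]
      have h1 : -(Nat.sqrt d : ℤ) ≤ k ∧ k ≤ Nat.sqrt d := by omega
      refine ⟨h1, ?_, by omega⟩
      zify
      rwa [sq_abs]
    refine ⟨⟨⟨k, a⟩, hS⟩, ?_⟩
    rw [ClassGroup.mk0_eq_mk0_iff]
    exact ⟨α, a, hα, fun h0 => ha.ne' (q.natCast_inj (by rw [h0, Nat.cast_zero])), h.symm⟩
  refine ⟨Finite.of_surjective F hF, ?_⟩
  calc Nat.card (ClassGroup R) ≤ Nat.card S := Nat.card_le_card_of_surjective F hF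
    _ = S.card := by simp
    _ = _ := Finset.card_sigma _ _

end ImagQuad

theorem exists_ratCoords {d : ℕ} (hd : 0 < d) {z : ℂ} (hz : z ∈ Kneg d) :
    ∃ r s : ℚ, z = (r : ℂ) + s * ((Real.sqrt d : ℂ) * Complex.I) := by
  set θ := (Real.sqrt d : ℂ) * Complex.I with hθdef
  have hθ : θ * θ = -(d : ℂ) := by
    have h : ((Real.sqrt d : ℝ) : ℂ) * (Real.sqrt d : ℝ) = (d : ℂ) := by
      rw [← Complex.ofReal_mul, Real.mul_self_sqrt (Nat.cast_nonneg d)]; simp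
    rw [hθdef]
    linear_combination ((Real.sqrt d : ℝ) : ℂ) * (Real.sqrt d : ℝ) * Complex.I_mul_I - h
  unfold Kneg at hz
  induction hz using IntermediateField.adjoin_induction with
  | mem x hx => exact ⟨0, 1, by rw [Set.mem_singleton_iff] at hx; rw [hx, hθdef]; simp⟩
  | algebraMap x => exact ⟨x, 0, by simp⟩
  | add x y _ _ hx hy =>
    obtain ⟨r, s, rfl⟩ := hx
    obtain ⟨r', s', rfl⟩ := hy
    exact ⟨r + r', s + s', by push_cast; ring⟩
  | inv x _ hx =>
    obtain ⟨r, s, rfl⟩ := hx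
    by_cases h0 : r = 0 ∧ s = 0
    · exact ⟨0, 0, by simp [h0.1, h0.2]⟩
    have hn : r ^ 2 + d * s ^ 2 ≠ 0 := by
      intro h
      have hd' : (0 : ℚ) < d := by exact_mod_cast hd
      have h1 : r ^ 2 = 0 := by nlinarith [sq_nonneg r, mul_nonneg hd'.le (sq_nonneg s)]
      have h2 : s ^ 2 = 0 := by
        rw [h1, zero_add] at h
        exact (mul_eq_zero.mp h).resolve_left hd'.ne'
      exact h0 ⟨pow_eq_zero_iff two_ne_zero |>.mp h1, pow_eq_zero_iff two_ne_zero |>.mp h2⟩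
    have hn' : (r : ℂ) ^ 2 + d * s ^ 2 ≠ 0 := by exact_mod_cast hn
    refine ⟨r / (r ^ 2 + d * s ^ 2), -s / (r ^ 2 + d * s ^ 2), ?_⟩
    apply inv_eq_of_mul_eq_one_right
    push_cast
    rw [div_eq_mul_inv, div_eq_mul_inv]
    linear_combination (-(s : ℂ) ^ 2 * ((r : ℂ) ^ 2 + d * s ^ 2)⁻¹) * hθ +
      mul_inv_cancel₀ hn'
  | mul x y _ _ hx hy =>
    obtain ⟨r, s, rfl⟩ := hx
    obtain ⟨r', s', rfl⟩ := hy
    refine ⟨r * r' - d * (s * s'), r * s' + s * r', ?_⟩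
    push_cast
    linear_combination (s : ℂ) * s' * hθ

theorem exists_intCast_eq_of_isIntegral {r : ℚ} (h : IsIntegral ℤ (r : ℂ)) : ∃ n : ℤ, (n : ℚ) = r := by
  have h1 : IsIntegral ℤ (algebraMap ℚ ℂ r) := by simpa using h
  rw [isIntegral_algebraMap_iff (algebraMap ℚ ℂ).injective] at h1
  obtain ⟨n, hn⟩ := IsIntegrallyClosed.isIntegral_iff.mp h1
  exact ⟨n, by simpa using hn⟩

theorem exists_intCast_eq_of_squarefree_mul_sq {d : ℕ} (hd : Squarefree d) {t : ℚ} {m : ℤ}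
    (h : d * t ^ 2 = m) : ∃ n : ℤ, (n : ℚ) = t := by
  have hden : (t.den : ℚ) ≠ 0 := by exact_mod_cast t.den_nz
  have h1 : (d : ℤ) * t.num ^ 2 = m * t.den ^ 2 := by
    have : (d : ℚ) * t.num ^ 2 = m * t.den ^ 2 := by
      rw [← h, mul_assoc, ← mul_pow, Rat.mul_den_eq_num]
    exact_mod_cast this
  have h2 : t.den ^ 2 ∣ d := by
    have hcop : Nat.Coprime (t.den ^ 2) (t.num.natAbs ^ 2) := (t.reduced.symm.pow 2 2)
    apply hcop.dvd_of_dvd_mul_right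
    zify
    rw [sq_abs, h1]
    exact dvd_mul_left _ _
  rw [sq] at h2
  have h3 : t.den = 1 := Nat.isUnit_iff.mp (hd _ h2)
  exact ⟨t.num, by rw [← Rat.mul_den_eq_num t, h3]; simp⟩

open NumberField in
theorem nonempty_imagQuad {d : ℕ} (hd : Squarefree d) : Nonempty (ImagQuad (𝓞 (Kneg d)) d) := by
  have hd0 : 0 < d := Nat.pos_of_ne_zero hd.ne_zero
  set θ := (Real.sqrt d : ℂ) * Complex.I with hθdef
  have hsq : ((Real.sqrt d : ℝ) : ℂ) * (Real.sqrt d : ℝ) = (d : ℂ) := by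
    rw [← Complex.ofReal_mul, Real.mul_self_sqrt (Nat.cast_nonneg d)]; simp
  have hθ : θ ^ 2 = ((-d : ℤ) : ℂ) := by
    rw [hθdef]
    push_cast
    linear_combination ((Real.sqrt d : ℝ) : ℂ) * (Real.sqrt d : ℝ) * Complex.I_mul_I - hsq
  have hθK : θ ∈ Kneg d := IntermediateField.subset_adjoin ℚ _ rfl
  have hθint : IsIntegral ℤ (⟨θ, hθK⟩ : Kneg d) := by
    apply IsIntegral.of_pow two_pos
    have : (⟨θ, hθK⟩ : Kneg d) ^ 2 = ((-d : ℤ) : Kneg d) := Subtype.ext (by simpa using hθ)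
    rw [this]
    exact isIntegral_algebraMap
  obtain ⟨T, hT⟩ : ∃ T : 𝓞 (Kneg d), ((algebraMap (Kneg d) ℂ).comp
      (algebraMap (𝓞 (Kneg d)) (Kneg d))) T = θ := ⟨⟨⟨θ, hθK⟩, hθint⟩, rfl⟩
  refine ⟨{ ι := (algebraMap (Kneg d) ℂ).comp (algebraMap (𝓞 (Kneg d)) (Kneg d))
            inj := (algebraMap (Kneg d) ℂ).injective.comp RingOfIntegers.coe_injective
            θ := T
            map_θ := hT
            exists_coords := ?_ }⟩
  intro z
  have hzint : IsIntegral ℤ (((z : Kneg d)) : ℂ) := z.isIntegral_coe.map (Kneg d).val.toRingHom.toIntAlgHom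
  obtain ⟨r, s, hrs⟩ := exists_ratCoords hd0 (z : Kneg d).2
  have hconj : (starRingEnd ℂ) (((z : Kneg d)) : ℂ) = r - s * θ := by
    rw [hrs]; simp [hθdef]; ring
  have hcint : IsIntegral ℤ ((r : ℂ) - s * θ) := by
    rw [← hconj]; exact hzint.map (starRingEnd ℂ).toIntAlgHom
  rw [hrs] at hzint
  obtain ⟨u, hu⟩ := exists_intCast_eq_of_isIntegral (r := 2 * r) (by
    have e : ((2 * r : ℚ) : ℂ) = (r + s * θ) + (r - s * θ) := by push_cast; ring
    rw [e]; exact hzint.add hcint)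
  obtain ⟨n, hn⟩ := exists_intCast_eq_of_isIntegral (r := r ^ 2 + d * s ^ 2) (by
    have e : ((r ^ 2 + d * s ^ 2 : ℚ) : ℂ) = (r + s * θ) * (r - s * θ) := by
      push_cast at hθ ⊢; linear_combination (s : ℂ) ^ 2 * hθ
    rw [e]; exact hzint.mul hcint)
  obtain ⟨v, hv⟩ := exists_intCast_eq_of_squarefree_mul_sq hd (t := 2 * s) (m := 4 * n - u ^ 2) (by
    push_cast; rw [hu, hn]; ring)
  refine ⟨u, v, ?_, n, ?_⟩
  · have hinj : Function.Injective
        ((algebraMap (Kneg d) ℂ).comp (algebraMap (𝓞 (Kneg d)) (Kneg d))) :=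
      (algebraMap (Kneg d) ℂ).injective.comp RingOfIntegers.coe_injective
    apply hinj
    rw [map_add, map_mul, map_mul, map_ofNat, map_intCast, map_intCast, hT]
    have hu' : (u : ℂ) = 2 * r := by exact_mod_cast congrArg (Rat.cast (K := ℂ)) hu
    have hv' : (v : ℂ) = 2 * s := by exact_mod_cast congrArg (Rat.cast (K := ℂ)) hv
    have : (2 : ℂ) * (((z : Kneg d)) : ℂ) = u + v * θ := by
      rw [hrs, hu', hv']; ring
    exact this
  · have : (u : ℚ) ^ 2 + d * v ^ 2 = 4 * n := by rw [hu, hv, hn]; ring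
    exact_mod_cast this

theorem numberField_kneg (d : ℕ) : NumberField (Kneg d) := by
  have h : IsIntegral ℚ ((Real.sqrt d : ℂ) * Complex.I) := by
    apply IsIntegral.of_pow two_pos
    have hsq : ((Real.sqrt d : ℝ) : ℂ) * (Real.sqrt d : ℝ) = (d : ℂ) := by
      rw [← Complex.ofReal_mul, Real.mul_self_sqrt (Nat.cast_nonneg d)]; simp
    have : ((Real.sqrt d : ℂ) * Complex.I) ^ 2 = algebraMap ℚ ℂ (-d) := by
      rw [map_neg, map_natCast]
      linear_combination ((Real.sqrt d : ℝ) : ℂ) * (Real.sqrt d : ℝ) * Complex.I_mul_I - hsq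
    rw [this]
    exact isIntegral_algebraMap
  exact { to_charZero := inferInstance, to_finiteDimensional := IntermediateField.adjoin.finiteDimensional h }

/-- The upper bound for the class number coming from counting reduced forms. -/
noncomputable def formCount (d : ℕ) : ℕ :=
  ∑ k ∈ Finset.Icc (-(Nat.sqrt d : ℤ)) (Nat.sqrt d), (d + k.natAbs ^ 2).divisors.card

/-- The pairs of distinct `p₁, p₂` in `P` for which `PairRel d p₁ p₂` holds. -/
noncomputable def relPairs (P : Finset ℕ) (d : ℕ) : Finset (ℕ × ℕ) := by
  classical
  exact (P ×ˢ P).filter fun t => t.1 ≠ t.2 ∧ PairRel d t.1 t.2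

/-- The triples of distinct `p₁, p₂, p₃` in `P` for which `TripleRel d p₁ p₂ p₃` holds. -/
noncomputable def relTriples (P : Finset ℕ) (d : ℕ) : Finset (ℕ × ℕ × ℕ) := by
  classical
  exact (P ×ˢ P ×ˢ P).filter fun t => t.1 ≠ t.2.1 ∧ t.1 ≠ t.2.2 ∧ t.2.1 ≠ t.2.2 ∧
    TripleRel d t.1 t.2.1 t.2.2

theorem hneg_bounds {d : ℕ} (hd : Squarefree d) :
    hneg 3 d ≤ formCount d ∧
    (∀ Z, hneg 3 d * (splitPrimes d Z).card ^ 2 ≤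
      formCount d * (Z + (relPairs (oddPrimesLE Z) d).card)) ∧
    (∀ Z, hneg 3 d ^ 2 * (splitPrimes d Z).card ^ 3 ≤
      formCount d ^ 2 * (36 * Z + 2 * (relTriples (oddPrimesLE Z) d).card)) := by
  classical
  obtain ⟨q⟩ := nonempty_imagQuad hd
  have hd0 : 0 < d := Nat.pos_of_ne_zero hd.ne_zero
  have := numberField_kneg d
  obtain ⟨hfin, hcard⟩ := q.card_classGroup_le hd0
  have hsub : ∀ Z, splitPrimes d Z ⊆ oddPrimesLE Z := fun Z => Finset.filter_subset _ _
  have hZ : ∀ Z, (splitPrimes d Z).card ≤ Z := fun Z => by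
    calc _ ≤ (Finset.Icc 1 Z).card := Finset.card_le_card fun p hp => by
          have := mem_oddPrimesLE.mp (hsub Z hp)
          rw [Finset.mem_Icc]; omega
      _ = Z := by simp
  refine ⟨(Nat.card_le_card_of_injective _ Subtype.val_injective).trans hcard, fun Z => ?_,
    fun Z => ?_⟩
  · obtain ⟨F, hF, hF2, -⟩ := q.exists_cube_map hd0 Z
    refine (card_torsion_mul_sq_le (splitPrimes d Z) F hF).trans (Nat.mul_le_mul hcard ?_)
    refine Nat.add_le_add (hZ Z) (Finset.card_le_card ?_)
    rintro ⟨x, y⟩ h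
    simp only [Finset.mem_filter, Finset.mem_product, relPairs] at h ⊢
    exact ⟨⟨hsub Z h.1.1, hsub Z h.1.2⟩, h.2.1, hF2 x h.1.1 y h.1.2 h.2.1 h.2.2⟩
  · obtain ⟨F, hF, -, hF3⟩ := q.exists_cube_map hd0 Z
    refine (card_torsion_sq_mul_cube_le (splitPrimes d Z) F hF).trans
      (Nat.mul_le_mul (Nat.pow_le_pow_left hcard 2) ?_)
    refine Nat.add_le_add (Nat.mul_le_mul_left _ (hZ Z))
      (Nat.mul_le_mul_left _ (Finset.card_le_card ?_))
    rintro ⟨x, y, z⟩ h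
    simp only [Finset.mem_filter, Finset.mem_product, relTriples] at h ⊢
    obtain ⟨⟨hx, hy, hz⟩, hxy, hxz, hyz, h1, h2⟩ := h
    exact ⟨⟨hsub Z hx, hsub Z hy, hsub Z hz⟩, hxy, hxz, hyz, hF3 x hx y hy z hz hxy hxz h1 h2⟩

theorem card_le_card_of_rel {α β : Type*} {s : Finset α} {t : Finset β} (r : α → β → Prop)
    (h : ∀ a ∈ s, ∃ b ∈ t, r a b)
    (hinj : ∀ a ∈ s, ∀ a' ∈ s, ∀ b, r a b → r a' b → a = a') : s.card ≤ t.card := by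
  classical
  rcases s.eq_empty_or_nonempty with rfl | ⟨a₀, ha₀⟩
  · simp
  have : Nonempty β := ⟨(h a₀ ha₀).choose⟩
  choose! f hf hr using h
  exact Finset.card_le_card_of_injOn f (fun a ha => hf a ha)
    fun a ha a' ha' he => hinj a ha a' ha' (f a) (hr a ha) (he ▸ hr a' ha')

theorem natCast_div_le_real (a b : ℕ) : ((a / b : ℕ) : ℝ) ≤ a / b := Nat.cast_div_le

/-- Solutions of `x² ≡ 4 q³ (mod v²)` with `x ≥ 0` and `(4 q³ - x²) / v²` in a dyadic block. -/
theorem card_sq_congr_block_le {q v D : ℕ} (hv : 0 < v) (hqv : Nat.Coprime q v)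
    {L : ℝ} (hL1 : 1 ≤ L) (hL : ∀ n, n ≠ 0 → n ≤ v ^ 2 → (n.divisors.card : ℝ) ≤ L)
    {U : Finset ℤ} (hU : ∀ x ∈ U, 0 ≤ x ∧ (v : ℤ) ^ 2 ∣ x ^ 2 - 4 * (q : ℤ) ^ 3 ∧
      (D : ℤ) * v ^ 2 ≤ 4 * (q : ℤ) ^ 3 - x ^ 2 ∧ 4 * (q : ℤ) ^ 3 - x ^ 2 ≤ 2 * D * v ^ 2) :
    (U.card : ℝ) ≤ L ^ 2 * (2 * (Nat.sqrt D + 1) / v + 1) := by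
  classical
  rcases U.eq_empty_or_nonempty with rfl | hne
  · simp; positivity
  set s := Nat.sqrt D + 1 with hs
  set A := U.min' hne with hA
  have hAU : A ∈ U := U.min'_mem hne
  have hrange : ∀ x ∈ U, A ≤ x ∧ x - A ≤ s * v := by
    intro x hx
    have hAx : A ≤ x := U.min'_le x hx
    refine ⟨hAx, ?_⟩
    obtain ⟨h0, -, h1, -⟩ := hU x hx
    obtain ⟨h0', -, -, h2⟩ := hU A hAU
    have h3 : x ^ 2 - A ^ 2 ≤ D * v ^ 2 := by linarith
    have h4 : (D : ℤ) ≤ s ^ 2 := by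
      have := Nat.lt_succ_sqrt' D
      exact_mod_cast this.le
    have h5 : (x - A) ^ 2 ≤ (s * v) ^ 2 := by
      have h6 : (D : ℤ) * v ^ 2 ≤ s ^ 2 * v ^ 2 := by gcongr
      nlinarith [mul_nonneg h0' (sub_nonneg.mpr hAx)]
    exact (le_abs_self _).trans (abs_le_of_sq_le_sq h5 (by positivity))
  have hv' : (0 : ℝ) < v := by exact_mod_cast hv
  have hqv' : IsCoprime (q : ℤ) (v : ℤ) := Nat.isCoprime_iff_coprime.mpr hqv
  rcases Nat.even_or_odd v with ⟨w, hw⟩ | hodd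
  · have hw0 : 0 < w := by omega
    have hvw : v = 2 * w := by omega
    have heven : ∀ x ∈ U, ∃ y, x = 2 * y := by
      intro x hx
      obtain ⟨-, ⟨m, hm⟩, -, -⟩ := hU x hx
      have : (2 : ℤ) ∣ x ^ 2 := by
        refine ⟨2 * q ^ 3 + 2 * w ^ 2 * m, ?_⟩
        rw [hvw] at hm; push_cast at hm
        linarith
      exact Int.prime_two.dvd_of_dvd_pow this
    have hinj : Set.InjOn (fun x : ℤ => x / 2) U := by
      intro x hx y hy h
      obtain ⟨x', rfl⟩ := heven x hx
      obtain ⟨y', rfl⟩ := heven y hy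
      simp at h
      rw [h]
    have hcop : IsCoprime ((q : ℤ) ^ 3) ((w ^ 2 : ℕ) : ℤ) := by
      push_cast
      refine (IsCoprime.of_isCoprime_of_dvd_right hqv' ?_).pow
      exact_mod_cast Dvd.intro_left 2 hvw.symm
    have h := card_pow_congr_le (k := 2) (Or.inl rfl) (m := w ^ 2) (by positivity) ((q : ℤ) ^ 3) hcop
      (U.image fun x => x / 2) (A / 2) (s * w) (by
        intro y hy
        obtain ⟨x, hx, rfl⟩ := Finset.mem_image.mp hy
        obtain ⟨h1, h2⟩ := hrange x hx
        obtain ⟨-, hdvd, -, -⟩ := hU x hx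
        obtain ⟨x', rfl⟩ := heven x hx
        obtain ⟨a, ha⟩ := heven A hAU
        rw [ha] at h1 h2 ⊢
        rw [hvw] at h2 hdvd
        simp only [ne_eq, OfNat.ofNat_ne_zero, not_false_eq_true, Int.mul_ediv_cancel_left]
        push_cast at h2 hdvd ⊢
        refine ⟨by omega, by linarith, ?_⟩
        apply Int.dvd_of_mul_dvd_mul_left (a := 4) (by norm_num)
        convert hdvd using 1 <;> ring)
    rw [Finset.card_image_of_injOn hinj] at h
    have hτ : (((w ^ 2).divisors.card : ℕ) : ℝ) ≤ L :=
      hL _ (by positivity) (Nat.pow_le_pow_left (by omega) 2)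
    have hw' : (0 : ℝ) < w := by exact_mod_cast hw0
    calc (U.card : ℝ) ≤ ((w ^ 2).divisors.card ^ 2 * (s * w / w ^ 2 + 1) : ℕ) := by exact_mod_cast h
      _ ≤ L ^ 2 * ((s * w : ℕ) / (w ^ 2 : ℕ) + 1) := by
          push_cast
          gcongr
          exact_mod_cast natCast_div_le_real (s * w) (w ^ 2)
      _ = _ := by
          rw [hvw, hs]; push_cast
          field_simp
  · have hcop : IsCoprime (4 * (q : ℤ) ^ 3) ((v ^ 2 : ℕ) : ℤ) := by
      push_cast
      apply IsCoprime.pow_right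
      refine IsCoprime.mul_left ?_ hqv'.pow_left
      have : IsCoprime (2 : ℤ) (v : ℤ) := by
        exact_mod_cast Nat.isCoprime_iff_coprime.mpr (Nat.coprime_two_left.mpr hodd)
      exact_mod_cast this.pow_left (m := 2)
    have h := card_pow_congr_le (k := 2) (Or.inl rfl) (m := v ^ 2) (by positivity) _ hcop
      U A (s * v) (by
        intro x hx
        obtain ⟨h1, h2⟩ := hrange x hx
        obtain ⟨-, hdvd, -, -⟩ := hU x hx
        push_cast
        exact ⟨h1, by linarith, hdvd⟩)
    have hτ : (((v ^ 2).divisors.card : ℕ) : ℝ) ≤ L := hL _ (by positivity) le_rfl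
    calc (U.card : ℝ) ≤ ((v ^ 2).divisors.card ^ 2 * (s * v / v ^ 2 + 1) : ℕ) := by exact_mod_cast h
      _ ≤ L ^ 2 * ((s * v : ℕ) / (v ^ 2 : ℕ) + 1) := by
          push_cast
          gcongr
          exact_mod_cast natCast_div_le_real (s * v) (v ^ 2)
      _ = L ^ 2 * (s / v + 1) := by
          push_cast
          field_simp
      _ ≤ _ := by
          gcongr
          rw [hs]; push_cast
          linarith [(Nat.cast_nonneg (Nat.sqrt D) : (0 : ℝ) ≤ Nat.sqrt D)]

theorem card_oddPrimesLE_le (Z : ℕ) : (oddPrimesLE Z).card ≤ Z := by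
  calc _ ≤ (Finset.Icc 1 Z).card := Finset.card_le_card fun p hp => by
        have := mem_oddPrimesLE.mp hp
        rw [Finset.mem_Icc]; omega
    _ = Z := by simp

theorem le_of_pairRel {d p₁ p₂ Z D V : ℕ} {u v : ℤ} (hd : D ≤ d)
    (hp₁ : p₁ ∈ oddPrimesLE Z) (hp₂ : p₂ ∈ oddPrimesLE Z)
    (hV : ∀ v : ℕ, D * v ^ 2 ≤ 4 * Z ^ 6 → v ≤ V) (hv : 0 < v)
    (h : u ^ 2 + d * v ^ 2 = 4 * ((p₁ : ℤ) * p₂) ^ 3) : v.toNat ∈ Finset.Icc 1 V := by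
  rw [Finset.mem_Icc]
  refine ⟨by omega, hV _ ?_⟩
  zify
  rw [Int.toNat_of_nonneg hv.le]
  have h1 : (p₁ : ℤ) ≤ Z := by exact_mod_cast (mem_oddPrimesLE.mp hp₁).2.1
  have h2 : (p₂ : ℤ) ≤ Z := by exact_mod_cast (mem_oddPrimesLE.mp hp₂).2.1
  have h3 : ((p₁ : ℤ) * p₂) ^ 3 ≤ (Z * Z) ^ 3 := by gcongr
  have h4 : (D : ℤ) * v ^ 2 ≤ d * v ^ 2 := by gcongr
  calc (D : ℤ) * v ^ 2 ≤ 4 * (Z * Z) ^ 3 := by linarith [sq_nonneg u]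
    _ = _ := by ring

theorem sum_card_relPairs_le {D Z V : ℕ} {L : ℝ} (hL1 : 1 ≤ L)
    (hV : ∀ v : ℕ, D * v ^ 2 ≤ 4 * Z ^ 6 → v ≤ V)
    (hL : ∀ n, n ≠ 0 → n ≤ V ^ 2 → (n.divisors.card : ℝ) ≤ L)
    (hH : ∑ v ∈ Finset.Icc 1 V, (1 : ℝ) / v ≤ L) :
    ((∑ d ∈ Finset.Ico D (2 * D), (relPairs (oddPrimesLE Z) d).card : ℕ) : ℝ) ≤
      L ^ 3 * Z ^ 2 * (2 * (Nat.sqrt D + 1) + V) := by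
  classical
  set P := oddPrimesLE Z with hP
  let U : ℕ × ℕ × ℕ → Finset ℤ := fun t =>
    (Finset.Icc (0 : ℤ) (4 * ((t.1 * t.2.1 : ℕ) : ℤ) ^ 3)).filter fun x =>
      (t.2.2 : ℤ) ^ 2 ∣ x ^ 2 - 4 * ((t.1 * t.2.1 : ℕ) : ℤ) ^ 3 ∧
      (D : ℤ) * t.2.2 ^ 2 ≤ 4 * ((t.1 * t.2.1 : ℕ) : ℤ) ^ 3 - x ^ 2 ∧
      4 * ((t.1 * t.2.1 : ℕ) : ℤ) ^ 3 - x ^ 2 ≤ 2 * D * t.2.2 ^ 2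
  let T : Finset (ℕ × ℕ × ℕ) := (P ×ˢ P ×ˢ Finset.Icc 1 V).filter fun t =>
    Nat.Coprime (t.1 * t.2.1) t.2.2
  have hcard : ∑ d ∈ Finset.Ico D (2 * D), (relPairs P d).card ≤ (T.sigma U).card := by
    rw [← Finset.card_sigma]
    refine card_le_card_of_rel (fun a b => a.2.1 = b.1.1 ∧ a.2.2 = b.1.2.1 ∧ 0 < b.1.2.2 ∧
      b.2 ^ 2 + a.1 * (b.1.2.2 : ℤ) ^ 2 = 4 * ((b.1.1 : ℤ) * b.1.2.1) ^ 3) ?_ ?_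
    · rintro ⟨d, p₁, p₂⟩ h
      simp only [Finset.mem_sigma, relPairs, Finset.mem_filter, Finset.mem_product,
        Finset.mem_Ico] at h
      obtain ⟨⟨hd1, hd2⟩, ⟨hp₁, hp₂⟩, hne, u, v, he, hv, hv1, hv2⟩ := h
      have hmem := le_of_pairRel hd1 hp₁ hp₂ hV hv he
      lift v to ℕ using hv.le
      rw [Int.toNat_natCast] at hmem
      have hvpos : 0 < v := by omega
      have hd1' : (D : ℤ) ≤ d := by exact_mod_cast hd1
      have hd2' : (d : ℤ) ≤ 2 * D := by exact_mod_cast hd2.le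
      refine ⟨⟨(p₁, p₂, v), |u|⟩, ?_, rfl, rfl, hvpos, by rw [sq_abs]; exact he⟩
      simp only [Finset.mem_sigma, T, U, Finset.mem_filter, Finset.mem_product, Finset.mem_Icc,
        sq_abs]
      push_cast
      refine ⟨⟨⟨hp₁, hp₂, Finset.mem_Icc.mp hmem⟩, ?_⟩, ⟨abs_nonneg u, ?_⟩, ⟨-d, ?_⟩, ?_, ?_⟩
      · have c1 := ((mem_oddPrimesLE.mp hp₁).2.2.coprime_iff_not_dvd (n := v)).mpr
          (by exact_mod_cast hv1)
        have c2 := ((mem_oddPrimesLE.mp hp₂).2.2.coprime_iff_not_dvd (n := v)).mpr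
          (by exact_mod_cast hv2)
        exact c1.mul_left c2
      · rw [← he]
        have h1 : |u| ≤ u ^ 2 := by
          rw [← sq_abs]
          rcases (abs_nonneg u).eq_or_lt with h | h
          · rw [← h]; simp
          · nlinarith
        have : (0 : ℤ) ≤ d * (v : ℤ) ^ 2 := by positivity
        linarith
      · linear_combination he
      · rw [← he]
        have : (D : ℤ) * v ^ 2 ≤ d * v ^ 2 := by gcongr
        linarith
      · rw [← he]
        have : (d : ℤ) * v ^ 2 ≤ 2 * D * v ^ 2 := by gcongr
        linarith
    · rintro ⟨d, p₁, p₂⟩ - ⟨d', p₁', p₂'⟩ - ⟨⟨q₁, q₂, v⟩, u⟩ ⟨h1, h2, h3, h4⟩ ⟨h1', h2', h3', h4'⟩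
      simp only at h1 h2 h3 h4 h1' h2' h3' h4'
      have hv : (v : ℤ) ^ 2 ≠ 0 := by positivity
      have : (d : ℤ) = d' := mul_right_cancel₀ hv (by linarith)
      have : d = d' := by exact_mod_cast this
      subst this h1 h2 h1' h2'
      rfl
  have hU : ∀ t ∈ T, ((U t).card : ℝ) ≤ L ^ 2 * (2 * (Nat.sqrt D + 1) * (1 / t.2.2) + 1) := by
    rintro ⟨p₁, p₂, v⟩ ht
    simp only [T, Finset.mem_filter, Finset.mem_product, Finset.mem_Icc] at ht
    have := card_sq_congr_block_le (q := p₁ * p₂) (v := v) (D := D) (by omega) ht.2 hL1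
      (fun n hn hnv => hL n hn (hnv.trans (Nat.pow_le_pow_left ht.1.2.2.2 2)))
      (U := U (p₁, p₂, v)) (fun x hx => by
        simp only [U, Finset.mem_filter, Finset.mem_Icc] at hx
        exact ⟨hx.1.1, hx.2⟩)
    rw [mul_one_div]
    exact this
  calc ((∑ d ∈ Finset.Ico D (2 * D), (relPairs P d).card : ℕ) : ℝ) ≤ ((T.sigma U).card : ℕ) := by
        exact_mod_cast hcard
    _ = ∑ t ∈ T, ((U t).card : ℝ) := by rw [Finset.card_sigma]; push_cast; rfl
    _ ≤ ∑ t ∈ T, L ^ 2 * (2 * (Nat.sqrt D + 1) * (1 / t.2.2) + 1) := Finset.sum_le_sum hU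
    _ ≤ ∑ t ∈ P ×ˢ P ×ˢ Finset.Icc 1 V, L ^ 2 * (2 * (Nat.sqrt D + 1) * (1 / t.2.2 : ℝ) + 1) :=
        Finset.sum_le_sum_of_subset_of_nonneg (Finset.filter_subset _ _)
          fun _ _ _ => by positivity
    _ = P.card ^ 2 * (L ^ 2 * (2 * (Nat.sqrt D + 1) * (∑ v ∈ Finset.Icc 1 V, (1 : ℝ) / v) + V)) := by
        simp only [Finset.sum_product, Finset.sum_const]
        rw [← Finset.mul_sum, Finset.sum_add_distrib, ← Finset.mul_sum]
        simp; ring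
    _ ≤ Z ^ 2 * (L ^ 2 * (2 * (Nat.sqrt D + 1) * L + L * V)) := by
        have : (P.card : ℝ) ≤ Z := by exact_mod_cast card_oddPrimesLE_le Z
        have h2 : (V : ℝ) ≤ L * V := le_mul_of_one_le_left (Nat.cast_nonneg V) hL1
        gcongr
    _ = _ := by ring

/-- Counting solutions of the congruence `a x³ ≡ b (mod v)` with `x` prime to `v`. -/
theorem card_cube_congr_le {v Z : ℕ} (hv : 0 < v) (a b : ℕ) {L : ℝ} (hL1 : 1 ≤ L)
    (hL : ∀ n, n ≠ 0 → n ≤ v → (n.divisors.card : ℝ) ≤ L) {S : Finset ℕ}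
    (hS : ∀ x ∈ S, 1 ≤ x ∧ x ≤ Z ∧ Nat.Coprime x v ∧ (v : ℤ) ∣ a * (x : ℤ) ^ 3 - b) :
    (S.card : ℝ) ≤ L ^ 2 * (Z * (Nat.gcd b v / v) + 1) := by
  classical
  rcases S.eq_empty_or_nonempty with rfl | ⟨x₀, hx₀⟩
  · simp; positivity
  obtain ⟨-, -, hc₀, hd₀⟩ := hS x₀ hx₀
  obtain ⟨g, hg⟩ : ∃ g, g = Nat.gcd b v := ⟨_, rfl⟩
  rw [← hg]
  have hgpos : 0 < g := hg ▸ Nat.gcd_pos_of_pos_right _ hv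
  have hgv : g ∣ v := hg ▸ Nat.gcd_dvd_right _ _
  have hgb : g ∣ b := hg ▸ Nat.gcd_dvd_left _ _
  obtain ⟨m, hm⟩ := hgv
  have hga : g ∣ a := by
    have h1 : (g : ℤ) ∣ a * (x₀ : ℤ) ^ 3 := by
      have h2 : (g : ℤ) ∣ a * (x₀ : ℤ) ^ 3 - b :=
        (Int.natCast_dvd_natCast.mpr ⟨m, hm⟩).trans hd₀
      have h3 : (g : ℤ) ∣ b := Int.natCast_dvd_natCast.mpr hgb
      simpa using dvd_add h2 h3
    have h1' : g ∣ a * x₀ ^ 3 := by exact_mod_cast h1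
    have hcop : Nat.Coprime g (x₀ ^ 3) :=
      ((Nat.Coprime.coprime_dvd_right ⟨m, hm⟩ hc₀).pow_left 3).symm
    exact hcop.dvd_of_dvd_mul_right h1'
  obtain ⟨a₁, ha₁⟩ := hga
  have hm0 : m ≠ 0 := by rintro rfl; omega
  have hgcd : Nat.Coprime a₁ m := by
    have h1 : g * Nat.gcd a₁ m ∣ g := by
      have h2 : g * Nat.gcd a₁ m ∣ v := by rw [hm]; exact mul_dvd_mul_left _ (Nat.gcd_dvd_right _ _)
      have h3 : g * Nat.gcd a₁ m ∣ a := by rw [ha₁]; exact mul_dvd_mul_left _ (Nat.gcd_dvd_left _ _)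
      have h4 : g * Nat.gcd a₁ m ∣ b := by
        have h5 := (Int.natCast_dvd_natCast.mpr h2).trans hd₀
        have h6 : ((g * Nat.gcd a₁ m : ℕ) : ℤ) ∣ a * (x₀ : ℤ) ^ 3 :=
          (Int.natCast_dvd_natCast.mpr h3).mul_right _
        have := dvd_sub h6 h5
        rw [sub_sub_cancel] at this
        exact_mod_cast this
      exact (Nat.dvd_gcd h4 h2).trans hg.symm.dvd
    have := Nat.le_of_dvd hgpos h1
    have h6 : 0 < Nat.gcd a₁ m := Nat.gcd_pos_of_pos_right _ (Nat.pos_of_ne_zero hm0)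
    have : Nat.gcd a₁ m ≤ 1 := by
      by_contra hlt
      nlinarith
    exact le_antisymm this h6
  have hcop : IsCoprime ((x₀ : ℤ) ^ 3) (m : ℤ) := by
    apply IsCoprime.pow_left
    exact Nat.isCoprime_iff_coprime.mpr (Nat.Coprime.coprime_dvd_right ⟨g, by rw [hm, mul_comm]⟩ hc₀)
  have h := card_pow_congr_le (k := 3) (Or.inr rfl) hm0 _ hcop
    (S.image fun x : ℕ => (x : ℤ)) 0 Z (by
      intro y hy
      obtain ⟨x, hx, rfl⟩ := Finset.mem_image.mp hy
      obtain ⟨h1, h2, h3, h4⟩ := hS x hx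
      refine ⟨by omega, by omega, ?_⟩
      have h5 := dvd_sub h4 hd₀
      have h6 : (g : ℤ) * m ∣ g * (a₁ * ((x : ℤ) ^ 3 - (x₀ : ℤ) ^ 3)) := by
        have e1 : (v : ℤ) = g * m := by exact_mod_cast hm
        have e2 : (a : ℤ) = g * a₁ := by exact_mod_cast ha₁
        have e3 : (g : ℤ) * (a₁ * ((x : ℤ) ^ 3 - (x₀ : ℤ) ^ 3)) =
            a * (x : ℤ) ^ 3 - b - (a * (x₀ : ℤ) ^ 3 - b) := by rw [e2]; ring
        rw [← e1, e3]
        exact h5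
      have h7 := Int.dvd_of_mul_dvd_mul_left (by exact_mod_cast hgpos.ne') h6
      exact (Nat.isCoprime_iff_coprime.mpr hgcd).symm.dvd_of_dvd_mul_left h7)
  rw [Finset.card_image_of_injective _ Nat.cast_injective] at h
  have hτ : (m.divisors.card : ℝ) ≤ L :=
    hL m hm0 (by rw [hm]; exact Nat.le_mul_of_pos_left _ hgpos)
  have hg' : (0 : ℝ) < g := by exact_mod_cast hgpos
  have hm' : (0 : ℝ) < m := by exact_mod_cast Nat.pos_of_ne_zero hm0
  calc (S.card : ℝ) ≤ (m.divisors.card ^ 2 * (Z / m + 1) : ℕ) := by exact_mod_cast h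
    _ ≤ L ^ 2 * ((Z : ℝ) / m + 1) := by
        rw [Nat.cast_mul, Nat.cast_pow, Nat.cast_add, Nat.cast_one]
        exact mul_le_mul (pow_le_pow_left₀ (Nat.cast_nonneg _) hτ 2)
          (add_le_add_left (natCast_div_le_real Z m) 1) (by positivity) (by positivity)
    _ = _ := by
        have h8 : (v : ℝ) = g * m := by exact_mod_cast hm
        rw [h8, div_mul_eq_div_div, div_self hg'.ne', mul_one_div]

theorem sum_gcd_div_le (w V : ℕ) (hw : w ≠ 0) :
    ∑ v ∈ Finset.Icc 1 V, ((Nat.gcd w v : ℕ) : ℝ) / v ≤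
      w.divisors.card * ∑ v ∈ Finset.Icc 1 V, (1 : ℝ) / v := by
  classical
  have h1 : ∀ v ∈ Finset.Icc 1 V, ((Nat.gcd w v : ℕ) : ℝ) / v ≤
      ∑ g ∈ w.divisors, if g ∣ v then (g : ℝ) / v else 0 := by
    intro v _
    have := Finset.single_le_sum (f := fun g => if g ∣ v then (g : ℝ) / v else 0)
      (fun g _ => by split_ifs <;> positivity)
      (Nat.mem_divisors.mpr ⟨Nat.gcd_dvd_left w v, hw⟩)
    simpa [Nat.gcd_dvd_right] using this
  refine (Finset.sum_le_sum h1).trans ?_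
  rw [Finset.sum_comm, ← nsmul_eq_mul]
  refine Finset.sum_le_card_nsmul _ _ _ fun g hg => ?_
  have hg0 : 0 < g := Nat.pos_of_mem_divisors hg
  rw [← Finset.sum_filter]
  have hinj : Set.InjOn (fun v => v / g) ((Finset.Icc 1 V).filter fun v => g ∣ v : Finset ℕ) := by
    intro x hx y hy h
    have hx' := (Finset.mem_filter.mp (Finset.mem_coe.mp hx)).2
    have hy' := (Finset.mem_filter.mp (Finset.mem_coe.mp hy)).2
    rw [← Nat.div_mul_cancel hx', ← Nat.div_mul_cancel hy']
    exact congrArg (· * g) h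
  calc ∑ v ∈ (Finset.Icc 1 V).filter (fun v => g ∣ v), (g : ℝ) / v
      = ∑ v ∈ (Finset.Icc 1 V).filter (fun v => g ∣ v), (1 : ℝ) / ((v / g : ℕ) : ℝ) := by
        refine Finset.sum_congr rfl fun v hv => ?_
        rw [Nat.cast_div (Finset.mem_filter.mp hv).2 (by positivity), one_div_div]
    _ = ∑ k ∈ ((Finset.Icc 1 V).filter (fun v => g ∣ v)).image (fun v => v / g), (1 : ℝ) / k :=
        (Finset.sum_image (f := fun k : ℕ => (1 : ℝ) / k) hinj).symm
    _ ≤ _ := by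
        refine Finset.sum_le_sum_of_subset_of_nonneg ?_ fun _ _ _ => by positivity
        intro k hk
        obtain ⟨v, hv, rfl⟩ := Finset.mem_image.mp hk
        obtain ⟨hv1, hv2⟩ := Finset.mem_filter.mp hv
        rw [Finset.mem_Icc] at hv1 ⊢
        exact ⟨Nat.div_pos (Nat.le_of_dvd (by omega) hv2) hg0, (Nat.div_le_self _ _).trans hv1.2⟩

theorem TripleRel.exists_nat {d p₁ p₂ p₃ : ℕ} (hp₁ : p₁.Prime) (hp₂ : p₂.Prime) (hp₃ : p₃.Prime)
    (h₂₃ : p₂ ≠ p₃) (h : TripleRel d p₁ p₂ p₃) :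
    ∃ v v' n : ℕ, ∃ u u' : ℤ, 0 < v ∧ 0 < v' ∧ 0 < n ∧ p₁.Coprime v ∧ p₂.Coprime v ∧
      u ^ 2 + d * (v : ℤ) ^ 2 = 4 * ((p₁ : ℤ) * p₂) ^ 3 ∧
      u' ^ 2 + d * (v' : ℤ) ^ 2 = 4 * ((p₁ : ℤ) * p₃) ^ 3 ∧
      u * v' - v * u' = 2 * (p₁ : ℤ) ^ 3 * n ∧
      2 * ((p₂ : ℤ) ^ 3 * v' ^ 2 - (p₃ : ℤ) ^ 3 * v ^ 2) ≠ 0 ∧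
      (n : ℤ) ∣ 2 * ((p₂ : ℤ) ^ 3 * v' ^ 2 - (p₃ : ℤ) ^ 3 * v ^ 2) ∧
      (v : ℤ) ∣ ((4 * n ^ 2 : ℕ) : ℤ) * (p₁ : ℤ) ^ 3 - ((4 * v' ^ 2 * p₂ ^ 3 : ℕ) : ℤ) := by
  obtain ⟨u, v, u', v', w, he, hv, hv1, hv2, he', hv', -, -, hw⟩ := h
  lift v to ℕ using hv.le
  lift v' to ℕ using hv'.le
  have hv0 : 0 < v := by exact_mod_cast hv
  have hv0' : 0 < v' := by exact_mod_cast hv'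
  have c1 : p₁.Coprime v := hp₁.coprime_iff_not_dvd.mpr (by exact_mod_cast hv1)
  have c2 : p₂.Coprime v := hp₂.coprime_iff_not_dvd.mpr (by exact_mod_cast hv2)
  have hp0 : (p₁ : ℤ) ^ 3 ≠ 0 := pow_ne_zero 3 (by exact_mod_cast hp₁.ne_zero)
  have hM : 2 * ((p₂ : ℤ) ^ 3 * v' ^ 2 - (p₃ : ℤ) ^ 3 * v ^ 2) ≠ 0 := by
    intro h0
    have h1 : (p₂ : ℤ) ^ 3 * v' ^ 2 = (p₃ : ℤ) ^ 3 * v ^ 2 := by linarith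
    have h2 : p₂ ^ 3 * v' ^ 2 = p₃ ^ 3 * v ^ 2 := by exact_mod_cast h1
    have h3 : p₂ ∣ p₃ ^ 3 * v ^ 2 := h2 ▸ (dvd_pow_self p₂ (by norm_num)).mul_right _
    have h4 : Nat.Coprime p₂ (p₃ ^ 3 * v ^ 2) :=
      (((Nat.coprime_primes hp₂ hp₃).mpr h₂₃).pow_right 3).mul_right (c2.pow_right 2)
    exact hp₂.coprime_iff_not_dvd.mp h4 h3
  have hwM : w * (u * v' + v * u') = 2 * ((p₂ : ℤ) ^ 3 * v' ^ 2 - (p₃ : ℤ) ^ 3 * v ^ 2) := by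
    apply mul_left_cancel₀ (mul_ne_zero two_ne_zero hp0)
    linear_combination (-(u * v' + v * u')) * hw + (v' : ℤ) ^ 2 * he - (v : ℤ) ^ 2 * he'
  have hw0 : w ≠ 0 := by
    rintro rfl
    rw [zero_mul] at hwM
    exact hM hwM.symm
  have hdvd : (v : ℤ) ∣ 4 * w ^ 2 * (p₁ : ℤ) ^ 3 - 4 * v' ^ 2 * (p₂ : ℤ) ^ 3 := by
    have hcop : IsCoprime (v : ℤ) ((p₁ : ℤ) ^ 3) :=
      ((Nat.isCoprime_iff_coprime.mpr c1).pow_left (m := 3)).symm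
    refine hcop.dvd_of_dvd_mul_left
      ⟨-2 * u * u' * v' + v * u' ^ 2 - d * v * v' ^ 2, ?_⟩
    linear_combination (-(u * v' - v * u' + 2 * (p₁ : ℤ) ^ 3 * w)) * hw + (v' : ℤ) ^ 2 * he
  have hmain : ∀ s s' : ℤ, s ^ 2 = u ^ 2 → s' ^ 2 = u' ^ 2 →
      s * v' - v * s' = 2 * (p₁ : ℤ) ^ 3 * w.natAbs → _ := fun s s' hs hs' hn =>
    (⟨v, v', w.natAbs, s, s', hv0, hv0', Int.natAbs_pos.mpr hw0, c1, c2, by rw [hs, he],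
      by rw [hs', he'], hn, hM, Int.natAbs_dvd.mpr ⟨_, hwM.symm⟩, by
        push_cast
        rw [sq_abs]
        exact hdvd⟩ : ∃ v v' n : ℕ, ∃ u u' : ℤ, 0 < v ∧ 0 < v' ∧ 0 < n ∧ p₁.Coprime v ∧
      p₂.Coprime v ∧ u ^ 2 + d * (v : ℤ) ^ 2 = 4 * ((p₁ : ℤ) * p₂) ^ 3 ∧
      u' ^ 2 + d * (v' : ℤ) ^ 2 = 4 * ((p₁ : ℤ) * p₃) ^ 3 ∧
      u * v' - v * u' = 2 * (p₁ : ℤ) ^ 3 * n ∧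
      2 * ((p₂ : ℤ) ^ 3 * v' ^ 2 - (p₃ : ℤ) ^ 3 * v ^ 2) ≠ 0 ∧
      (n : ℤ) ∣ 2 * ((p₂ : ℤ) ^ 3 * v' ^ 2 - (p₃ : ℤ) ^ 3 * v ^ 2) ∧
      (v : ℤ) ∣ ((4 * n ^ 2 : ℕ) : ℤ) * (p₁ : ℤ) ^ 3 - ((4 * v' ^ 2 * p₂ ^ 3 : ℕ) : ℤ))
  rcases Int.natAbs_eq w with h | h
  · exact hmain u u' rfl rfl (by rw [← h]; exact hw)
  · refine hmain (-u) (-u') (by ring) (by ring) ?_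
    have : (w.natAbs : ℤ) = -w := by rw [eq_neg_iff_add_eq_zero]; linarith
    rw [this]
    linear_combination -hw

theorem sum_card_relTriples_le {D Z V : ℕ} {L : ℝ} (hL1 : 1 ≤ L)
    (hV : ∀ v : ℕ, D * v ^ 2 ≤ 4 * Z ^ 6 → v ≤ V)
    (hL : ∀ n, n ≠ 0 → n ≤ 4 * (Z ^ 3 + 1) * V ^ 2 → (n.divisors.card : ℝ) ≤ L)
    (hH : ∑ v ∈ Finset.Icc 1 V, (1 : ℝ) / v ≤ L) :
    ((∑ d ∈ Finset.Ico D (2 * D), (relTriples (oddPrimesLE Z) d).card : ℕ) : ℝ) ≤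
      L ^ 5 * Z ^ 2 * (Z * V + V ^ 2) := by
  classical
  set P := oddPrimesLE Z with hP
  let M : ℕ × ℕ × ℕ × ℕ → ℤ := fun t =>
    2 * ((t.1 : ℤ) ^ 3 * t.2.2.2 ^ 2 - (t.2.1 : ℤ) ^ 3 * t.2.2.1 ^ 2)
  let B : Finset (ℕ × ℕ × ℕ × ℕ) := P ×ˢ P ×ˢ Finset.Icc 1 V ×ˢ Finset.Icc 1 V
  let T : Finset (ℕ × ℕ × ℕ × ℕ) := B.filter fun t => Nat.Coprime t.1 t.2.2.1 ∧ M t ≠ 0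
  let X : ℕ × ℕ × ℕ × ℕ → ℕ → Finset ℕ := fun t n =>
    (Finset.Icc 1 Z).filter fun x => Nat.Coprime x t.2.2.1 ∧
      (t.2.2.1 : ℤ) ∣ ((4 * n ^ 2 : ℕ) : ℤ) * (x : ℤ) ^ 3 - ((4 * t.2.2.2 ^ 2 * t.1 ^ 3 : ℕ) : ℤ)
  let U : ℕ × ℕ × ℕ × ℕ → Finset (Σ _ : ℕ, ℕ) := fun t => (M t).natAbs.divisors.sigma (X t)
  have hcard : ∑ d ∈ Finset.Ico D (2 * D), (relTriples P d).card ≤ (T.sigma U).card := by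
    rw [← Finset.card_sigma]
    refine card_le_card_of_rel (fun a b => a.2.1 = b.2.2 ∧ a.2.2.1 = b.1.1 ∧ a.2.2.2 = b.1.2.1 ∧
      0 < b.1.2.2.1 ∧ 0 < b.1.2.2.2 ∧ 0 < b.2.1 ∧ 0 < b.2.2 ∧ ∃ u u' : ℤ,
      u ^ 2 + a.1 * (b.1.2.2.1 : ℤ) ^ 2 = 4 * ((b.2.2 : ℤ) * b.1.1) ^ 3 ∧
      u' ^ 2 + a.1 * (b.1.2.2.2 : ℤ) ^ 2 = 4 * ((b.2.2 : ℤ) * b.1.2.1) ^ 3 ∧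
      u * b.1.2.2.2 - b.1.2.2.1 * u' = 2 * (b.2.2 : ℤ) ^ 3 * b.2.1) ?_ ?_
    · rintro ⟨d, p₁, p₂, p₃⟩ h
      simp only [Finset.mem_sigma, relTriples, Finset.mem_filter, Finset.mem_product,
        Finset.mem_Ico] at h
      obtain ⟨⟨hd1, hd2⟩, ⟨hp₁, hp₂, hp₃⟩, -, -, h₂₃, htr⟩ := h
      have hP₁ := mem_oddPrimesLE.mp hp₁
      obtain ⟨v, v', n, u, u', hv, hv', hn, c1, c2, he, he', hw, hM, hdM, hdv⟩ :=
        htr.exists_nat hP₁.2.2 (mem_oddPrimesLE.mp hp₂).2.2 (mem_oddPrimesLE.mp hp₃).2.2 h₂₃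
      refine ⟨⟨(p₂, p₃, v, v'), ⟨n, p₁⟩⟩, ?_, rfl, rfl, rfl, hv, hv', hn, hP₁.2.2.pos, u, u',
        he, he', hw⟩
      have m1 := le_of_pairRel hd1 hp₁ hp₂ hV (by exact_mod_cast hv) he
      have m2 := le_of_pairRel hd1 hp₁ hp₃ hV (by exact_mod_cast hv') he'
      simp only [Finset.mem_sigma, T, U, X, B, Finset.mem_filter, Finset.mem_product]
      refine ⟨⟨⟨hp₂, hp₃, m1, m2⟩, c2, hM⟩, ?_, ?_, c1, hdv⟩
      · rw [Nat.mem_divisors]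
        exact ⟨Int.natCast_dvd.mp hdM, Int.natAbs_ne_zero.mpr hM⟩
      · rw [Finset.mem_Icc]
        omega
    · rintro ⟨d, p₁, p₂, p₃⟩ - ⟨e, q₁, q₂, q₃⟩ - ⟨⟨r₂, r₃, v, v'⟩, n, r₁⟩
        ⟨h1, h2, h3, hv, hv', hn, hp, u, u', he, he', hw⟩
        ⟨h1', h2', h3', -, -, -, -, x, x', hf, hf', hw'⟩
      simp only at h1 h2 h3 h1' h2' h3' hv hv' hn hp he he' hw hf hf' hw'
      have hn0 : (n : ℤ) ≠ 0 := by positivity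
      have hv0 : (v : ℤ) ≠ 0 := by positivity
      have hv0' : (v' : ℤ) ≠ 0 := by positivity
      have hp0 : (r₁ : ℤ) ≠ 0 := by positivity
      have k1 : (2 * (r₁ : ℤ) ^ 3 * n) * (u * v' + v * u') =
          (2 * (r₁ : ℤ) ^ 3 * n) * (x * v' + v * x') := by
        linear_combination (-(u * v' + v * u')) * hw + (x * v' + v * x') * hw' +
          v' ^ 2 * he - v' ^ 2 * hf - v ^ 2 * he' + v ^ 2 * hf'
      have k2 := mul_left_cancel₀ (by positivity) k1
      have k3 : u = x := by
        have : (2 * v' : ℤ) * u = (2 * v') * x := by linear_combination k2 + hw - hw'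
        exact mul_left_cancel₀ (by positivity) this
      subst k3
      have : (d : ℤ) = e := mul_right_cancel₀ (pow_ne_zero 2 hv0) (by linarith)
      have : d = e := by exact_mod_cast this
      subst this h1 h2 h3 h1' h2' h3'
      rfl
  have hV1 : ∀ {n v : ℕ}, n ≤ v → 1 ≤ v → v ≤ V → n ≤ 4 * (Z ^ 3 + 1) * V ^ 2 := by
    intro n v h1 h2 h3
    have : V ≤ V ^ 2 := Nat.le_self_pow (by norm_num) V
    nlinarith [Nat.zero_le (Z ^ 3)]
  have hU : ∀ t ∈ T, ((U t).card : ℝ) ≤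
      L * (L ^ 2 * (Z * ((Nat.gcd (4 * t.2.2.2 ^ 2) t.2.2.1 : ℕ) / t.2.2.1) + 1)) := by
    rintro ⟨p₂, p₃, v, v'⟩ ht
    simp only [T, B, Finset.mem_filter, Finset.mem_product, Finset.mem_Icc] at ht
    obtain ⟨⟨hp₂, hp₃, hv, hv'⟩, hcop, hM⟩ := ht
    have hτ : ((M (p₂, p₃, v, v')).natAbs.divisors.card : ℝ) ≤ L := by
      refine hL _ (Int.natAbs_ne_zero.mpr hM) ?_
      zify
      have a1 : (p₂ : ℤ) ≤ Z := by exact_mod_cast (mem_oddPrimesLE.mp hp₂).2.1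
      have a2 : (p₃ : ℤ) ≤ Z := by exact_mod_cast (mem_oddPrimesLE.mp hp₃).2.1
      have a3 : (v : ℤ) ≤ V := by exact_mod_cast hv.2
      have a4 : (v' : ℤ) ≤ V := by exact_mod_cast hv'.2
      have b1 : (p₂ : ℤ) ^ 3 * v' ^ 2 ≤ Z ^ 3 * V ^ 2 := by gcongr
      have b2 : (p₃ : ℤ) ^ 3 * v ^ 2 ≤ Z ^ 3 * V ^ 2 := by gcongr
      have b3 : (0 : ℤ) ≤ (p₂ : ℤ) ^ 3 * v' ^ 2 := by positivity
      have b4 : (0 : ℤ) ≤ (p₃ : ℤ) ^ 3 * v ^ 2 := by positivity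
      have b5 : (0 : ℤ) ≤ (V : ℤ) ^ 2 := by positivity
      rw [abs_le]
      simp only [M]
      constructor <;> linarith
    have hX : ∀ n, ((X (p₂, p₃, v, v') n).card : ℝ) ≤
        L ^ 2 * (Z * ((Nat.gcd (4 * v' ^ 2) v : ℕ) / v) + 1) := by
      intro n
      have := card_cube_congr_le (v := v) (Z := Z) (by omega) (4 * n ^ 2) (4 * v' ^ 2 * p₂ ^ 3) hL1
        (fun m hm hmv => hL m hm (hV1 hmv hv.1 hv.2)) (S := X (p₂, p₃, v, v') n) (fun x hx => by
          simp only [X, Finset.mem_filter, Finset.mem_Icc] at hx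
          exact ⟨hx.1.1, hx.1.2, hx.2⟩)
      rwa [Nat.Coprime.gcd_mul_right_cancel _ (hcop.pow_left 3)] at this
    rw [Finset.card_sigma]
    push_cast
    refine (Finset.sum_le_card_nsmul _ _ _ fun n _ => hX n).trans ?_
    rw [nsmul_eq_mul]
    gcongr
  calc ((∑ d ∈ Finset.Ico D (2 * D), (relTriples P d).card : ℕ) : ℝ) ≤ ((T.sigma U).card : ℕ) := by
        exact_mod_cast hcard
    _ = ∑ t ∈ T, ((U t).card : ℝ) := by rw [Finset.card_sigma]; push_cast; rfl
    _ ≤ ∑ t ∈ T, L * (L ^ 2 * (Z * ((Nat.gcd (4 * t.2.2.2 ^ 2) t.2.2.1 : ℕ) / t.2.2.1) + 1)) :=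
        Finset.sum_le_sum hU
    _ ≤ ∑ t ∈ B, L * (L ^ 2 * (Z * (((Nat.gcd (4 * t.2.2.2 ^ 2) t.2.2.1 : ℕ) : ℝ) / t.2.2.1) + 1)) :=
        Finset.sum_le_sum_of_subset_of_nonneg (Finset.filter_subset _ _)
          fun _ _ _ => by positivity
    _ = P.card ^ 2 * (L ^ 3 * (Z * (∑ v' ∈ Finset.Icc 1 V, ∑ v ∈ Finset.Icc 1 V,
          ((Nat.gcd (4 * v' ^ 2) v : ℕ) : ℝ) / v) + V ^ 2)) := by
        simp only [B, Finset.sum_product, Finset.sum_const]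
        rw [Finset.sum_comm (s := Finset.Icc 1 V) (t := Finset.Icc 1 V)]
        simp only [← Finset.mul_sum, Finset.sum_add_distrib]
        simp; ring
    _ ≤ Z ^ 2 * (L ^ 3 * (Z * (V * (L * L)) + L ^ 2 * V ^ 2)) := by
        have : (P.card : ℝ) ≤ Z := by exact_mod_cast card_oddPrimesLE_le Z
        have h2 : (V : ℝ) ^ 2 ≤ L ^ 2 * V ^ 2 :=
          le_mul_of_one_le_left (by positivity) (one_le_pow₀ hL1)
        have h3 : ∑ v' ∈ Finset.Icc 1 V, ∑ v ∈ Finset.Icc 1 V,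
            ((Nat.gcd (4 * v' ^ 2) v : ℕ) : ℝ) / v ≤ V * (L * L) := by
          refine (Finset.sum_le_card_nsmul _ _ (L * L) fun v' hv' => ?_).trans ?_
          · rw [Finset.mem_Icc] at hv'
            have hne : 4 * v' ^ 2 ≠ 0 := by
              have : 0 < v' := by omega
              positivity
            refine (sum_gcd_div_le _ V hne).trans ?_
            have := hL _ hne (by
              have : v' ^ 2 ≤ V ^ 2 := Nat.pow_le_pow_left hv'.2 2
              nlinarith [Nat.zero_le (Z ^ 3 * V ^ 2)])
            gcongr
          · simp
        gcongr
    _ = _ := by ring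

theorem card_sub_le_abs_charSum {d Z : ℕ} (hd : d ≠ 0) :
    ((oddPrimesLE Z).card : ℝ) - 2 * (splitPrimes d Z).card - d.divisors.card ≤
      |((∑ p ∈ oddPrimesLE Z, oddJacobi (-(d : ℤ)) p : ℤ) : ℝ)| := by
  classical
  have hpt : ∀ p ∈ oddPrimesLE Z, (1 : ℤ) - 2 * (if oddJacobi (-(d : ℤ)) p = 1 then 1 else 0) -
      (if p ∈ d.divisors then 1 else 0) ≤ -oddJacobi (-(d : ℤ)) p := by
    intro p hp
    obtain ⟨hp3, -, hpp⟩ := mem_oddPrimesLE.mp hp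
    have hodd : Odd p := hpp.odd_of_ne_two (by omega)
    rcases jacobiSym.trichotomy (-(d : ℤ)) p with h | h | h
    · have hdvd : p ∈ d.divisors := by
        rw [Nat.mem_divisors]
        refine ⟨?_, hd⟩
        have : NeZero p := ⟨hpp.ne_zero⟩
        rw [jacobiSym.eq_zero_iff_not_coprime, Int.neg_gcd] at h
        by_contra hn
        exact h (hpp.coprime_iff_not_dvd.mpr hn).symm
      rw [oddJacobi_apply, if_pos hodd, h, if_pos hdvd]
      norm_num
    · rw [oddJacobi_apply, if_pos hodd, h, if_pos rfl]
      split_ifs <;> norm_num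
    · rw [oddJacobi_apply, if_pos hodd, h]
      split_ifs <;> norm_num
  have hsum := Finset.sum_le_sum hpt
  rw [Finset.sum_sub_distrib, Finset.sum_sub_distrib, ← Finset.mul_sum, Finset.sum_boole,
    Finset.sum_boole, Finset.sum_neg_distrib] at hsum
  have hz : ((oddPrimesLE Z).filter fun p => p ∈ d.divisors).card ≤ d.divisors.card :=
    Finset.card_le_card fun p hp => (Finset.mem_filter.mp hp).2
  have hz' : ((((oddPrimesLE Z).filter fun p => p ∈ d.divisors).card : ℤ)) ≤ d.divisors.card := by
    exact_mod_cast hz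
  have hs : (((oddPrimesLE Z).filter fun p => oddJacobi (-(d : ℤ)) p = 1).card : ℤ) =
    (splitPrimes d Z).card := rfl
  rw [hs] at hsum
  have key : ((oddPrimesLE Z).card : ℤ) - 2 * (splitPrimes d Z).card - d.divisors.card ≤
      |∑ p ∈ oddPrimesLE Z, oddJacobi (-(d : ℤ)) p| := by
    have := neg_le_abs (∑ p ∈ oddPrimesLE Z, oddJacobi (-(d : ℤ)) p)
    simp only [Finset.sum_const, nsmul_eq_mul, mul_one] at hsum
    linarith
  exact_mod_cast key

/-- Squarefree `d` in `[D, 2D)` for which few odd primes up to `Z` split in `ℚ(√-d)`. -/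
def fewSplit (D Z : ℕ) : Finset ℕ :=
  (Finset.Ico D (2 * D)).filter fun d =>
    Squarefree d ∧ 4 * (splitPrimes d Z).card < (oddPrimesLE Z).card

theorem card_fewSplit_le {D Z : ℕ} {L : ℝ} (hL1 : 1 ≤ L) (hZ1 : 1 ≤ Z)
    (hL : ∀ n, n ≠ 0 → n ≤ Z ^ 12 → (n.divisors.card : ℝ) ≤ L)
    (hLD : ∀ n, n ≠ 0 → n ≤ 2 * D → (n.divisors.card : ℝ) ≤ L)
    (hZ : (Z : ℝ) ≤ L * (oddPrimesLE Z).card) (hP : 4 * L ≤ (oddPrimesLE Z).card)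
    (hbig : 64 * (4 * L ^ 2) ^ 24 * (D : ℝ) ^ 2 ≤ (Z : ℝ) ^ 12) :
    ((fewSplit D Z).card : ℝ) ≤ 8 * (4 * L ^ 2) ^ 24 := by
  set E := fewSplit D Z with hE
  set P := oddPrimesLE Z with hPdef
  have hmem : ∀ d ∈ E, d < 2 * D ∧ Squarefree d ∧ 4 * (splitPrimes d Z).card < P.card := by
    intro d hd
    simp only [hE, fewSplit, Finset.mem_filter, Finset.mem_Ico] at hd
    exact ⟨hd.1.2, hd.2⟩
  have h := card_large_charSum_le (E := E) (D := D) (Z := Z) (k := 12) (by decide) (L := L)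
    (fun d hd => ⟨(hmem d hd).2.1, (hmem d hd).1.le⟩) hZ1 hL (W := P.card / 4) (by positivity)
    (by
      intro d hd
      obtain ⟨h1, h2, h3⟩ := hmem d hd
      have h4 := card_sub_le_abs_charSum (Z := Z) h2.ne_zero
      have h5 := hLD d h2.ne_zero h1.le
      have h6 : (4 : ℝ) * (splitPrimes d Z).card < P.card := by exact_mod_cast h3
      rw [← hPdef] at h4
      linarith)
  have he0 : (0 : ℝ) ≤ E.card := Nat.cast_nonneg _
  have hzpos : (1 : ℝ) ≤ Z := by exact_mod_cast hZ1
  have hz12 : (1 : ℝ) ≤ (Z : ℝ) ^ 12 := one_le_pow₀ hzpos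
  generalize (E.card : ℝ) = e at *
  generalize (P.card : ℝ) = p at *
  generalize (Z : ℝ) = z at *
  generalize (D : ℝ) = x at *
  set A := (4 * L ^ 2) ^ 24 with hA
  have hApos : 0 < A := by positivity
  have hz24 : z ^ 24 = (z ^ 12) ^ 2 := by ring
  have h1 : z ^ 24 ≤ (4 * L) ^ 24 * (p / 4) ^ 24 := by
    rw [← mul_pow]
    exact pow_le_pow_left₀ (by linarith) (by linarith) 24
  set y := z ^ 12 with hy
  have h2 : e ^ 2 * y ^ 2 ≤ A * ((2 * y) * (e * (2 * y) + e ^ 2 * (16 * x ^ 2))) := by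
    calc e ^ 2 * y ^ 2 ≤ e ^ 2 * ((4 * L) ^ 24 * (p / 4) ^ 24) := by
          rw [← hz24]; gcongr
      _ = (4 * L) ^ 24 * (e * (p / 4) ^ 12) ^ 2 := by ring
      _ ≤ (4 * L) ^ 24 * (L ^ (2 * 12) * (y + 1) * (e * (y + 1) + e ^ 2 * (16 * x ^ 2))) := by
          gcongr
      _ ≤ (4 * L) ^ 24 * (L ^ (2 * 12) * (2 * y) * (e * (2 * y) + e ^ 2 * (16 * x ^ 2))) := by
          have : y + 1 ≤ 2 * y := by linarith
          gcongr
      _ = _ := by rw [hA]; ring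
  have h3 : e ^ 2 * y ^ 2 ≤ 4 * A * e * y ^ 2 + e ^ 2 * y ^ 2 / 2 := by
    have : e ^ 2 * y * (64 * A * x ^ 2) ≤ e ^ 2 * y * y := by gcongr
    linarith
  by_contra hcon
  push Not at hcon
  have hepos : 0 < e := lt_trans (by positivity) hcon
  have hy2 : 0 < y ^ 2 := by positivity
  have : e * y ^ 2 * (8 * A) < e * y ^ 2 * e := by
    have : 0 < e * y ^ 2 := by positivity
    gcongr
  linarith

/-- The real number `L` dominates all the losses of size `D ^ o(1)` that occur for the
dyadic block `[D, 2D)`. -/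
structure LossBound (D : ℕ) (L : ℝ) : Prop where
  one_le : 1 ≤ L
  card_divisors_le : ∀ n, n ≠ 0 → n ≤ 2 ^ 14 * D ^ 5 → (n.divisors.card : ℝ) ≤ L
  le_mul_card_primes : ∀ Z, 3 ≤ Z → Z ≤ 4 * D → (Z : ℝ) ≤ L * (oddPrimesLE Z).card
  harmonic_le : ∀ V ≤ 16 * D, ∑ v ∈ Finset.Icc 1 V, (1 : ℝ) / v ≤ L
  pow_le : 64 * (4 * L ^ 2) ^ 24 ≤ (D : ℝ)

namespace LossBound

variable {D : ℕ} {L x : ℝ}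

theorem formCount_le (h : LossBound D L) (hx1 : 1 ≤ x) (hx : x ^ 36 = D) {d : ℕ} (hd0 : 0 < d)
    (hd : d < 2 * D) : (formCount d : ℝ) ≤ 4 * L * x ^ 18 := by
  have hL1 := h.one_le
  have hD : 1 ≤ D := by omega
  have hs : Nat.sqrt d ^ 2 ≤ d := Nat.sqrt_le' d
  have hle : ∀ k ∈ Finset.Icc (-(Nat.sqrt d : ℤ)) (Nat.sqrt d),
      ((d + k.natAbs ^ 2).divisors.card : ℝ) ≤ L := by
    intro k hk
    rw [Finset.mem_Icc] at hk
    refine h.card_divisors_le _ (by omega) ?_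
    have h1 : k.natAbs ≤ Nat.sqrt d := by omega
    have h2 : k.natAbs ^ 2 ≤ Nat.sqrt d ^ 2 := Nat.pow_le_pow_left h1 2
    have h3 : D ≤ D ^ 5 := Nat.le_self_pow (by norm_num) D
    omega
  have h1 : (formCount d : ℝ) ≤ (2 * Nat.sqrt d + 1) * L := by
    rw [formCount]
    push_cast
    refine (Finset.sum_le_card_nsmul _ _ _ hle).trans ?_
    rw [Int.card_Icc, nsmul_eq_mul]
    have h2 : (((Nat.sqrt d : ℤ) + 1 - -(Nat.sqrt d : ℤ)).toNat) = 2 * Nat.sqrt d + 1 := by omega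
    rw [h2]
    push_cast
    rfl
  have h2 : (Nat.sqrt d : ℝ) ≤ 3 / 2 * x ^ 18 := by
    refine le_of_pow_le_pow_left₀ two_ne_zero (by positivity) ?_
    have h3 : ((Nat.sqrt d : ℝ)) ^ 2 ≤ d := by exact_mod_cast hs
    have h4 : (d : ℝ) ≤ 2 * D := by exact_mod_cast hd.le
    have h5 : (0 : ℝ) ≤ x ^ 36 := by positivity
    calc _ ≤ 2 * x ^ 36 := by rw [hx]; linarith
      _ ≤ 9 / 4 * x ^ 36 := by linarith
      _ = _ := by ring
  have h3 : 1 ≤ x ^ 18 := one_le_pow₀ hx1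
  calc _ ≤ _ := h1
    _ ≤ (2 * (3 / 2 * x ^ 18) + x ^ 18) * L := by gcongr
    _ = _ := by ring

theorem le_base (h : LossBound D L) (hx1 : 1 ≤ x) (hx : x ^ 36 = D) : 4 * L ^ 2 ≤ x ^ 9 := by
  have hL1 := h.one_le
  have h1 : 1 ≤ 4 * L ^ 2 := by nlinarith
  refine le_of_pow_le_pow_left₀ (n := 4) (by norm_num) (by positivity) ?_
  have h2 : (4 * L ^ 2) ^ 4 ≤ (4 * L ^ 2) ^ 24 := pow_le_pow_right₀ h1 (by norm_num)
  have h3 : 0 ≤ (4 * L ^ 2) ^ 24 := by positivity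
  calc (4 * L ^ 2) ^ 4 ≤ D := by linarith [h.pow_le]
    _ = (x ^ 9) ^ 4 := by rw [← hx]; ring

/-- `Z` is an admissible number of auxiliary primes of size `y`. -/
theorem le_mul_card (h : LossBound D L) (hx1 : 1 ≤ x) (hx : x ^ 36 = D) {y : ℝ} {Z : ℕ}
    (hy : x ^ 9 ≤ y) (hy' : y ≤ x ^ 13) (hZ : y ≤ Z) (hZ' : (Z : ℝ) ≤ 2 * y) :
    (Z : ℝ) ≤ L * (oddPrimesLE Z).card ∧ 1 ≤ Z ∧ 4 * L ≤ (oddPrimesLE Z).card := by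
  have hL1 := h.one_le
  have hb := h.le_base hx1 hx
  have h4 : (4 : ℝ) ≤ Z := by nlinarith
  have h4' : 4 ≤ Z := by exact_mod_cast h4
  have hx13 : x ^ 13 ≤ x ^ 36 := pow_le_pow_right₀ hx1 (by norm_num)
  have hZD : (Z : ℝ) ≤ 4 * D := by
    rw [← hx]
    have : 0 ≤ x ^ 36 := by positivity
    linarith
  have h5 := h.le_mul_card_primes Z (by omega) (by exact_mod_cast hZD)
  refine ⟨h5, by omega, ?_⟩
  have h6 : L * (4 * L) ≤ L * (oddPrimesLE Z).card := by nlinarith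
  exact le_of_mul_le_mul_left h6 (by linarith)

theorem card_fewSplit_le (h : LossBound D L) (hx1 : 1 ≤ x) (hx : x ^ 36 = D) {y : ℝ} {Z : ℕ}
    (hy : x ^ 9 ≤ y) (hy' : y ≤ x ^ 13) (hZ : y ≤ Z) (hZ' : (Z : ℝ) ≤ 2 * y) :
    ((fewSplit D Z).card : ℝ) ≤ 8 * (4 * L ^ 2) ^ 24 := by
  obtain ⟨h1, h2, h3⟩ := h.le_mul_card hx1 hx hy hy' hZ hZ'
  have hy0 : 0 ≤ y := le_trans (by positivity) hy
  refine _root_.card_fewSplit_le h.one_le h2 (fun n hn hnZ => h.card_divisors_le n hn ?_)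
    (fun n hn hnD => h.card_divisors_le n hn ?_) h1 h3 ?_
  · have h4 : (Z : ℝ) ^ 12 ≤ 2 ^ 14 * (D : ℝ) ^ 5 := by
      calc (Z : ℝ) ^ 12 ≤ (2 * x ^ 13) ^ 12 := by gcongr; linarith
        _ = 2 ^ 12 * x ^ 156 := by ring
        _ ≤ 2 ^ 14 * x ^ 180 := by
            gcongr
            · norm_num
            · norm_num
            · norm_num
        _ = _ := by rw [← hx]; ring
    have h5 : Z ^ 12 ≤ 2 ^ 14 * D ^ 5 := by exact_mod_cast h4
    exact hnZ.trans h5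
  · have : D ≤ D ^ 5 := Nat.le_self_pow (by norm_num) D
    omega
  · calc 64 * (4 * L ^ 2) ^ 24 * (D : ℝ) ^ 2 ≤ D * (D : ℝ) ^ 2 := by
          gcongr; exact h.pow_le
      _ = (x ^ 9) ^ 12 := by rw [← hx]; ring
      _ ≤ (Z : ℝ) ^ 12 := by gcongr; linarith

theorem hneg_le (h : LossBound D L) (hx1 : 1 ≤ x) (hx : x ^ 36 = D) {y : ℝ} {Z : ℕ}
    (hy : x ^ 9 ≤ y) (hy' : y ≤ x ^ 13) (hZ : y ≤ Z) (hZ' : (Z : ℝ) ≤ 2 * y) {d : ℕ}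
    (hd : d ∈ Finset.Ico D (2 * D)) (hsf : Squarefree d) (hE : d ∉ fewSplit D Z) :
    (hneg 3 d : ℝ) ≤ 64 * L ^ 3 * x ^ 18 * (1 / y + (relPairs (oddPrimesLE Z) d).card / y ^ 2) ∧
    (hneg 3 d : ℝ) ^ 2 ≤ 1024 * L ^ 5 * x ^ 36 *
      (36 / y ^ 2 + 2 * (relTriples (oddPrimesLE Z) d).card / y ^ 3) := by
  have hL1 := h.one_le
  obtain ⟨h1, h2, h3⟩ := h.le_mul_card hx1 hx hy hy' hZ hZ'
  have hy0 : 0 < y := lt_of_lt_of_le (by positivity) hy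
  have hZ0 : (0 : ℝ) < Z := hy0.trans_le hZ
  have hF := h.formCount_le hx1 hx (Nat.pos_of_ne_zero hsf.ne_zero) (Finset.mem_Ico.mp hd).2
  obtain ⟨-, hp, ht⟩ := hneg_bounds hsf
  have hp' : (hneg 3 d : ℝ) * (splitPrimes d Z).card ^ 2 ≤
      formCount d * (Z + (relPairs (oddPrimesLE Z) d).card) := by exact_mod_cast hp Z
  have ht' : (hneg 3 d : ℝ) ^ 2 * (splitPrimes d Z).card ^ 3 ≤
      formCount d ^ 2 * (36 * Z + 2 * (relTriples (oddPrimesLE Z) d).card) := by exact_mod_cast ht Z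
  have hs : (oddPrimesLE Z).card ≤ 4 * (splitPrimes d Z).card := by
    by_contra hlt
    exact hE (Finset.mem_filter.mpr ⟨hd, hsf, not_le.mp hlt⟩)
  have hs' : (Z : ℝ) ≤ 4 * L * (splitPrimes d Z).card := by
    have : ((oddPrimesLE Z).card : ℝ) ≤ 4 * (splitPrimes d Z).card := by exact_mod_cast hs
    nlinarith
  generalize ((splitPrimes d Z).card : ℝ) = s at *
  have hS0 : (0 : ℝ) ≤ (relPairs (oddPrimesLE Z) d).card := Nat.cast_nonneg _
  have hT0 : (0 : ℝ) ≤ (relTriples (oddPrimesLE Z) d).card := Nat.cast_nonneg _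
  have hh0 : (0 : ℝ) ≤ hneg 3 d := Nat.cast_nonneg _
  have hF0 : (0 : ℝ) ≤ formCount d := Nat.cast_nonneg _
  generalize ((relPairs (oddPrimesLE Z) d).card : ℝ) = S at *
  generalize ((relTriples (oddPrimesLE Z) d).card : ℝ) = T at *
  generalize (formCount d : ℝ) = F at *
  generalize (hneg 3 d : ℝ) = n at *
  generalize (Z : ℝ) = z at *
  constructor
  · have k1 : n * z ^ 2 ≤ 64 * L ^ 3 * x ^ 18 * (z + S) := by
      calc n * z ^ 2 ≤ n * (4 * L * s) ^ 2 := by gcongr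
        _ = 16 * L ^ 2 * (n * s ^ 2) := by ring
        _ ≤ 16 * L ^ 2 * (F * (z + S)) := by gcongr
        _ ≤ 16 * L ^ 2 * (4 * L * x ^ 18 * (z + S)) := by gcongr
        _ = _ := by ring
    calc n = n * z ^ 2 / z ^ 2 := by field_simp
      _ ≤ 64 * L ^ 3 * x ^ 18 * (z + S) / z ^ 2 := by gcongr
      _ = 64 * L ^ 3 * x ^ 18 * (1 / z + S / z ^ 2) := by field_simp
      _ ≤ _ := by gcongr
  · have k1 : n ^ 2 * z ^ 3 ≤ 1024 * L ^ 5 * x ^ 36 * (36 * z + 2 * T) := by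
      calc n ^ 2 * z ^ 3 ≤ n ^ 2 * (4 * L * s) ^ 3 := by gcongr
        _ = 64 * L ^ 3 * (n ^ 2 * s ^ 3) := by ring
        _ ≤ 64 * L ^ 3 * (F ^ 2 * (36 * z + 2 * T)) := by gcongr
        _ ≤ 64 * L ^ 3 * ((4 * L * x ^ 18) ^ 2 * (36 * z + 2 * T)) := by gcongr
        _ = _ := by ring
    calc n ^ 2 = n ^ 2 * z ^ 3 / z ^ 3 := by field_simp
      _ ≤ 1024 * L ^ 5 * x ^ 36 * (36 * z + 2 * T) / z ^ 3 := by gcongr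
      _ = 1024 * L ^ 5 * x ^ 36 * (36 / z ^ 2 + 2 * T / z ^ 3) := by field_simp
      _ ≤ _ := by gcongr

theorem sum_rel_le (h : LossBound D L) (hx1 : 1 ≤ x) (hx : x ^ 36 = D) {y t : ℝ} {Z : ℕ}
    (hy0 : 0 ≤ y) (hy' : y ≤ x ^ 13) (hZ' : (Z : ℝ) ≤ 2 * y) (ht1 : 1 ≤ t) (ht : t ≤ x ^ 21)
    (hyt : y ^ 3 = x ^ 18 * t) :
    ∑ d ∈ Finset.Ico D (2 * D), ((relPairs (oddPrimesLE Z) d).card : ℝ) ≤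
      L ^ 3 * (2 * y) ^ 2 * (4 * x ^ 18 + 16 * t) ∧
    ∑ d ∈ Finset.Ico D (2 * D), ((relTriples (oddPrimesLE Z) d).card : ℝ) ≤
      L ^ 5 * (2 * y) ^ 2 * (2 * y * (16 * t) + (16 * t) ^ 2) := by
  have hL1 := h.one_le
  have ht0 : 0 ≤ t := by linarith
  set V := ⌊16 * t⌋₊ with hVdef
  have hVt : (V : ℝ) ≤ 16 * t := Nat.floor_le (by positivity)
  have hV : ∀ v : ℕ, D * v ^ 2 ≤ 4 * Z ^ 6 → v ≤ V := by
    intro v hv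
    apply Nat.le_floor
    have h1 : (D : ℝ) * v ^ 2 ≤ 4 * Z ^ 6 := by exact_mod_cast hv
    have h2 : x ^ 36 * (v : ℝ) ^ 2 ≤ x ^ 36 * (16 * t) ^ 2 := by
      calc x ^ 36 * (v : ℝ) ^ 2 ≤ 4 * Z ^ 6 := by rw [hx]; exact h1
        _ ≤ 4 * (2 * y) ^ 6 := by gcongr
        _ = 256 * (y ^ 3) ^ 2 := by ring
        _ = _ := by rw [hyt]; ring
    exact le_of_pow_le_pow_left₀ two_ne_zero (by positivity)
      (le_of_mul_le_mul_left h2 (by positivity))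
  have hVD : V ≤ 16 * D := by
    have : (V : ℝ) ≤ 16 * D := by
      have : x ^ 21 ≤ x ^ 36 := pow_le_pow_right₀ hx1 (by norm_num)
      rw [← hx]; linarith
    exact_mod_cast this
  have hH := h.harmonic_le V hVD
  have hN : 4 * (Z ^ 3 + 1) * V ^ 2 ≤ 2 ^ 14 * D ^ 5 := by
    have h1 : (4 : ℝ) * (Z ^ 3 + 1) * V ^ 2 ≤ 2 ^ 14 * (D : ℝ) ^ 5 := by
      have h2 : (Z : ℝ) ^ 3 + 1 ≤ 9 * x ^ 39 := by
        have h3 : (Z : ℝ) ^ 3 ≤ (2 * x ^ 13) ^ 3 := by gcongr; linarith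
        have h4 : 1 ≤ x ^ 39 := one_le_pow₀ hx1
        calc _ ≤ (2 * x ^ 13) ^ 3 + x ^ 39 := by linarith
          _ = _ := by ring
      calc (4 : ℝ) * (Z ^ 3 + 1) * V ^ 2 ≤ 4 * (9 * x ^ 39) * (16 * x ^ 21) ^ 2 := by
            gcongr; linarith
        _ = 9216 * x ^ 81 := by ring
        _ ≤ 2 ^ 14 * x ^ 180 := by
            gcongr
            · norm_num
            · norm_num
        _ = _ := by rw [← hx]; ring
    exact_mod_cast h1
  have hp := sum_card_relPairs_le (D := D) (Z := Z) (V := V) hL1 hV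
    (fun n hn hnV => h.card_divisors_le n hn (by nlinarith [Nat.zero_le (Z ^ 3 * V ^ 2)])) hH
  have ht := sum_card_relTriples_le (D := D) (Z := Z) (V := V) hL1 hV
    (fun n hn hnV => h.card_divisors_le n hn (hnV.trans hN)) hH
  push_cast at hp ht
  have hsq : (Nat.sqrt D : ℝ) ≤ x ^ 18 := by
    refine le_of_pow_le_pow_left₀ two_ne_zero (by positivity) ?_
    have h1 : ((Nat.sqrt D : ℝ)) ^ 2 ≤ D := by exact_mod_cast Nat.sqrt_le' D
    calc _ ≤ _ := h1
      _ = _ := by rw [← hx]; ring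
  have hx18 : 1 ≤ x ^ 18 := one_le_pow₀ hx1
  constructor
  · have : 2 * ((Nat.sqrt D : ℝ) + 1) + V ≤ 4 * x ^ 18 + 16 * t := by linarith
    refine hp.trans ?_
    gcongr
  · refine ht.trans ?_
    gcongr

end LossBound

theorem exists_nat_between {y : ℝ} (hy : 1 ≤ y) : ∃ Z : ℕ, y ≤ Z ∧ (Z : ℝ) ≤ 2 * y :=
  ⟨⌈y⌉₊, Nat.le_ceil y, by linarith [Nat.ceil_lt_add_one (zero_le_one.trans hy)]⟩

namespace LossBound

variable {D : ℕ} {L x : ℝ}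

theorem sq_hneg_le (h : LossBound D L) (hx1 : 1 ≤ x) (hx : x ^ 36 = D) {Z₁ Z₂ Z₃ : ℕ}
    (h₁ : x ^ 9 ≤ Z₁) (h₁' : (Z₁ : ℝ) ≤ 2 * x ^ 9) (h₂ : x ^ 12 ≤ Z₂)
    (h₂' : (Z₂ : ℝ) ≤ 2 * x ^ 12) (h₃ : x ^ 13 ≤ Z₃) (h₃' : (Z₃ : ℝ) ≤ 2 * x ^ 13)
    {d : ℕ} (hd : d ∈ Finset.Ico D (2 * D)) (hsf : Squarefree d) :
    (hneg 3 d : ℝ) ^ 2 ≤ 16 * L ^ 2 * x ^ 36 * ((if d ∈ fewSplit D Z₁ then 1 else 0) +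
        (if d ∈ fewSplit D Z₂ then 1 else 0) + (if d ∈ fewSplit D Z₃ then 1 else 0)) +
      4096 * L ^ 5 * x ^ 9 * (relTriples (oddPrimesLE Z₁) d).card +
      34816 * L ^ 6 * x ^ 3 * (relPairs (oddPrimesLE Z₂) d).card +
      16384 * L ^ 6 / x ^ 2 * (relPairs (oddPrimesLE Z₃) d).card + 16384 * L ^ 6 * x ^ 10 := by
  have hL1 := h.one_le
  have hx0 : 0 < x := by linarith
  have hh0 : (0 : ℝ) ≤ hneg 3 d := Nat.cast_nonneg _
  have hT0 : (0 : ℝ) ≤ (relTriples (oddPrimesLE Z₁) d).card := Nat.cast_nonneg _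
  have hS0 : (0 : ℝ) ≤ (relPairs (oddPrimesLE Z₂) d).card := Nat.cast_nonneg _
  have hR0 : (0 : ℝ) ≤ (relPairs (oddPrimesLE Z₃) d).card := Nat.cast_nonneg _
  have hexc : (hneg 3 d : ℝ) ^ 2 ≤ 16 * L ^ 2 * x ^ 36 := by
    have h1 : (hneg 3 d : ℝ) ≤ formCount d := by exact_mod_cast (hneg_bounds hsf).1
    have h2 := h.formCount_le hx1 hx (Nat.pos_of_ne_zero hsf.ne_zero) (Finset.mem_Ico.mp hd).2
    calc (hneg 3 d : ℝ) ^ 2 ≤ (4 * L * x ^ 18) ^ 2 := by gcongr; linarith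
      _ = _ := by ring
  have hstage₁ : d ∉ fewSplit D Z₁ →
      (hneg 3 d : ℝ) ^ 2 ≤ 4096 * L ^ 5 * x ^ 9 * (relTriples (oddPrimesLE Z₁) d).card ∨
      (hneg 3 d : ℝ) ≤ 272 * L ^ 3 * x ^ 9 := by
    intro hE
    have k := (h.hneg_le hx1 hx le_rfl (pow_le_pow_right₀ hx1 (by norm_num)) h₁ h₁' hd hsf hE).2
    generalize ((relTriples (oddPrimesLE Z₁) d).card : ℝ) = T at *
    have k' : (hneg 3 d : ℝ) ^ 2 ≤ 1024 * L ^ 5 * (36 * x ^ 18 + 2 * T * x ^ 9) := by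
      refine k.trans_eq ?_
      field_simp
    rcases le_total (36 * x ^ 18) (2 * T * x ^ 9) with hc | hc
    · left
      calc _ ≤ _ := k'
        _ ≤ 1024 * L ^ 5 * (2 * T * x ^ 9 + 2 * T * x ^ 9) := by gcongr
        _ = _ := by ring
    · right
      refine le_of_pow_le_pow_left₀ two_ne_zero (by positivity) ?_
      have h5 : L ^ 5 ≤ L ^ 6 := pow_le_pow_right₀ hL1 (by norm_num)
      calc _ ≤ _ := k'
        _ ≤ 1024 * L ^ 6 * (36 * x ^ 18 + 36 * x ^ 18) := by gcongr
        _ = 73728 * (L ^ 6 * x ^ 18) := by ring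
        _ ≤ 73984 * (L ^ 6 * x ^ 18) := by gcongr; norm_num
        _ = _ := by ring
  have hstage₂ : d ∉ fewSplit D Z₂ →
      (hneg 3 d : ℝ) ≤ 128 * L ^ 3 / x ^ 6 * (relPairs (oddPrimesLE Z₂) d).card ∨
      (hneg 3 d : ℝ) ≤ 128 * L ^ 3 * x ^ 6 := by
    intro hE
    have k := (h.hneg_le hx1 hx (pow_le_pow_right₀ hx1 (by norm_num))
      (pow_le_pow_right₀ hx1 (by norm_num)) h₂ h₂' hd hsf hE).1
    generalize ((relPairs (oddPrimesLE Z₂) d).card : ℝ) = S at *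
    have k' : (hneg 3 d : ℝ) ≤ 64 * L ^ 3 * (x ^ 6 + S / x ^ 6) := by
      refine k.trans_eq ?_
      field_simp
    rcases le_total (x ^ 6) (S / x ^ 6) with hc | hc
    · left
      calc _ ≤ _ := k'
        _ ≤ 64 * L ^ 3 * (S / x ^ 6 + S / x ^ 6) := by gcongr
        _ = _ := by ring
    · right
      calc _ ≤ _ := k'
        _ ≤ 64 * L ^ 3 * (x ^ 6 + x ^ 6) := by gcongr
        _ = _ := by ring
  have hstage₃ : d ∉ fewSplit D Z₃ →
      (hneg 3 d : ℝ) ≤ 128 * L ^ 3 / x ^ 8 * (relPairs (oddPrimesLE Z₃) d).card ∨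
      (hneg 3 d : ℝ) ≤ 128 * L ^ 3 * x ^ 5 := by
    intro hE
    have k := (h.hneg_le hx1 hx (pow_le_pow_right₀ hx1 (by norm_num)) le_rfl h₃ h₃' hd hsf hE).1
    generalize ((relPairs (oddPrimesLE Z₃) d).card : ℝ) = S at *
    have k' : (hneg 3 d : ℝ) ≤ 64 * L ^ 3 * (x ^ 5 + S / x ^ 8) := by
      refine k.trans_eq ?_
      field_simp
    rcases le_total (x ^ 5) (S / x ^ 8) with hc | hc
    · left
      calc _ ≤ _ := k'
        _ ≤ 64 * L ^ 3 * (S / x ^ 8 + S / x ^ 8) := by gcongr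
        _ = _ := by ring
    · right
      calc _ ≤ _ := k'
        _ ≤ 64 * L ^ 3 * (x ^ 5 + x ^ 5) := by gcongr
        _ = _ := by ring
  generalize ((relTriples (oddPrimesLE Z₁) d).card : ℝ) = T at *
  generalize ((relPairs (oddPrimesLE Z₂) d).card : ℝ) = S at *
  generalize ((relPairs (oddPrimesLE Z₃) d).card : ℝ) = R at *
  generalize (hneg 3 d : ℝ) = n at *
  have t0 : 0 ≤ 16 * L ^ 2 * x ^ 36 := by positivity
  have t1 : 0 ≤ 4096 * L ^ 5 * x ^ 9 * T := by positivity
  have t2 : 0 ≤ 34816 * L ^ 6 * x ^ 3 * S := by positivity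
  have t3 : 0 ≤ 16384 * L ^ 6 / x ^ 2 * R := by positivity
  have t4 : 0 ≤ 16384 * L ^ 6 * x ^ 10 := by positivity
  by_cases e1 : d ∈ fewSplit D Z₁
  · rw [if_pos e1]
    split_ifs <;> linarith
  by_cases e2 : d ∈ fewSplit D Z₂
  · rw [if_neg e1, if_pos e2]
    split_ifs <;> linarith
  by_cases e3 : d ∈ fewSplit D Z₃
  · rw [if_neg e1, if_neg e2, if_pos e3]
    linarith
  rw [if_neg e1, if_neg e2, if_neg e3]
  rcases hstage₁ e1 with k1 | k1
  · linarith
  rcases hstage₂ e2 with k2 | k2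
  · have : n ^ 2 ≤ 34816 * L ^ 6 * x ^ 3 * S := by
      calc n ^ 2 = n * n := sq n
        _ ≤ (272 * L ^ 3 * x ^ 9) * (128 * L ^ 3 / x ^ 6 * S) := by gcongr
        _ = _ := by field_simp; ring
    linarith
  rcases hstage₃ e3 with k3 | k3
  · have : n ^ 2 ≤ 16384 * L ^ 6 / x ^ 2 * R := by
      calc n ^ 2 = n * n := sq n
        _ ≤ (128 * L ^ 3 * x ^ 6) * (128 * L ^ 3 / x ^ 8 * R) := by gcongr
        _ = _ := by field_simp; ring
    linarith
  · have : n ^ 2 ≤ (128 * L ^ 3 * x ^ 5) ^ 2 := by gcongr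
    have h2 : (128 * L ^ 3 * x ^ 5) ^ 2 = 16384 * L ^ 6 * x ^ 10 := by ring
    linarith

theorem sum_sq_hneg_le (h : LossBound D L) (hx1 : 1 ≤ x) (hx : x ^ 36 = D) :
    ∑ d ∈ (Finset.Ico D (2 * D)).filter Squarefree, (hneg 3 d : ℝ) ^ 2 ≤
      4 ^ 30 * L ^ 50 * x ^ 46 := by
  classical
  have hL1 := h.one_le
  have hx0 : 0 < x := by linarith
  obtain ⟨Z₁, h₁, h₁'⟩ := exists_nat_between (one_le_pow₀ (n := 9) hx1)
  obtain ⟨Z₂, h₂, h₂'⟩ := exists_nat_between (one_le_pow₀ (n := 12) hx1)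
  obtain ⟨Z₃, h₃, h₃'⟩ := exists_nat_between (one_le_pow₀ (n := 13) hx1)
  have hmono : ∀ {a b : ℕ}, a ≤ b → x ^ a ≤ x ^ b := fun hab => pow_le_pow_right₀ hx1 hab
  set Q := (Finset.Ico D (2 * D)).filter Squarefree with hQ
  have hQD : Q ⊆ Finset.Ico D (2 * D) := Finset.filter_subset _ _
  have hind : ∀ E : Finset ℕ, ∑ d ∈ Q, (if d ∈ E then (1 : ℝ) else 0) ≤ E.card := by
    intro E
    rw [Finset.sum_boole]
    exact_mod_cast Finset.card_le_card fun d hd => (Finset.mem_filter.mp hd).2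
  have hext : ∀ f : ℕ → Finset (ℕ × ℕ), ∑ d ∈ Q, ((f d).card : ℝ) ≤
      ∑ d ∈ Finset.Ico D (2 * D), ((f d).card : ℝ) := fun f =>
    Finset.sum_le_sum_of_subset_of_nonneg hQD fun _ _ _ => Nat.cast_nonneg _
  have hext' : ∀ f : ℕ → Finset (ℕ × ℕ × ℕ), ∑ d ∈ Q, ((f d).card : ℝ) ≤
      ∑ d ∈ Finset.Ico D (2 * D), ((f d).card : ℝ) := fun f =>
    Finset.sum_le_sum_of_subset_of_nonneg hQD fun _ _ _ => Nat.cast_nonneg _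
  have hE₁ := (hind _).trans
    (h.card_fewSplit_le hx1 hx le_rfl (hmono (by norm_num : 9 ≤ 13)) h₁ h₁')
  have hE₂ := (hind _).trans
    (h.card_fewSplit_le hx1 hx (hmono (by norm_num : 9 ≤ 12)) (hmono (by norm_num : 12 ≤ 13)) h₂ h₂')
  have hE₃ := (hind _).trans
    (h.card_fewSplit_le hx1 hx (hmono (by norm_num : 9 ≤ 13)) le_rfl h₃ h₃')
  have hT := (hext' _).trans (h.sum_rel_le hx1 hx (by positivity) (hmono (by norm_num : 9 ≤ 13)) h₁'
    (one_le_pow₀ (n := 9) hx1) (hmono (by norm_num : 9 ≤ 21)) (by ring)).2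
  have hS := (hext _).trans (h.sum_rel_le hx1 hx (by positivity) (hmono (by norm_num : 12 ≤ 13)) h₂'
    (one_le_pow₀ (n := 18) hx1) (hmono (by norm_num : 18 ≤ 21)) (by ring)).1
  have hR := (hext _).trans (h.sum_rel_le hx1 hx (by positivity) le_rfl h₃'
    (one_le_pow₀ (n := 21) hx1) le_rfl (by ring)).1
  have hc : (Q.card : ℝ) ≤ x ^ 36 := by
    rw [hx]
    have := Finset.card_le_card hQD
    rw [Nat.card_Ico] at this
    have h2 : Q.card ≤ D := by omega
    exact_mod_cast h2
  have hfin := Finset.sum_le_sum fun d (hd : d ∈ Q) =>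
    h.sq_hneg_le hx1 hx h₁ h₁' h₂ h₂' h₃ h₃' (hQD hd) (Finset.mem_filter.mp hd).2
  simp only [Finset.sum_add_distrib, ← Finset.mul_sum, Finset.sum_const, nsmul_eq_mul] at hfin
  refine hfin.trans ?_
  have hR' : ∑ d ∈ Q, ((relPairs (oddPrimesLE Z₃) d).card : ℝ) ≤ L ^ 3 * (80 * x ^ 47) := by
    refine hR.trans ?_
    have := hmono (by norm_num : 18 ≤ 21)
    calc L ^ 3 * (2 * x ^ 13) ^ 2 * (4 * x ^ 18 + 16 * x ^ 21)
        ≤ L ^ 3 * (2 * x ^ 13) ^ 2 * (4 * x ^ 21 + 16 * x ^ 21) := by gcongr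
      _ = _ := by ring
  have hpow : ∀ {a b : ℕ}, a ≤ 50 → b ≤ 46 → L ^ a * x ^ b ≤ L ^ 50 * x ^ 46 := fun ha hb =>
    mul_le_mul (pow_le_pow_right₀ hL1 ha) (hmono hb) (by positivity) (by positivity)
  have b0 := hpow (by norm_num : 50 ≤ 50) (by norm_num : 36 ≤ 46)
  have b1 := hpow (by norm_num : 10 ≤ 50) (by norm_num : 45 ≤ 46)
  have b2 := hpow (by norm_num : 9 ≤ 50) (by norm_num : 45 ≤ 46)
  have b3 := hpow (by norm_num : 6 ≤ 50) (by norm_num : 46 ≤ 46)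
  have bpos : 0 ≤ L ^ 50 * x ^ 46 := by positivity
  calc _ ≤ 16 * L ^ 2 * x ^ 36 * (8 * (4 * L ^ 2) ^ 24 + 8 * (4 * L ^ 2) ^ 24 +
          8 * (4 * L ^ 2) ^ 24) +
        4096 * L ^ 5 * x ^ 9 * (L ^ 5 * (2 * x ^ 9) ^ 2 * (2 * x ^ 9 * (16 * x ^ 9) +
          (16 * x ^ 9) ^ 2)) +
        34816 * L ^ 6 * x ^ 3 * (L ^ 3 * (2 * x ^ 12) ^ 2 * (4 * x ^ 18 + 16 * x ^ 18)) +
        16384 * L ^ 6 / x ^ 2 * (L ^ 3 * (80 * x ^ 47)) +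
        16384 * L ^ 6 * (x ^ 36 * x ^ 10) := by
        gcongr
    _ = 384 * 4 ^ 24 * (L ^ 50 * x ^ 36) + 4718592 * (L ^ 10 * x ^ 45) +
        2785280 * (L ^ 9 * x ^ 45) + 1310720 * (L ^ 9 * x ^ 45) + 16384 * (L ^ 6 * x ^ 46) := by
        field_simp
        ring
    _ ≤ _ := by
        rw [mul_assoc]
        linarith

end LossBound

theorem sixtyFour_mul_le_of_sq_le {C t x : ℝ} (hx : 0 < x) (ht : t ^ 48 ≤ x ^ (1 / 2 : ℝ))
    (hC : (64 * (4 * C ^ 2) ^ 24) ^ 2 ≤ x) : 64 * (4 * (C * t) ^ 2) ^ 24 ≤ x := by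
  have h0 : 0 ≤ 64 * (4 * C ^ 2) ^ 24 := by positivity
  have h1 : 64 * (4 * C ^ 2) ^ 24 ≤ x ^ (1 / 2 : ℝ) := by
    rw [← Real.sqrt_eq_rpow]
    exact Real.le_sqrt_of_sq_le hC
  have h2 : 64 * (4 * (C * t) ^ 2) ^ 24 = 64 * (4 * C ^ 2) ^ 24 * t ^ 48 := by
    rw [show 4 * (C * t) ^ 2 = 4 * C ^ 2 * t ^ 2 by ring, mul_pow _ (t ^ 2), ← pow_mul, mul_assoc]
  have h3 : x ^ (1 / 2 : ℝ) * x ^ (1 / 2 : ℝ) = x := by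
    rw [← Real.rpow_add hx, add_halves, Real.rpow_one]
  calc 64 * (4 * (C * t) ^ 2) ^ 24 = 64 * (4 * C ^ 2) ^ 24 * t ^ 48 := h2
    _ ≤ x ^ (1 / 2 : ℝ) * x ^ (1 / 2 : ℝ) := by gcongr
    _ = x := h3

open Filter in
theorem exists_lossBound {δ : ℝ} (hδ : 0 < δ) (hδ' : δ ≤ 1 / 96) :
    ∃ C : ℝ, 1 ≤ C ∧ ∃ D₀ : ℕ, ∀ D ≥ D₀, 1 ≤ D ∧ LossBound D (C * (D : ℝ) ^ δ) := by
  obtain ⟨C₁, hC₁, hτ⟩ := exists_card_divisors_le_rpow (η := δ / 19) (by positivity)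
  obtain ⟨C₂, hC₂, hP⟩ := exists_rpow_le_card_oddPrimesLE (η := δ / 3) (by positivity)
  set C := C₁ + C₂ + (1 + 5 / δ) with hC
  have hδ5 : 0 < 5 / δ := by positivity
  have hC1 : 1 ≤ C := by linarith
  obtain ⟨D₀, hD₀⟩ : ∃ D₀ : ℕ, ∀ D : ℕ, D₀ ≤ D → (64 * (4 * C ^ 2) ^ 24) ^ 2 ≤ (D : ℝ) :=
    eventually_atTop.mp (tendsto_natCast_atTop_atTop.eventually_ge_atTop _)
  refine ⟨C, hC1, max D₀ 4, fun D hD => ⟨by omega, ?_⟩⟩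
  have hD4 : 4 ≤ D := (le_max_right _ _).trans hD
  have hD4' : (4 : ℝ) ≤ D := by exact_mod_cast hD4
  have hDpos : (0 : ℝ) < D := by linarith
  have hDδ : 1 ≤ (D : ℝ) ^ δ := Real.one_le_rpow (by linarith) hδ.le
  have hpow : ∀ {y : ℝ} {k : ℕ}, 0 < k → 0 ≤ y → y ≤ (D : ℝ) ^ k → y ^ (δ / k) ≤ (D : ℝ) ^ δ := by
    intro y k hk hy hyD
    have hk' : (0 : ℝ) < k := by exact_mod_cast hk
    calc y ^ (δ / k) ≤ ((D : ℝ) ^ k) ^ (δ / k) := Real.rpow_le_rpow hy hyD (by positivity)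
      _ = (D : ℝ) ^ δ := by
        rw [← Real.rpow_natCast, ← Real.rpow_mul hDpos.le]
        congr 1
        field_simp
  constructor
  · nlinarith
  · intro n hn hnD
    refine (hτ n hn).trans ?_
    have h1 : (n : ℝ) ≤ (D : ℝ) ^ 19 := by
      have h2 : (n : ℝ) ≤ 2 ^ 14 * (D : ℝ) ^ 5 := by exact_mod_cast hnD
      calc (n : ℝ) ≤ 4 ^ 7 * (D : ℝ) ^ 5 := by norm_num at h2 ⊢; exact h2
        _ ≤ (D : ℝ) ^ 7 * (D : ℝ) ^ 5 := by gcongr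
        _ = (D : ℝ) ^ 12 := by ring
        _ ≤ (D : ℝ) ^ 19 := pow_le_pow_right₀ (by linarith) (by norm_num)
    have h3 := hpow (by norm_num : 0 < 19) (Nat.cast_nonneg n) h1
    push_cast at h3
    have : C₁ ≤ C := by linarith
    gcongr
  · intro Z hZ3 hZD
    refine (hP Z hZ3).trans ?_
    have h1 : (Z : ℝ) ≤ (D : ℝ) ^ 3 := by
      have h2 : (Z : ℝ) ≤ 4 * D := by exact_mod_cast hZD
      have h4 : (4 : ℝ) * D ≤ D * D := by gcongr
      have h5 : (D : ℝ) ^ 2 ≤ (D : ℝ) ^ 3 := pow_le_pow_right₀ (by linarith) (by norm_num)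
      linarith [sq (D : ℝ)]
    have h3 := hpow (by norm_num : 0 < 3) (Nat.cast_nonneg Z) h1
    push_cast at h3
    have : C₂ ≤ C := by linarith
    gcongr
  · intro V hV
    have h0 : ∑ v ∈ Finset.Icc 1 V, (1 : ℝ) / v = ((harmonic V : ℚ) : ℝ) := by
      rw [harmonic_eq_sum_Icc]
      push_cast
      simp only [one_div]
    have h1 : (V : ℝ) ≤ (D : ℝ) ^ 5 := by
      have h2 : (V : ℝ) ≤ 16 * D := by exact_mod_cast hV
      calc (V : ℝ) ≤ 4 ^ 2 * D := by norm_num at h2 ⊢; exact h2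
        _ ≤ (D : ℝ) ^ 2 * D := by gcongr
        _ = (D : ℝ) ^ 3 := by ring
        _ ≤ (D : ℝ) ^ 5 := pow_le_pow_right₀ (by linarith) (by norm_num)
    have h3 := hpow (by norm_num : 0 < 5) (Nat.cast_nonneg V) h1
    have h4 := Real.log_le_rpow_div (Nat.cast_nonneg V) (ε := δ / 5) (by positivity)
    push_cast at h3
    have h5 : (V : ℝ) ^ (δ / 5) / (δ / 5) ≤ 5 / δ * (D : ℝ) ^ δ := by
      rw [div_div_eq_mul_div, mul_div_assoc, mul_comm]
      gcongr
    rw [h0]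
    have h6 := harmonic_le_one_add_log V
    have h7 : (1 + 5 / δ) * (D : ℝ) ^ δ ≤ C * (D : ℝ) ^ δ := by gcongr; linarith
    linarith
  · refine sixtyFour_mul_le_of_sq_le hDpos ?_ (hD₀ D ((le_max_left _ _).trans hD))
    calc ((D : ℝ) ^ δ) ^ 48 = (D : ℝ) ^ (δ * (48 : ℕ)) := by
          rw [Real.rpow_mul hDpos.le, Real.rpow_natCast]
      _ ≤ (D : ℝ) ^ (1 / 2 : ℝ) := by
          gcongr
          · linarith
          · push_cast; linarith

theorem exists_sum_sq_hneg_block_le {ε : ℝ} (hε : 0 < ε) :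
    ∃ C : ℝ, 0 < C ∧ ∀ D : ℕ, 1 ≤ D →
      ∑ d ∈ (Finset.Ico D (2 * D)).filter Squarefree, (hneg 3 d : ℝ) ^ 2 ≤
        C * (D : ℝ) ^ ((23 : ℝ) / 18 + ε) := by
  classical
  set δ := min (ε / 50) (1 / 96) with hδdef
  have hδ : 0 < δ := lt_min (by positivity) (by norm_num)
  obtain ⟨C, hC, D₀, h⟩ := exists_lossBound hδ (min_le_right _ _)
  set B : ℕ → ℝ := fun D =>
    ∑ d ∈ (Finset.Ico D (2 * D)).filter Squarefree, (hneg 3 d : ℝ) ^ 2 with hB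
  have hB0 : ∀ D, 0 ≤ B D := fun D => Finset.sum_nonneg fun _ _ => by positivity
  set C' := ∑ D ∈ Finset.range D₀, B D with hC'
  have hC'0 : 0 ≤ C' := Finset.sum_nonneg fun D _ => hB0 D
  refine ⟨C' + 4 ^ 30 * C ^ 50, by positivity, fun D hD1 => ?_⟩
  change B D ≤ _
  have hD1' : (1 : ℝ) ≤ D := by exact_mod_cast hD1
  have hone : 1 ≤ (D : ℝ) ^ ((23 : ℝ) / 18 + ε) := Real.one_le_rpow hD1' (by positivity)
  rcases lt_or_ge D D₀ with hlt | hge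
  · calc B D ≤ C' := Finset.single_le_sum (fun D _ => hB0 D) (Finset.mem_range.mpr hlt)
      _ ≤ C' + 4 ^ 30 * C ^ 50 := by linarith [show 0 ≤ 4 ^ 30 * C ^ 50 by positivity]
      _ ≤ _ := le_mul_of_one_le_right (by positivity) hone
  · have hx1 : 1 ≤ (D : ℝ) ^ (1 / 36 : ℝ) := Real.one_le_rpow hD1' (by norm_num)
    have hx : ((D : ℝ) ^ (1 / 36 : ℝ)) ^ 36 = D := by
      rw [← Real.rpow_natCast, ← Real.rpow_mul (by linarith)]
      norm_num
    refine ((h D hge).2.sum_sq_hneg_le hx1 hx).trans ?_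
    have e1 : ((D : ℝ) ^ δ) ^ 50 ≤ (D : ℝ) ^ ε := by
      rw [← Real.rpow_natCast, ← Real.rpow_mul (by linarith)]
      refine Real.rpow_le_rpow_of_exponent_le hD1' ?_
      have := min_le_left (ε / 50) (1 / 96 : ℝ)
      push_cast
      linarith
    have e2 : ((D : ℝ) ^ (1 / 36 : ℝ)) ^ 46 = (D : ℝ) ^ ((23 : ℝ) / 18) := by
      rw [← Real.rpow_natCast, ← Real.rpow_mul (by linarith)]
      norm_num
    rw [mul_pow, e2, Real.rpow_add (by linarith)]
    calc 4 ^ 30 * (C ^ 50 * ((D : ℝ) ^ δ) ^ 50) * (D : ℝ) ^ ((23 : ℝ) / 18)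
        ≤ 4 ^ 30 * (C ^ 50 * (D : ℝ) ^ ε) * (D : ℝ) ^ ((23 : ℝ) / 18) := by gcongr
      _ = 4 ^ 30 * C ^ 50 * ((D : ℝ) ^ ((23 : ℝ) / 18) * (D : ℝ) ^ ε) := by ring
      _ ≤ _ := by
        gcongr
        linarith

theorem sum_dyadic_le {f : ℕ → ℝ} {p : ℕ → Prop} [DecidablePred p] {C s : ℝ} (hC : 0 ≤ C)
    (hs : 1 ≤ s) (hp : ¬ p 0)
    (h : ∀ D : ℕ, 1 ≤ D → ∑ d ∈ (Finset.Ico D (2 * D)).filter p, f d ≤ C * (D : ℝ) ^ s) (k : ℕ) :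
    ∑ d ∈ (Finset.range (2 ^ k)).filter p, f d ≤ C * ((2 : ℝ) ^ s) ^ k := by
  induction k with
  | zero => simpa [Finset.sum_filter, hp] using hC
  | succ k ih =>
    have hr : (2 : ℝ) ≤ 2 ^ s := by
      simpa using Real.rpow_le_rpow_of_exponent_le (one_le_two (α := ℝ)) hs
    have h1 := h (2 ^ k) Nat.one_le_two_pow
    have h2 : ((2 ^ k : ℕ) : ℝ) ^ s = ((2 : ℝ) ^ s) ^ k := by
      push_cast
      rw [← Real.rpow_natCast, ← Real.rpow_natCast, ← Real.rpow_mul (by norm_num),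
        ← Real.rpow_mul (by norm_num), mul_comm]
    rw [h2] at h1
    simp only [Finset.sum_filter] at ih h1 ⊢
    rw [Finset.range_eq_Ico] at ih ⊢
    rw [← Finset.sum_Ico_consecutive _ (Nat.zero_le (2 ^ k)) (Nat.pow_le_pow_right (by norm_num)
      (Nat.le_succ k)), show 2 ^ (k + 1) = 2 * 2 ^ k by ring]
    have hk : 0 ≤ C * ((2 : ℝ) ^ s) ^ k := by positivity
    calc _ ≤ C * ((2 : ℝ) ^ s) ^ k + C * ((2 : ℝ) ^ s) ^ k := add_le_add ih h1
      _ = C * ((2 : ℝ) ^ s) ^ k * 2 := by ring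
      _ ≤ C * ((2 : ℝ) ^ s) ^ k * 2 ^ s := by gcongr
      _ = _ := by rw [pow_succ]; ring

/-- For every `ε > 0` there is `C = C(ε)` such that for all `X ≥ 2`,
`∑_{0 < d < X, d squarefree} h_3(-d)^2 ≤ C · X^(23/18 + ε)`. -/
theorem second_moment_h3_bound (ε : ℝ) (hε : 0 < ε) :
    ∃ C : ℝ, 0 < C ∧ ∀ X : ℝ, 2 ≤ X →
      ∑ d ∈ (Finset.range (⌈X⌉₊ + 1)).filter
          (fun d : ℕ => Squarefree d ∧ 0 < d ∧ (d : ℝ) < X),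
        (hneg 3 d : ℝ) ^ 2
      ≤ C * X ^ ((23 : ℝ) / 18 + ε) := by
  obtain ⟨C, hC, hblock⟩ := exists_sum_sq_hneg_block_le hε
  set s := (23 : ℝ) / 18 + ε with hs
  have hs1 : 1 ≤ s := by linarith
  refine ⟨C * 2 ^ s, by positivity, fun X hX => ?_⟩
  obtain ⟨n, hn, hn'⟩ := exists_nat_pow_near (x := X) (y := 2) (by linarith) one_lt_two
  have h := sum_dyadic_le (p := Squarefree) hC.le hs1 not_squarefree_zero hblock (n + 1)
  calc _ ≤ ∑ d ∈ (Finset.range (2 ^ (n + 1))).filter Squarefree, (hneg 3 d : ℝ) ^ 2 := by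
        refine Finset.sum_le_sum_of_subset_of_nonneg ?_ fun _ _ _ => by positivity
        intro d hd
        obtain ⟨-, hsf, -, hdX⟩ := Finset.mem_filter.mp hd
        refine Finset.mem_filter.mpr ⟨Finset.mem_range.mpr ?_, hsf⟩
        exact_mod_cast hdX.trans hn'
    _ ≤ C * ((2 : ℝ) ^ s) ^ (n + 1) := h
    _ = C * 2 ^ s * ((2 : ℝ) ^ n) ^ s := by
        rw [pow_succ, ← Real.rpow_natCast ((2 : ℝ) ^ s), ← Real.rpow_mul (by norm_num),
          ← Real.rpow_natCast 2 n, ← Real.rpow_mul (by norm_num), mul_comm s]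
        ring
    _ ≤ _ := by gcongr
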